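/- There exists an absolute constant C > 0 such that for every graph H with at least one edge the following holds: every graph G on n vertices admits a family F of subgraphs of G, each of which is either a single edge or a subdivision of H, such that F strongly separates the edges of G and |F| ≤ C·|V(H)|²·n. -/

import Mathlib

open SimpleGraph

/-- `K` is a subdivision of `H`: there is an injection `f` from the vertices of `H`
(the branch vertices) and, for each edge of `H`, a branch path in `K` between the
images of its endpoints, such that these paths are pairwise internally disjoint,
their internal vertices avoid the branch vertices, and together they use every
vertex and edge of `K`. -/
def IsSubdivision {α β : Type*} (H : SimpleGraph α) (K : SimpleGraph β) : Prop :=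
  ∃ (f : α → β) (P : ∀ ⦃x y⦄, H.Adj x y → K.Walk (f x) (f y)),
    Function.Injective f ∧
    (∀ ⦃x y⦄ (h : H.Adj x y), (P h).IsPath) ∧
    (∀ ⦃x y⦄ (h : H.Adj x y), P h.symm = (P h).reverse) ∧
    (∀ ⦃x y⦄ (h : H.Adj x y), ∀ v ∈ (P h).support, v ∈ Set.range f → v = f x ∨ v = f y) ∧
    (∀ ⦃x y x' y'⦄ (h : H.Adj x y) (h' : H.Adj x' y'), s(x, y) ≠ s(x', y') →
      ∀ v ∈ (P h).support, v ∈ (P h').support → v ∈ Set.range f) ∧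
    (∀ v : β, v ∈ Set.range f ∨ ∃ (x y : α) (h : H.Adj x y), v ∈ (P h).support) ∧
    (∀ e ∈ K.edgeSet, ∃ (x y : α) (h : H.Adj x y), e ∈ (P h).edges)

/-- The subgraph `A` of `G` is a single edge. -/
def IsSingleEdge {V : Type*} {G : SimpleGraph V} (A : G.Subgraph) : Prop :=
  ∃ (v w : V) (h : G.Adj v w), A = G.subgraphOfAdj h

/-- The family `F` of subgraphs of `G` strongly separates the edges of `G`. -/
def StronglySeparatesEdges {V : Type*} (G : SimpleGraph V) (F : Set G.Subgraph) : Prop :=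
  ∀ e ∈ G.edgeSet, ∀ e' ∈ G.edgeSet, e ≠ e' → ∃ A ∈ F, e ∈ A.edgeSet ∧ e' ∉ A.edgeSet

namespace EdgeSep
open Classical

variable {V : Type*}

/-- `v` is reachable from `A` in `G` along a walk avoiding `S`. -/
def Reach (G : SimpleGraph V) (A S : Set V) (v : V) : Prop :=
  ∃ a ∈ A, ∃ p : G.Walk a v, ∀ w ∈ p.support, w ∉ S

/-- Every walk from `A` to `B` meets `S`. -/
def Separates (G : SimpleGraph V) (A B S : Set V) : Prop :=
  ∀ b ∈ B, ¬ Reach G A S b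

lemma Reach.of_mem {G : SimpleGraph V} {A S : Set V} {v : V} (h : v ∈ A) (h' : v ∉ S) :
    Reach G A S v := ⟨v, h, Walk.nil, by simpa⟩

lemma Reach.notMem {G : SimpleGraph V} {A S : Set V} {v : V} (h : Reach G A S v) : v ∉ S := by
  obtain ⟨a, _, p, hp⟩ := h
  exact hp _ p.end_mem_support

lemma Reach.adj {G : SimpleGraph V} {A S : Set V} {v w : V} (h : Reach G A S v)
    (hvw : G.Adj v w) (hw : w ∉ S) : Reach G A S w := by
  obtain ⟨a, ha, p, hp⟩ := h
  refine ⟨a, ha, p.concat hvw, fun u hu => ?_⟩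
  rw [Walk.support_concat] at hu
  simp only [List.mem_append, List.mem_singleton] at hu
  rcases hu with hu | rfl
  exacts [hp _ hu, hw]

/-- Induction principle for reachability. -/
lemma Reach.rec_on {G : SimpleGraph V} {A S : Set V} {C : V → Prop} {v : V} (h : Reach G A S v)
    (h0 : ∀ a ∈ A, a ∉ S → C a)
    (h1 : ∀ u w, Reach G A S u → C u → G.Adj u w → w ∉ S → C w) : C v := by
  obtain ⟨a, ha, p, hp⟩ := h
  have key : ∀ (u w : V) (q : G.Walk u w), (∀ x ∈ q.support, x ∉ S) → Reach G A S u → C u → C w := by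
    intro u w q
    induction q with
    | nil => intro _ _ h; exact h
    | cons hadj q ih =>
      intro hq hr hc
      have hS := hq _ (List.mem_cons_of_mem _ q.start_mem_support)
      exact ih (fun x hx => hq x (List.mem_cons_of_mem _ hx)) (hr.adj hadj hS)
        (h1 _ _ hr hc hadj hS)
  have haS : a ∉ S := hp _ p.start_mem_support
  exact key _ _ p hp (Reach.of_mem ha haS) (h0 a ha haS)

lemma Reach.append {G : SimpleGraph V} {A B S : Set V} {v : V} (h : Reach G A S v)
    (h' : Reach G B S v) : ∃ b ∈ B, Reach G A S b := by
  obtain ⟨a, ha, p, hp⟩ := h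
  obtain ⟨b, hb, q, hq⟩ := h'
  refine ⟨b, hb, a, ha, p.append q.reverse, fun w hw => ?_⟩
  rw [Walk.mem_support_append_iff] at hw
  rcases hw with hw | hw
  · exact hp _ hw
  · exact hq _ (by simpa using hw)

lemma Reach.symm_of {G : SimpleGraph V} {A S : Set V} {v : V} (h : Reach G A S v) :
    ∃ a ∈ A, Reach G {v} S a := by
  obtain ⟨a, ha, p, hp⟩ := h
  exact ⟨a, ha, v, rfl, p.reverse, by simpa using hp⟩

lemma Separates.symm {G : SimpleGraph V} {A B S : Set V} (h : Separates G A B S) :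
    Separates G B A S := by
  intro a ha hr
  obtain ⟨b, hb, p, hp⟩ := hr
  exact h b hb ⟨a, ha, p.reverse, by simpa using hp⟩

/-- A family, indexed by `ι`, of disjoint `A`–`B` paths, the `i`-th one inside `C i`. -/
def LinkedBy (G : SimpleGraph V) (A B : Set V) {ι : Type*} (a b : ι → V) (C : ι → Set V) : Prop :=
  Pairwise (fun i j => Disjoint (C i) (C j)) ∧ ∀ i, a i ∈ A ∧ b i ∈ B ∧
    ∃ p : G.Walk (a i) (b i), p.IsPath ∧ (∀ v, v ∈ p.support ↔ v ∈ C i) ∧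
      (∀ v ∈ C i, v ∈ A → v = a i) ∧ (∀ v ∈ C i, v ∈ B → v = b i)

lemma LinkedBy.a_mem {G : SimpleGraph V} {A B : Set V} {ι : Type*} {a b : ι → V}
    {C : ι → Set V} (h : LinkedBy G A B a b C) (i : ι) : a i ∈ C i := by
  obtain ⟨_, _, p, _, h3, _⟩ := h.2 i
  exact (h3 _).1 p.start_mem_support

lemma LinkedBy.b_mem {G : SimpleGraph V} {A B : Set V} {ι : Type*} {a b : ι → V}
    {C : ι → Set V} (h : LinkedBy G A B a b C) (i : ι) : b i ∈ C i := by
  obtain ⟨_, _, p, _, h3, _⟩ := h.2 i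
  exact (h3 _).1 p.end_mem_support

lemma LinkedBy.b_inj {G : SimpleGraph V} {A B : Set V} {ι : Type*} {a b : ι → V}
    {C : ι → Set V} (h : LinkedBy G A B a b C) : Function.Injective b := by
  intro i j hij
  by_contra hne
  exact Set.disjoint_left.1 (h.1 hne) (h.b_mem i) (hij ▸ h.b_mem j)

lemma LinkedBy.reach {G : SimpleGraph V} {A B : Set V} {ι : Type*} {a b : ι → V}
    {C : ι → Set V} (h : LinkedBy G A B a b C) {i : ι} {v : V} (hv : v ∈ C i) (hvb : v ∉ B) :
    Reach G A B v := by
  obtain ⟨h1, h2, p, hp, h3, h4, h5⟩ := h.2 i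
  have hv' := (h3 v).2 hv
  refine ⟨a i, h1, p.takeUntil v hv', fun w hw hwB => ?_⟩
  have hwC := (h3 w).1 (p.support_takeUntil_subset_support hv' hw)
  have := h5 w hwC hwB
  subst this
  exact Walk.endpoint_notMem_support_takeUntil hp hv' (by rintro rfl; exact hvb h2) hw

lemma LinkedBy.comp {G : SimpleGraph V} {A B : Set V} {ι κ : Type*} {a b : ι → V}
    {C : ι → Set V} (h : LinkedBy G A B a b C) (e : κ → ι) (he : Function.Injective e) :
    LinkedBy G A B (a ∘ e) (b ∘ e) (C ∘ e) :=
  ⟨fun _ _ hij => h.1 (he.ne hij), fun i => h.2 (e i)⟩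

lemma Reach.mono {G G' : SimpleGraph V} (hG : G ≤ G') {A S S' : Set V} (hS : S' ⊆ S) {v : V}
    (h : Reach G A S v) : Reach G' A S' v := by
  obtain ⟨a, ha, p, hp⟩ := h
  exact ⟨a, ha, p.mapLe hG, fun w hw hmem => hp w (by simpa using hw) (hS hmem)⟩

/-- A linkage onto a set of the same size can be indexed by that set. -/
lemma LinkedBy.index {G : SimpleGraph V} {A : Set V} {P : Finset V} {ι : Type*} [Fintype ι]
    {a b : ι → V} {C : ι → Set V} (h : LinkedBy G A P a b C) (hc : P.card = Fintype.card ι) :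
    ∃ (a' : P → V) (C' : P → Set V), LinkedBy G A P a' (fun x => x.1) C' := by
  let f : ι → P := fun i => ⟨b i, (h.2 i).2.1⟩
  have hf : Function.Injective f := fun i j hij => h.b_inj (congrArg Subtype.val hij)
  have hb : Function.Bijective f :=
    (Fintype.bijective_iff_injective_and_card f).2 ⟨hf, by simp [hc]⟩
  let e := Equiv.ofBijective f hb
  have := h.comp e.symm e.symm.injective
  refine ⟨a ∘ e.symm, C ∘ e.symm, ?_⟩
  have hbe : (fun x : P => x.1) = b ∘ e.symm := by
    funext x
    exact (congrArg Subtype.val (e.apply_symm_apply x)).symm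
  rw [hbe]
  exact this

/-- Menger's theorem. -/
theorem menger [Finite V] (G : SimpleGraph V) (A B : Set V) (ι : Type) [Fintype ι]
    (h : ∀ S : Finset V, Separates G A B S → Fintype.card ι ≤ S.card) :
    ∃ a b C, LinkedBy G A B (ι := ι) a b C := by
  have := Fintype.ofFinite V
  induction hn : G.edgeSet.ncard using Nat.strong_induction_on generalizing G A B ι with
  | _ n ih =>
  by_cases hE : G.edgeSet = ∅
  · have hbot : G = ⊥ := by simpa using hE
    subst hbot
    have hs : Separates (⊥ : SimpleGraph V) A B ((A ∩ B).toFinset : Finset V) := by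
      intro b hb ⟨a, ha, p, hp⟩
      cases p with
      | nil => exact hp b (by simp) (by simp [ha, hb])
      | cons h _ => exact h.elim
    have hcard := h _ hs
    obtain ⟨f⟩ : Nonempty (ι ↪ (A ∩ B).toFinset) :=
      Function.Embedding.nonempty_of_card_le (by rwa [Fintype.card_coe])
    have hf : ∀ i, (f i).1 ∈ A ∧ (f i).1 ∈ B := fun i => by
      have := (f i).2
      rwa [Set.mem_toFinset] at this
    refine ⟨fun i => (f i).1, fun i => (f i).1, fun i => {(f i).1}, ?_, fun i =>
      ⟨(hf i).1, (hf i).2, Walk.nil, by simp, by simp, by simp, by simp⟩⟩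
    intro i j hij
    simp only [Set.disjoint_singleton]
    exact fun h => hij (f.injective (Subtype.ext h))
  obtain ⟨e, he⟩ := Set.nonempty_iff_ne_empty.2 hE
  induction e using Sym2.ind with
  | _ x y =>
  have hxy : G.Adj x y := he
  obtain ⟨G', hG'⟩ : ∃ G', G' = G.deleteEdges {s(x, y)} := ⟨_, rfl⟩
  have hle : G' ≤ G := hG' ▸ G.deleteEdges_le _
  have hadj : ∀ u v, G.Adj u v → ¬ G'.Adj u v → (u = x ∧ v = y) ∨ (u = y ∧ v = x) := by
    intro u v h1 h2
    rw [hG', deleteEdges_adj] at h2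
    simp only [h1, true_and, not_not, Set.mem_singleton_iff, Sym2.eq_iff] at h2
    exact h2
  have hlt : G'.edgeSet.ncard < n := by
    rw [← hn]
    apply Set.ncard_lt_ncard _ (Set.toFinite _)
    refine ⟨edgeSet_mono hle, fun hsub => ?_⟩
    have : s(x, y) ∈ G'.edgeSet := hsub he
    simp [hG'] at this
  clear hG' he
  by_cases hsep : ∀ S : Finset V, Separates G' A B S → Fintype.card ι ≤ S.card
  · obtain ⟨a, b, C, h1, h2⟩ := ih _ hlt G' A B ι hsep rfl
    refine ⟨a, b, C, h1, fun i => ?_⟩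
    obtain ⟨ha, hb, p, hp, h3, h4⟩ := h2 i
    exact ⟨ha, hb, p.mapLe hle, by simpa using hp, by simpa using h3, h4⟩
  push Not at hsep
  obtain ⟨S, hS, hSc⟩ := hsep
  -- by symmetry `x` is on the `A`-side and `y` is not
  wlog hx : Reach G' A S x ∧ ¬ Reach G' A S y generalizing x y
  · refine this y x hxy.symm (fun u v h1 h2 => (hadj u v h1 h2).symm) ?_
    by_contra hcon
    refine absurd (h S ?_) (not_le.2 hSc)
    intro b hb hr
    refine hS b hb (hr.rec_on (fun a ha haS => Reach.of_mem ha haS) fun u w _ hu huw hw => ?_)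
    by_cases h' : G'.Adj u w
    · exact hu.adj h' hw
    · rcases hadj u w huw h' with ⟨rfl, rfl⟩ | ⟨rfl, rfl⟩ <;> tauto
  obtain ⟨hxR, hyR⟩ := hx
  have hxS := hxR.notMem
  have hxB : ¬ Reach G' B S x := fun hr => by
    obtain ⟨b, hb, hb'⟩ := hxR.append hr
    exact hS b hb hb'
  have hP : ∀ R : Finset V, Separates G' A (insert x S : Finset V) R → Separates G A B R := by
    intro R hR b hb hr
    have hR1 : ∀ v, Reach G' A R v → Reach G' A S v := fun v hv =>
      hv.rec_on (fun a ha haR => Reach.of_mem ha fun haS =>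
        hR a (by simp at haS; simp [haS]) (Reach.of_mem ha haR)) fun u w hu hu' huw hw =>
        hu'.adj huw fun hwS => hR w (by simp at hwS; simp [hwS]) (hu.adj huw hw)
    have : Reach G' A R b := hr.rec_on (fun a ha haS => Reach.of_mem ha haS) fun u w _ hu huw hw => by
      by_cases h' : G'.Adj u w
      · exact hu.adj h' hw
      · rcases hadj u w huw h' with ⟨rfl, rfl⟩ | ⟨rfl, rfl⟩
        · exact (hR _ (by simp) hu).elim
        · exact (hyR (hR1 _ hu)).elim
    exact hS b hb (hR1 b this)
  have hQ : ∀ R : Finset V, Separates G' B (insert y S : Finset V) R → Separates G A B R := by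
    intro R hR
    apply Separates.symm
    intro b hb hr
    have hR1 : ∀ v, Reach G' B R v → Reach G' B S v := fun v hv =>
      hv.rec_on (fun a ha haR => Reach.of_mem ha fun haS =>
        hR a (by simp at haS; simp [haS]) (Reach.of_mem ha haR)) fun u w hu hu' huw hw =>
        hu'.adj huw fun hwS => hR w (by simp at hwS; simp [hwS]) (hu.adj huw hw)
    have : Reach G' B R b := hr.rec_on (fun a ha haS => Reach.of_mem ha haS) fun u w _ hu huw hw => by
      by_cases h' : G'.Adj u w
      · exact hu.adj h' hw
      · rcases hadj u w huw h' with ⟨rfl, rfl⟩ | ⟨rfl, rfl⟩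
        · exact (hxB (hR1 _ hu)).elim
        · exact (hR _ (by simp) hu).elim
    exact hS.symm b hb (hR1 b this)
  have hsepself : ∀ (D : Set V) (P : Finset V), Separates G' D P P :=
    fun D P b hb hr => hr.notMem hb
  have hPc : (insert x S).card = Fintype.card ι :=
    le_antisymm ((Finset.card_insert_le _ _).trans hSc) (h _ (hP _ (hsepself A _)))
  have hQc : (insert y S).card = Fintype.card ι :=
    le_antisymm ((Finset.card_insert_le _ _).trans hSc) (h _ (hQ _ (hsepself B _)))
  have hyS : y ∉ S := fun hy => by
    rw [Finset.insert_eq_of_mem hy] at hQc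
    omega
  obtain ⟨a1, b1, C1, hC1⟩ := ih _ hlt G' A (insert x S : Finset V) ι
    (fun R hR => h R (hP R hR)) rfl
  obtain ⟨a2, b2, C2, hC2⟩ := ih _ hlt G' B (insert y S : Finset V) ι
    (fun R hR => h R (hQ R hR)) rfl
  obtain ⟨a1, C1, hC1⟩ := hC1.index hPc
  obtain ⟨a2, C2, hC2⟩ := hC2.index hQc
  have hcross : ∀ i j v, v ∈ C1 i → v ∈ C2 j → v = i.1 ∧ v = j.1 ∧ v ∈ S := by
    intro i j v h1 h2
    by_cases hvP : v ∈ insert x S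
    · have hvi : v = i.1 := (hC1.2 i).2.2.choose_spec.2.2.2 v h1 hvP
      by_cases hvQ : v ∈ insert y S
      · have hvj : v = j.1 := (hC2.2 j).2.2.choose_spec.2.2.2 v h2 hvQ
        refine ⟨hvi, hvj, ?_⟩
        rcases Finset.mem_insert.1 hvP with rfl | h3
        · rcases Finset.mem_insert.1 hvQ with rfl | h4
          · exact (hxy.ne rfl).elim
          · exact h4
        · exact h3
      · exfalso
        have hvx : v = x := by
          rcases Finset.mem_insert.1 hvP with h3 | h3
          · exact h3
          · exact (hvQ (Finset.mem_insert_of_mem h3)).elim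
        subst hvx
        exact hxB ((hC2.reach h2 (by simpa using hvQ)).mono le_rfl (by simp))
    · exfalso
      have hr1 : Reach G' A S v := (hC1.reach h1 (by simpa using hvP)).mono le_rfl (by simp)
      by_cases hvQ : v ∈ insert y S
      · rcases Finset.mem_insert.1 hvQ with rfl | h3
        · exact hyR hr1
        · exact hvP (Finset.mem_insert_of_mem h3)
      · obtain ⟨b, hb, hb'⟩ := hr1.append
          ((hC2.reach h2 (by simpa using hvQ)).mono le_rfl (by simp : (S : Set V) ⊆ _))
        exact hS b hb hb'
  let σ : ↥(insert x S) → ↥(insert y S) := fun i =>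
    if h : i.1 = x then ⟨y, by simp⟩ else ⟨i.1, by
      have := i.2
      simp only [Finset.mem_insert] at this ⊢
      tauto⟩
  have hσx : ∀ i, i.1 = x → (σ i).1 = y := fun i hi => by simp [σ, hi]
  have hσn : ∀ i, i.1 ≠ x → (σ i).1 = i.1 := fun i hi => by simp [σ, hi]
  have hσinj : Function.Injective σ := by
    intro i j hij
    have hij' := congrArg Subtype.val hij
    apply Subtype.ext
    have key : ∀ k : ↥(insert x S), k.1 ≠ x → k.1 ≠ y := by
      rintro ⟨k, hk⟩ h1 rfl
      rcases Finset.mem_insert.1 hk with h2 | h2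
      exacts [h1 h2, hyS h2]
    by_cases hi : i.1 = x <;> by_cases hj : j.1 = x
    · rw [hi, hj]
    · rw [hσx i hi, hσn j hj] at hij'
      exact (key j hj hij'.symm).elim
    · rw [hσn i hi, hσx j hj] at hij'
      exact (key i hi hij').elim
    · rwa [hσn i hi, hσn j hj] at hij'
  have hσS : ∀ i j v, v = i.1 → v = (σ j).1 → v ∈ S → i = j := by
    intro i j v h1 h2 h3
    apply Subtype.ext
    by_cases hj : j.1 = x
    · rw [hσx j hj] at h2
      exact (hyS (h2 ▸ h3)).elim
    · rw [← h1, ← hσn j hj, h2]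
  -- the combined paths, with larger index sets first
  have hcomb : ∀ i, ∃ p : G.Walk (a1 i) (a2 (σ i)), p.IsPath ∧
      ∀ v ∈ p.support, v ∈ C1 i ∪ C2 (σ i) := by
    intro i
    obtain ⟨_, _, p, _, hp, _⟩ := hC1.2 i
    obtain ⟨_, _, q, _, hq, _⟩ := hC2.2 (σ i)
    obtain ⟨r, hr⟩ : ∃ r : G.Walk (a1 i) (a2 (σ i)),
        ∀ v ∈ r.support, v ∈ p.support ∨ v ∈ q.support := by
      by_cases hi : i.1 = x
      · have hadj' : G.Adj i.1 (σ i).1 := by rw [hσx i hi, hi]; exact hxy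
        refine ⟨(p.mapLe hle).append (Walk.cons hadj' (q.mapLe hle).reverse), fun v hv => ?_⟩
        rw [Walk.mem_support_append_iff] at hv
        simp only [Walk.support_cons, List.mem_cons] at hv
        rcases hv with hv | rfl | hv
        · left; simpa using hv
        · left; exact p.end_mem_support
        · right; simpa using hv
      · refine ⟨((p.mapLe hle).copy rfl (hσn i hi).symm).append (q.mapLe hle).reverse,
          fun v hv => ?_⟩
        rw [Walk.mem_support_append_iff] at hv
        simpa using hv
    refine ⟨r.bypass, r.bypass_isPath, fun v hv => ?_⟩
    rcases hr v (r.support_bypass_subset_support hv) with h | h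
    · exact Or.inl ((hp v).1 h)
    · exact Or.inr ((hq v).1 h)
  choose p hp hpC using hcomb
  have hPA : ∀ i v, v ∈ C1 i ∪ C2 (σ i) → v ∈ A → v = a1 i := by
    rintro i v (hv | hv) hvA
    · exact (hC1.2 i).2.2.choose_spec.2.2.1 v hv hvA
    · by_cases hvS : v ∈ S
      · have hv2 : v = (σ i).1 := (hC2.2 (σ i)).2.2.choose_spec.2.2.2 v hv (by simp [hvS])
        have hix : i.1 ≠ x := fun hi => hyS (by rwa [hv2, hσx i hi] at hvS)
        have hvi : v = i.1 := by rw [hv2, hσn i hix]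
        exact (hC1.2 i).2.2.choose_spec.2.2.1 v (hvi ▸ hC1.b_mem i) hvA
      · have hr : Reach G' A S v := Reach.of_mem hvA (by simpa using hvS)
        by_cases hvy : v = y
        · subst hvy
          exact (hyR hr).elim
        · obtain ⟨b, hb, hb'⟩ := hr.append
            ((hC2.reach hv (by simp [hvS, hvy])).mono le_rfl (by simp : (S : Set V) ⊆ _))
          exact (hS b hb hb').elim
  have hPB : ∀ i v, v ∈ C1 i ∪ C2 (σ i) → v ∈ B → v = a2 (σ i) := by
    rintro i v (hv | hv) hvB
    · by_cases hvS : v ∈ S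
      · have hv2 : v = i.1 := (hC1.2 i).2.2.choose_spec.2.2.2 v hv (by simp [hvS])
        have hix : i.1 ≠ x := fun hi => hxS (by rwa [hv2, hi] at hvS)
        have hvi : v = (σ i).1 := by rw [hv2, hσn i hix]
        exact (hC2.2 _).2.2.choose_spec.2.2.1 v (hvi ▸ hC2.b_mem _) hvB
      · have hr : Reach G' B S v := Reach.of_mem hvB (by simpa using hvS)
        by_cases hvx : v = x
        · subst hvx
          exact (hxB hr).elim
        · obtain ⟨b, hb, hb'⟩ := ((hC1.reach hv (by simp [hvS, hvx])).mono le_rfl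
            (by simp : (S : Set V) ⊆ _)).append hr
          exact (hS b hb hb').elim
    · exact (hC2.2 _).2.2.choose_spec.2.2.1 v hv hvB
  have hfin : LinkedBy G A B (ι := ↥(insert x S)) (fun i => a1 i) (fun i => a2 (σ i))
      (fun i => {v | v ∈ (p i).support}) := by
    refine ⟨?_, fun i => ⟨(hC1.2 i).1, (hC2.2 (σ i)).1, p i, hp i, fun v => Iff.rfl,
      fun v hv => hPA i v (hpC i v hv), fun v hv => hPB i v (hpC i v hv)⟩⟩
    intro i j hij
    rw [Set.disjoint_left]
    intro v hvi hvj
    rcases hpC i v hvi with h1 | h1 <;> rcases hpC j v hvj with h2 | h2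
    · exact Set.disjoint_left.1 (hC1.1 hij) h1 h2
    · obtain ⟨h3, h4, h5⟩ := hcross _ _ v h1 h2
      exact hij (hσS i j v h3 h4 h5)
    · obtain ⟨h3, h4, h5⟩ := hcross _ _ v h2 h1
      exact hij (hσS j i v h3 h4 h5).symm
    · exact Set.disjoint_left.1 (hC2.1 (hσinj.ne hij)) h1 h2
  have hcard : Fintype.card ι = Fintype.card ↥(insert x S) := by
    rw [Fintype.card_coe, hPc]
  have e := Fintype.equivOfCardEq hcard
  exact ⟨_, _, _, hfin.comp e e.injective⟩

end EdgeSep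

namespace EdgeSep
open Classical

variable {V : Type}

/-- `C` induces a connected (or empty) subgraph. -/
def Conn (G : SimpleGraph V) (C : Set V) : Prop := ∀ a ∈ C, ∀ b ∈ C, Reach G {a} Cᶜ b

lemma Reach.trans' {G : SimpleGraph V} {S : Set V} {a b c : V} (h : Reach G {a} S b)
    (h' : Reach G {b} S c) : Reach G {a} S c := by
  obtain ⟨_, rfl, p, hp⟩ := h
  obtain ⟨_, rfl, q, hq⟩ := h'
  refine ⟨_, rfl, p.append q, fun w hw => ?_⟩
  rw [Walk.mem_support_append_iff] at hw
  exact hw.elim (hp w) (hq w)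

lemma Reach.symm' {G : SimpleGraph V} {S : Set V} {a b : V} (h : Reach G {a} S b) :
    Reach G {b} S a := by
  obtain ⟨_, rfl, p, hp⟩ := h
  exact ⟨_, rfl, p.reverse, by simpa using hp⟩

lemma conn_of_root {G : SimpleGraph V} {C : Set V} (r : V) (h : ∀ b ∈ C, Reach G {r} Cᶜ b) :
    Conn G C := fun a ha b hb => (h a ha).symm'.trans' (h b hb)

lemma Conn.union {G : SimpleGraph V} {C D : Set V} (hC : Conn G C) (hD : Conn G D) {v : V}
    (hv : v ∈ C) (hv' : v ∈ D) : Conn G (C ∪ D) := by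
  refine conn_of_root v ?_
  rintro b (hb | hb)
  · exact (hC v hv b hb).mono le_rfl (Set.compl_subset_compl.2 Set.subset_union_left)
  · exact (hD v hv' b hb).mono le_rfl (Set.compl_subset_compl.2 Set.subset_union_right)

lemma conn_support {G : SimpleGraph V} {a b : V} (p : G.Walk a b) :
    Conn G {v | v ∈ p.support} := by
  refine conn_of_root a fun v hv => ⟨a, rfl, p.takeUntil v hv, fun w hw => ?_⟩
  simpa using p.support_takeUntil_subset_support hv hw

/-- The set of vertices reachable from `a` inside `C`. -/
def comp (G : SimpleGraph V) (C : Set V) (a : V) : Set V := {v | Reach G {a} Cᶜ v}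

lemma comp_subset {G : SimpleGraph V} {C : Set V} {a : V} : comp G C a ⊆ C := fun v hv => by
  simpa using Reach.notMem hv

lemma conn_comp (G : SimpleGraph V) (C : Set V) (a : V) : Conn G (comp G C a) := by
  refine conn_of_root a fun v hv => ?_
  have : ∀ v, Reach G {a} Cᶜ v → Reach G {a} (comp G C a)ᶜ v := fun v hv =>
    hv.rec_on (fun a' ha' h => Reach.of_mem ha' (by
      simpa [comp] using Reach.of_mem ha' h)) fun u w h1 h2 h3 h4 =>
        h2.adj h3 (by simpa [comp] using h1.adj h3 h4)
  exact this v hv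

lemma mem_comp_self {G : SimpleGraph V} {C : Set V} {a : V} (h : a ∈ C) : a ∈ comp G C a :=
  Reach.of_mem rfl (by simpa)

/-- The unordered pairs `{s i, t i}` are pairwise disjoint. -/
def PairDisj {ι : Type} (s t : ι → V) : Prop :=
  ∀ i j, i ≠ j → s i ≠ s j ∧ s i ≠ t j ∧ t i ≠ t j

/-- Disjoint connected sets inside `U` joining `s i` to `t i` and avoiding the rest of `E`. -/
structure Joins (G : SimpleGraph V) (U E : Set V) {ι : Type} (s t : ι → V) (C : ι → Set V) :
    Prop where
  conn : ∀ i, Conn G (C i)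
  left : ∀ i, s i ∈ C i
  right : ∀ i, t i ∈ C i
  sub : ∀ i, C i ⊆ U
  avoid : ∀ i, ∀ v ∈ C i, v ∈ E → v = s i ∨ v = t i
  disj : ∀ i j, i ≠ j → ∀ v, v ∈ C i → v ∉ C j

/-- Any disjoint pairs in a set `E ⊆ W` of at most `κ` elements can be joined within `B`. -/
def Hub (G : SimpleGraph V) (W B : Set V) (κ : ℕ) : Prop :=
  ∀ E : Finset V, (E : Set V) ⊆ W → E.card ≤ κ → ∀ (ι : Type) (s t : ι → V),
    (∀ i, s i ∈ E ∧ t i ∈ E) → PairDisj s t → ∃ C, Joins G B E s t C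

/-- Any disjoint pairs in `X` can be joined within `U`. -/
def Linked (G : SimpleGraph V) (U X : Finset V) : Prop :=
  ∀ (ι : Type) (s t : ι → V), (∀ i, s i ∈ X ∧ t i ∈ X) → PairDisj s t → ∃ C, Joins G U X s t C

lemma Linked.hub {G : SimpleGraph V} {U X : Finset V} (h : Linked G U X) (κ : ℕ) :
    Hub G X U κ := by
  intro E hE _ ι s t hst hd
  obtain ⟨C, hC⟩ := h ι s t (fun i => ⟨hE (hst i).1, hE (hst i).2⟩) hd
  exact ⟨C, hC.conn, hC.left, hC.right, hC.sub, fun i v hv hvE => hC.avoid i v hv (hE hvE), hC.disj⟩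

lemma Linked.mono {G : SimpleGraph V} {U U' X : Finset V} (h : Linked G U X) (hU : U ⊆ U') :
    Linked G U' X := by
  intro ι s t hst hd
  obtain ⟨C, hC⟩ := h ι s t hst hd
  exact ⟨C, hC.conn, hC.left, hC.right, fun i v hv => hU (hC.sub i hv), hC.avoid, hC.disj⟩

/-- A separation of `G[U]`. -/
def IsSep (G : SimpleGraph V) (U A B : Finset V) : Prop :=
  A ∪ B = U ∧ ∀ a ∈ A, a ∉ B → ∀ b ∈ B, b ∉ A → ¬ G.Adj a b

/-- Lifting a linkage through the clique edges added on `A ∩ B`. -/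
lemma Linked.of_clique {G G' : SimpleGraph V} {A B X : Finset V} (hX : X ⊆ A)
    (hG' : ∀ u ∈ A, ∀ v ∈ A, G'.Adj u v → G.Adj u v ∨ (u ∈ B ∧ v ∈ B))
    (hA : Linked G' A X) (hB : Linked G B (A ∩ B)) : Linked G (A ∪ B) X := by
  intro ι s t hst hd
  obtain ⟨C, hC⟩ := hA ι s t hst hd
  have hCA : ∀ i v, v ∈ C i → v ∈ A := fun i v hv => hC.sub i hv
  have hmeet : ∀ i, t i ∉ comp G (C i) (s i) → ∀ a b, a ∈ C i → b ∈ C i → b ∉ comp G (C i) a →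
      ∃ z ∈ comp G (C i) a, z ∈ B := by
    intro i _ a b ha hb hn
    by_contra! hcon
    refine hn ((hC.conn i a ha b hb).rec_on (fun a' ha' h => Reach.of_mem ha' h)
      fun u w _ h2 h3 h4 => ?_)
    rcases hG' u (hCA i _ (comp_subset h2)) w (hCA i _ (by simpa using h4)) h3 with h | h
    · exact Reach.adj h2 h h4
    · exact (hcon u h2 h.1).elim
  let J := {i : ι // t i ∉ comp G (C i) (s i)}
  have h1 : ∀ j : J, ∃ z ∈ comp G (C j.1) (s j.1), z ∈ B := fun j =>
    hmeet j.1 j.2 _ _ (hC.left _) (hC.right _) j.2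
  have h2 : ∀ j : J, ∃ z ∈ comp G (C j.1) (t j.1), z ∈ B := fun j =>
    hmeet j.1 j.2 _ _ (hC.right _) (hC.left _) fun h => j.2 h.symm'
  choose z hz hzB using h1
  choose z' hz' hzB' using h2
  have hzC : ∀ j, z j ∈ C j.1 := fun j => comp_subset (hz j)
  have hzC' : ∀ j, z' j ∈ C j.1 := fun j => comp_subset (hz' j)
  obtain ⟨D, hD⟩ := hB J z z' (fun j => ⟨Finset.mem_inter.2 ⟨hCA _ _ (hzC j), hzB j⟩,
    Finset.mem_inter.2 ⟨hCA _ _ (hzC' j), hzB' j⟩⟩) (by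
      intro i j hij
      have hij' : i.1 ≠ j.1 := fun h => hij (Subtype.ext h)
      refine ⟨fun h => ?_, fun h => ?_, fun h => ?_⟩
      · exact hC.disj _ _ hij' _ (hzC i) (h ▸ hzC j)
      · exact hC.disj _ _ hij' _ (hzC i) (h ▸ hzC' j)
      · exact hC.disj _ _ hij' _ (hzC' i) (h ▸ hzC' j))
  have hDA : ∀ j v, v ∈ D j → v ∈ A → v ∈ C j.1 := by
    intro j v hv hvA
    rcases hD.avoid j v hv (Finset.mem_coe.2 (Finset.mem_inter.2 ⟨hvA, hD.sub j hv⟩)) with h | h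
    · exact h ▸ hzC j
    · exact h ▸ hzC' j
  let F : ι → Set V := fun i => if h : t i ∉ comp G (C i) (s i) then
    (comp G (C i) (s i) ∪ D ⟨i, h⟩) ∪ comp G (C i) (t i) else comp G (C i) (s i)
  have hF1 : ∀ i (h : t i ∉ comp G (C i) (s i)), F i =
    (comp G (C i) (s i) ∪ D ⟨i, h⟩) ∪ comp G (C i) (t i) := fun i h => dif_pos h
  have hF2 : ∀ i (h : ¬ t i ∉ comp G (C i) (s i)), F i = comp G (C i) (s i) := fun i h => dif_neg h
  have hFv : ∀ i v, v ∈ F i → v ∈ C i ∨ ∃ h, v ∈ D ⟨i, h⟩ := by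
    intro i v hv
    by_cases h : t i ∉ comp G (C i) (s i)
    · rw [hF1 i h] at hv
      rcases hv with (hv | hv) | hv
      · exact Or.inl (comp_subset hv)
      · exact Or.inr ⟨h, hv⟩
      · exact Or.inl (comp_subset hv)
    · rw [hF2 i h] at hv
      exact Or.inl (comp_subset hv)
  have hself : ∀ i, s i ∈ comp G (C i) (s i) := fun i => mem_comp_self (hC.left i)
  refine ⟨F, fun i => ?_, fun i => ?_, fun i => ?_, fun i v hv => ?_, fun i v hv hvX => ?_, ?_⟩
  · by_cases h : t i ∉ comp G (C i) (s i)
    · rw [hF1 i h]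
      refine Conn.union (v := z' ⟨i, h⟩) (Conn.union (v := z ⟨i, h⟩) (conn_comp _ _ _)
        (hD.conn _) (hz ⟨i, h⟩) (hD.left _)) (conn_comp _ _ _) (Or.inr (hD.right _)) (hz' ⟨i, h⟩)
    · rw [hF2 i h]
      exact conn_comp _ _ _
  · by_cases h : t i ∉ comp G (C i) (s i)
    · rw [hF1 i h]
      exact Or.inl (Or.inl (hself i))
    · rw [hF2 i h]
      exact hself i
  · by_cases h : t i ∉ comp G (C i) (s i)
    · rw [hF1 i h]
      exact Or.inr (mem_comp_self (hC.right i))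
    · rw [hF2 i h]
      exact not_not.1 h
  · rcases hFv i v hv with h | ⟨h, h'⟩
    · simp [hCA i v h]
    · have : v ∈ B := hD.sub _ h'
      simp [this]
  · rcases hFv i v hv with h | ⟨h, h'⟩
    · exact hC.avoid i v h hvX
    · exact hC.avoid i v (hDA _ _ h' (hX hvX)) hvX
  · intro i j hij v hvi hvj
    rcases hFv i v hvi with h1 | ⟨h1, h1'⟩ <;> rcases hFv j v hvj with h2 | ⟨h2, h2'⟩
    · exact hC.disj i j hij v h1 h2
    · exact hC.disj i j hij v h1 (hDA _ _ h2' (hCA i v h1))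
    · exact hC.disj i j hij v (hDA _ _ h1' (hCA j v h2)) h2
    · exact (hD.disj ⟨i, h1⟩ ⟨j, h2⟩ (fun h => hij (congrArg Subtype.val h)) v h1' h2').elim

/-- Lifting a linkage through the contraction of the edge `u v` onto `v`. -/
lemma Linked.of_contract {G G' : SimpleGraph V} {U X : Finset V} {u v : V} (huv : G.Adj u v)
    (hu : u ∉ U) (hX : X ⊆ U)
    (hG' : ∀ a ∈ U, ∀ b ∈ U, G'.Adj a b → G.Adj a b ∨ (a = v ∧ G.Adj u b) ∨ (b = v ∧ G.Adj u a))
    (h : Linked G' U X) : Linked G (insert u U) X := by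
  intro ι s t hst hd
  obtain ⟨C, hC⟩ := h ι s t hst hd
  have hCu : ∀ i, u ∉ C i := fun i hi => hu (hC.sub i hi)
  let F : ι → Set V := fun i => C i ∪ {w | w = u ∧ v ∈ C i}
  refine ⟨F, fun i => ?_, fun i => Or.inl (hC.left i), fun i => Or.inl (hC.right i), ?_, ?_, ?_⟩
  · refine conn_of_root (s i) ?_
    have hCF : ∀ w, w ∈ C i → w ∉ (F i)ᶜ := fun w hw => by simp [F, hw]
    have huF : v ∈ C i → u ∉ (F i)ᶜ := fun h => by simp [F, h]
    have key : ∀ b ∈ C i, Reach G {s i} (F i)ᶜ b := by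
      intro b hb
      refine (hC.conn i _ (hC.left i) b hb).rec_on
        (fun a ha ha' => Reach.of_mem ha (hCF a (by simpa using ha'))) fun a b h1 h2 h3 h4 => ?_
      have ha : a ∈ C i := by simpa using h1.notMem
      have hb : b ∈ C i := by simpa using h4
      rcases hG' a (hC.sub i ha) b (hC.sub i hb) h3 with h | ⟨rfl, h⟩ | ⟨rfl, h⟩
      · exact h2.adj h (hCF b hb)
      · exact (h2.adj huv.symm (huF ha)).adj h (hCF b hb)
      · exact (h2.adj h.symm (huF hb)).adj huv (hCF b hb)
    rintro b (hb | ⟨rfl, hb⟩)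
    · exact key b hb
    · exact (key v hb).adj huv.symm (huF hb)
  · rintro i w (hw | ⟨rfl, hw⟩)
    · simp [Finset.mem_coe.1 (hC.sub i hw)]
    · simp
  · rintro i w (hw | ⟨rfl, hw⟩) hX'
    · exact hC.avoid i w hw hX'
    · exact (hu (hX hX')).elim
  · rintro i j hij w (hw | ⟨rfl, hw⟩) (hw' | ⟨h, hw'⟩)
    · exact hC.disj i j hij w hw hw'
    · exact hCu i (h ▸ hw)
    · exact hCu j hw'
    · exact (hC.disj i j hij v hw hw').elim

/-- Disjoint connected sets in `U`, the one containing `s ∈ S` meeting `W` in `z s` only. -/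
structure Fan (G : SimpleGraph V) (U S W : Set V) (z : V → V) (P : V → Set V) : Prop where
  conn : ∀ s ∈ S, Conn G (P s)
  self : ∀ s ∈ S, s ∈ P s
  zmem : ∀ s ∈ S, z s ∈ P s
  zW : ∀ s ∈ S, z s ∈ W
  onlyW : ∀ s ∈ S, ∀ v ∈ P s, v ∈ W → v = z s
  onlyS : ∀ s ∈ S, ∀ v ∈ P s, v ∈ S → v = s
  sub : ∀ s ∈ S, P s ⊆ U
  disj : ∀ s ∈ S, ∀ s' ∈ S, s ≠ s' → ∀ v, v ∈ P s → v ∉ P s'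

lemma Fan.linked {G : SimpleGraph V} {U S : Finset V} {W B : Set V} {z : V → V} {P : V → Set V}
    (h : Fan G U S W z P) {κ : ℕ} (hub : Hub G W B κ) (hS : S.card ≤ κ)
    (hB : ∀ v ∈ B, v ∈ U → v ∈ W) {U' : Finset V} (hU' : (U : Set V) ∪ B ⊆ U') :
    Linked G U' S := by
  intro ι s t hst hd
  have hzinj : ∀ a ∈ S, ∀ b ∈ S, z a = z b → a = b := by
    intro a ha b hb hab
    by_contra hne
    exact h.disj a ha b hb hne _ (h.zmem a ha) (hab ▸ h.zmem b hb)
  obtain ⟨D, hD⟩ := hub (S.image z) (by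
      intro v hv
      obtain ⟨a, ha, rfl⟩ := Finset.mem_image.1 (Finset.mem_coe.1 hv)
      exact h.zW a ha) (Finset.card_image_le.trans hS) ι (z ∘ s) (z ∘ t)
    (fun i => ⟨Finset.mem_image_of_mem _ (hst i).1, Finset.mem_image_of_mem _ (hst i).2⟩) (by
      intro i j hij
      obtain ⟨h1, h2, h3⟩ := hd i j hij
      exact ⟨fun h => h1 (hzinj _ (hst i).1 _ (hst j).1 h),
        fun h => h2 (hzinj _ (hst i).1 _ (hst j).2 h),
        fun h => h3 (hzinj _ (hst i).2 _ (hst j).2 h)⟩)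
  have hPD : ∀ i, ∀ a ∈ S, ∀ v ∈ P a, v ∈ D i → a = s i ∨ a = t i := by
    intro i a ha v hv hvD
    have hvW := hB v (hD.sub i hvD) (h.sub a ha hv)
    have hva := h.onlyW a ha v hv hvW
    rcases hD.avoid i v hvD (by rw [hva]; exact Finset.mem_coe.2 (Finset.mem_image_of_mem _ ha))
      with h' | h'
    · exact Or.inl (hzinj _ ha _ (hst i).1 (hva ▸ h'))
    · exact Or.inr (hzinj _ ha _ (hst i).2 (hva ▸ h'))
  refine ⟨fun i => (P (s i) ∪ D i) ∪ P (t i), fun i => ?_, fun i => ?_, fun i => ?_, ?_, ?_, ?_⟩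
  · exact ((h.conn _ (hst i).1).union (hD.conn i) (h.zmem _ (hst i).1) (hD.left i)).union
      (h.conn _ (hst i).2) (Or.inr (hD.right i)) (h.zmem _ (hst i).2)
  · exact Or.inl (Or.inl (h.self _ (hst i).1))
  · exact Or.inr (h.self _ (hst i).2)
  · rintro i v ((hv | hv) | hv)
    · exact hU' (Or.inl (h.sub _ (hst i).1 hv))
    · exact hU' (Or.inr (hD.sub i hv))
    · exact hU' (Or.inl (h.sub _ (hst i).2 hv))
  · rintro i v ((hv | hv) | hv) hvS
    · exact Or.inl (h.onlyS _ (hst i).1 v hv hvS)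
    · exact hPD i v hvS v (h.self v hvS) hv
    · exact Or.inr (h.onlyS _ (hst i).2 v hv hvS)
  · intro i j hij v hvi hvj
    obtain ⟨h1, h2, h3⟩ := hd i j hij
    obtain ⟨-, h4, -⟩ := hd j i hij.symm
    have hPP : ∀ a ∈ S, ∀ b ∈ S, v ∈ P a → v ∈ P b → a = b := by
      intro a ha b hb h1 h2
      by_contra hne
      exact h.disj a ha b hb hne v h1 h2
    have hs : ∀ i, s i ∈ S := fun i => (hst i).1
    have ht : ∀ i, t i ∈ S := fun i => (hst i).2
    rcases hvi with (hi | hi) | hi <;> rcases hvj with (hj | hj) | hj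
    · exact h1 (hPP _ (hs i) _ (hs j) hi hj)
    · rcases hPD j _ (hs i) v hi hj with h | h
      exacts [h1 h, h2 h]
    · exact h2 (hPP _ (hs i) _ (ht j) hi hj)
    · rcases hPD i _ (hs j) v hj hi with h | h
      exacts [h1 h.symm, h4 h]
    · exact hD.disj i j hij v hi hj
    · rcases hPD i _ (ht j) v hj hi with h | h
      exacts [h2 h.symm, h3 h.symm]
    · exact h4 (hPP _ (hs j) _ (ht i) hj hi)
    · rcases hPD j _ (ht i) v hi hj with h | h
      exacts [h4 h.symm, h3 h]
    · exact h3 (hPP _ (ht i) _ (ht j) hi hj)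

/-- `G` with all edges not inside `U` removed. -/
def restr (G : SimpleGraph V) (U : Set V) : SimpleGraph V where
  Adj a b := G.Adj a b ∧ a ∈ U ∧ b ∈ U
  symm := ⟨fun _ _ h => ⟨h.1.symm, h.2.2, h.2.1⟩⟩
  loopless := ⟨fun _ h => G.loopless.irrefl _ h.1⟩

lemma restr_le (G : SimpleGraph V) (U : Set V) : restr G U ≤ G := fun _ _ h => h.1

lemma restr_walk {G : SimpleGraph V} {U : Set V} {a b : V} (p : (restr G U).Walk a b)
    (h : a ∈ U) : ∀ v ∈ p.support, v ∈ U := by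
  induction p with
  | nil => simpa using h
  | cons hadj p ih =>
    intro v hv
    rw [Walk.support_cons, List.mem_cons] at hv
    rcases hv with rfl | hv
    exacts [h, ih hadj.2.2 v hv]

/-- Menger's theorem: either `X` itself is linked to `W`, or a smaller separator is. -/
lemma exists_fan [Finite V] (G : SimpleGraph V) {U X W : Finset V} (hX : X ⊆ U) (hW : W ⊆ U) :
    ∃ A B z P, IsSep G U A B ∧ X ⊆ A ∧ W ⊆ B ∧ Fan G B (A ∩ B : Finset V) W z P ∧
      ((A ∩ B = X ∧ B = U) ∨ (A ∩ B).card < X.card) := by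
  have := Fintype.ofFinite V
  set G' := restr G U with hG'
  have hfan : ∀ S : Finset V, S ⊆ U →
      (∀ T : Finset V, Separates G' S W T → S.card ≤ T.card) →
      ∃ z P, Fan G U S W z P ∧ ∀ s ∈ S, ∀ v ∈ P s, v ∉ S → ∃ b ∈ W, Reach G' {v} S b := by
    intro S hSU hS
    obtain ⟨a, b, C, hC⟩ := menger G' W S S fun T hT => by
      rw [Fintype.card_coe]
      exact hS T hT.symm
    obtain ⟨a, C, hC⟩ := hC.index (by simp)
    refine ⟨fun s => if h : s ∈ S then a ⟨s, h⟩ else s, fun s => if h : s ∈ S then C ⟨s, h⟩ else ∅,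
      ⟨?_, ?_, ?_, ?_, ?_, ?_, ?_, ?_⟩, ?_⟩
    · intro s hs
      replace hs : s ∈ S := hs
      obtain ⟨h1, h2, p, hp, h3, h4, h5⟩ := hC.2 ⟨s, hs⟩
      have : C ⟨s, hs⟩ = {v | v ∈ (p.mapLe (restr_le G U)).support} := by
        ext v; simp [h3]
      simp only [hs, dif_pos, this]
      exact conn_support _
    · intro s hs
      simp only [Finset.mem_coe.1 hs, dif_pos]
      exact hC.b_mem ⟨s, hs⟩
    · intro s hs
      simp only [Finset.mem_coe.1 hs, dif_pos]
      exact hC.a_mem ⟨s, hs⟩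
    · intro s hs
      simp only [Finset.mem_coe.1 hs, dif_pos]
      exact (hC.2 ⟨s, hs⟩).1
    · intro s hs
      simp only [Finset.mem_coe.1 hs, dif_pos]
      exact (hC.2 ⟨s, hs⟩).2.2.choose_spec.2.2.1
    · intro s hs
      simp only [Finset.mem_coe.1 hs, dif_pos]
      exact (hC.2 ⟨s, hs⟩).2.2.choose_spec.2.2.2
    · intro s hs
      simp only [Finset.mem_coe.1 hs, dif_pos]
      intro v hv
      obtain ⟨h1, h2, p, hp, h3, h4, h5⟩ := hC.2 ⟨s, hs⟩
      exact restr_walk p (hW h1) v ((h3 v).2 hv)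
    · intro s hs s' hs' hne
      simp only [Finset.mem_coe.1 hs, Finset.mem_coe.1 hs', dif_pos]
      intro v h1 h2
      exact Set.disjoint_left.1 (hC.1 (i := ⟨s, hs⟩) (j := ⟨s', hs'⟩)
        (fun h => hne (congrArg Subtype.val h))) h1 h2
    · intro s hs v hv hvS
      simp only [hs, dif_pos] at hv
      exact (hC.reach hv hvS).symm_of
  by_cases hmin : ∀ T : Finset V, Separates G' X W T → X.card ≤ T.card
  · obtain ⟨z, P, hF, -⟩ := hfan X hX hmin
    have hXU : X ∩ U = X := Finset.inter_eq_left.2 hX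
    refine ⟨X, U, z, P, ⟨Finset.union_eq_right.2 hX, fun a ha ha' => (ha' (hX ha)).elim⟩,
      subset_rfl, hW, by rwa [hXU], Or.inl ⟨hXU, rfl⟩⟩
  push Not at hmin
  obtain ⟨T0, hT0, hT0c⟩ := hmin
  -- a minimum separator
  obtain ⟨S, hS, hSmin⟩ : ∃ S : Finset V, Separates G' X W S ∧
      ∀ T : Finset V, Separates G' X W T → S.card ≤ T.card := by
    obtain ⟨S, hS, hm⟩ := Set.exists_min_image {S : Finset V | Separates G' X W S} Finset.card
      (Set.toFinite _) ⟨T0, hT0⟩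
    exact ⟨S, hS, hm⟩
  have hSU : S ⊆ U := by
    have : Separates G' X W (S ∩ U : Finset V) := by
      intro b hb ⟨a, ha, p, hp⟩
      refine hS b hb ⟨a, ha, p, fun w hw hwS => hp w hw ?_⟩
      simp [Finset.mem_coe.1 hwS, Finset.mem_coe.1 (restr_walk p (hX ha) w hw)]
    have h1 := hSmin _ this
    have h2 : S ∩ U = S := Finset.eq_of_subset_of_card_le Finset.inter_subset_left h1
    exact Finset.inter_eq_left.1 h2
  obtain ⟨z, P, hF, hP⟩ := hfan S hSU fun T hT => hSmin T fun b hb hr => by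
    have : ∀ v, Reach G' X T v → Reach G' X S v ∨ Reach G' S T v := fun v hv =>
      hv.rec_on (fun a ha haT => (Classical.em (a ∈ S)).symm.imp (fun h => Reach.of_mem ha (by simpa using h))
        (fun h => Reach.of_mem h haT)) fun u w _ hu huw hw => by
        rcases hu with hu | hu
        · by_cases hwS : w ∈ S
          · exact Or.inr (Reach.of_mem hwS hw)
          · exact Or.inl (hu.adj huw (by simpa using hwS))
        · exact Or.inr (hu.adj huw hw)
    exact (this b hr).elim (hS b hb) (hT b hb)
  have hSR : ∀ v ∈ S, ¬ Reach G' X S v := fun v hv hr => hr.notMem hv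
  have hAB : U.filter (fun v => v ∈ S ∨ Reach G' X S v) ∩ U.filter (fun v => ¬ Reach G' X S v) =
      S := by
    ext v
    simp only [Finset.mem_inter, Finset.mem_filter]
    exact ⟨fun h => h.1.2.resolve_right h.2.2, fun h => ⟨⟨hSU h, Or.inl h⟩, hSU h, hSR v h⟩⟩
  refine ⟨U.filter fun v => v ∈ S ∨ Reach G' X S v, U.filter fun v => ¬ Reach G' X S v, z, P,
    ⟨?_, ?_⟩, ?_, ?_, ?_, Or.inr ?_⟩
  · ext v
    simp only [Finset.mem_union, Finset.mem_filter]
    tauto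
  · intro a ha ha' b hb hb' hab
    simp only [Finset.mem_filter, not_and, not_not, not_or] at *
    exact hb.2 ((ha' ha.1).adj ⟨hab, ha.1, hb.1⟩ (by simpa using (hb' hb.1).1))
  · intro x hx
    simp only [Finset.mem_filter]
    exact ⟨hX hx, (Classical.em (x ∈ S)).imp_right fun h => Reach.of_mem hx (by simpa using h)⟩
  · intro w hw
    simp only [Finset.mem_filter]
    exact ⟨hW hw, hS w hw⟩
  · rw [hAB]
    refine ⟨hF.conn, hF.self, hF.zmem, hF.zW, hF.onlyW, hF.onlyS, fun s hs v hv => ?_, hF.disj⟩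
    refine Finset.mem_coe.2 (Finset.mem_filter.2 ⟨hF.sub s hs hv, fun hr => ?_⟩)
    obtain ⟨b, hb, hb'⟩ := hP s hs v hv fun h => hSR v h hr
    obtain ⟨x, hx, p, hp⟩ := hr
    obtain ⟨_, rfl, q, hq⟩ := hb'
    refine hS b hb ⟨x, hx, p.append q, fun w hw => ?_⟩
    rw [Walk.mem_support_append_iff] at hw
    exact hw.elim (hp w) (hq w)
  · rw [hAB]
    exact (hSmin T0 hT0).trans_lt hT0c

end EdgeSep

namespace EdgeSep
open Classical

variable {V : Type}

/-- The number of ordered adjacent pairs in `U` that meet `Y`. -/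
noncomputable def rho (G : SimpleGraph V) (U Y : Finset V) : ℕ :=
  ((U ×ˢ U).filter fun p => G.Adj p.1 p.2 ∧ (p.1 ∈ Y ∨ p.2 ∈ Y)).card

/-- The neighbours of `u` in `U`. -/
noncomputable def nbr (G : SimpleGraph V) (U : Finset V) (u : V) : Finset V :=
  U.filter (G.Adj u)

lemma mem_nbr {G : SimpleGraph V} {U : Finset V} {u v : V} :
    v ∈ nbr G U u ↔ v ∈ U ∧ G.Adj u v := by simp [nbr]

lemma rho_le_of {G G' : SimpleGraph V} {U U' Y Y' : Finset V}
    (h : ∀ a ∈ U, ∀ b ∈ U, G.Adj a b → a ∈ Y ∨ b ∈ Y →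
      a ∈ U' ∧ b ∈ U' ∧ G'.Adj a b ∧ (a ∈ Y' ∨ b ∈ Y')) : rho G U Y ≤ rho G' U' Y' := by
  apply Finset.card_le_card
  rintro ⟨a, b⟩ hab
  simp only [Finset.mem_filter, Finset.mem_product] at hab ⊢
  obtain ⟨h1, h2, h3, h4⟩ := h a hab.1.1 b hab.1.2 hab.2.1 hab.2.2
  exact ⟨⟨h1, h2⟩, h3, h4⟩

/-- A dense rooted graph in which no small separation hides a dense part from the roots. -/
structure Massed (G : SimpleGraph V) (U X : Finset V) (a κ : ℕ) : Prop where
  sub : X ⊆ U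
  card : X.card ≤ κ
  dense : a * (U \ X).card < rho G U (U \ X)
  sep : ∀ A B, IsSep G U A B → X ⊆ A → (A ∩ B).card < X.card → rho G B (B \ A) ≤ a * (B \ A).card

/-- A separation of `(U, X)` with too many edges on the far side. -/
def Bad (G : SimpleGraph V) (U X : Finset V) (a : ℕ) (A B : Finset V) : Prop :=
  IsSep G U A B ∧ X ⊆ A ∧ a * (B \ A).card < rho G B (B \ A)

lemma Bad.exists_min [Finite V] {G : SimpleGraph V} {U X A B : Finset V} {a : ℕ}
    (h : Bad G U X a A B) : ∃ A' B', Bad G U X a A' B' ∧ (A' ∩ B').card ≤ (A ∩ B).card ∧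
      ∀ A'' B'', Bad G U X a A'' B'' → (A' ∩ B').card ≤ (A'' ∩ B'').card := by
  have := Fintype.ofFinite V
  obtain ⟨p, hp, hm⟩ := Set.exists_min_image {p : Finset V × Finset V | Bad G U X a p.1 p.2}
    (fun p => (p.1 ∩ p.2).card) (Set.toFinite _) ⟨(A, B), h⟩
  exact ⟨p.1, p.2, hp, hm (A, B) h, fun A'' B'' h'' => hm (A'', B'') h''⟩

lemma Bad.massed {G : SimpleGraph V} {U X A B : Finset V} {a κ : ℕ} (h : Bad G U X a A B)
    (hκ : (A ∩ B).card ≤ κ)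
    (hmin : ∀ A' B', Bad G U X a A' B' → (A ∩ B).card ≤ (A' ∩ B').card) :
    Massed G B (A ∩ B) a κ := by
  obtain ⟨⟨hU, hs⟩, hX, hb⟩ := h
  have hd : B \ (A ∩ B) = B \ A := by ext; simp
  refine ⟨Finset.inter_subset_right, hκ, by rwa [hd], fun A' B' ⟨hU', hs'⟩ hAB hlt => ?_⟩
  by_contra! hcon
  have hB' : B' ⊆ B := by rw [← hU']; exact Finset.subset_union_right
  have hA' : A' ⊆ B := by rw [← hU']; exact Finset.subset_union_left
  have hAB' : ∀ v ∈ A, v ∈ B → v ∈ A' := fun v h1 h2 => hAB (Finset.mem_inter.2 ⟨h1, h2⟩)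
  have h1 : (A ∪ A') ∩ B' = A' ∩ B' := by
    ext v
    simp only [Finset.mem_inter, Finset.mem_union]
    exact ⟨fun h => ⟨h.1.elim (fun h' => hAB' v h' (hB' h.2)) id, h.2⟩, fun h => ⟨Or.inr h.1, h.2⟩⟩
  have h2 : B' \ (A ∪ A') = B' \ A' := by
    ext v
    simp only [Finset.mem_sdiff, Finset.mem_union]
    exact ⟨fun h => ⟨h.1, fun h' => h.2 (Or.inr h')⟩,
      fun h => ⟨h.1, fun h' => h.2 (h'.elim (fun h'' => hAB' v h'' (hB' h.1)) id)⟩⟩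
  have := hmin (A ∪ A') B' ⟨⟨?_, ?_⟩, hX.trans Finset.subset_union_left, by rwa [h2]⟩
  · rw [h1] at this
    omega
  · rw [Finset.union_assoc, hU', hU]
  · intro x hx hxB y hy hyA hxy
    simp only [Finset.mem_union, not_or] at hx hyA
    rcases hx with hx | hx
    · by_cases hxB2 : x ∈ B
      · exact hs' x (hAB' x hx hxB2) hxB y hy hyA.2 hxy
      · exact hs x hx hxB2 y (hB' hy) hyA.1 hxy
    · exact hs' x hx hxB y hy hyA.2 hxy

/-- A small separation whose far side links its boundary. -/
def Rigid (G : SimpleGraph V) (U X A B : Finset V) : Prop :=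
  IsSep G U A B ∧ X ⊆ A ∧ (A ∩ B).card ≤ X.card ∧ (B \ A).Nonempty ∧ Linked G B (A ∩ B)

/-- `G` with the set `Z` made complete. -/
def addClique (G : SimpleGraph V) (Z : Finset V) : SimpleGraph V where
  Adj a b := a ≠ b ∧ (G.Adj a b ∨ (a ∈ Z ∧ b ∈ Z))
  symm := ⟨fun _ _ h => ⟨h.1.symm, h.2.imp (fun h' => h'.symm) And.symm⟩⟩
  loopless := ⟨fun _ h => h.1 rfl⟩

lemma linked_of_rigid [Finite V] {G : SimpleGraph V} {U X : Finset V} {a κ : ℕ}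
    (IH : ∀ (G' : SimpleGraph V) (U' X' : Finset V), U'.card < U.card → Massed G' U' X' a κ →
      Linked G' U' X') (hM : Massed G U X a κ) (h : ∃ A B, Rigid G U X A B) :
    Linked G U X := by
  have := Fintype.ofFinite V
  obtain ⟨⟨A, B⟩, hR, hmin⟩ := Set.exists_min_image
    {p : Finset V × Finset V | Rigid G U X p.1 p.2}
    (fun p => p.1.card) (Set.toFinite _) (let ⟨A, B, h⟩ := h; ⟨(A, B), h⟩)
  replace hmin : ∀ A' B', Rigid G U X A' B' → A.card ≤ A'.card := fun A' B' h => hmin (A', B') h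
  replace hR : Rigid G U X A B := hR
  obtain ⟨⟨hU, hs⟩, hX, hc, hne, hL⟩ := hR
  obtain ⟨w, hw⟩ := hne
  rw [Finset.mem_sdiff] at hw
  rcases hc.eq_or_lt with hc | hc
  · -- order `|X|`
    obtain ⟨A1, A2, z, P, ⟨hA, hsA⟩, hXA, hWA, hF, hor⟩ := exists_fan G hX
      (Finset.inter_subset_left : A ∩ B ⊆ A)
    have hA1 : A1 ⊆ A := by rw [← hA]; exact Finset.subset_union_left
    have hA2 : A2 ⊆ A := by rw [← hA]; exact Finset.subset_union_right
    have hlink : (A1 ∩ A2).card ≤ κ → Linked G (A2 ∪ B) (A1 ∩ A2) := fun hk =>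
      hF.linked (hL.hub κ) hk (fun v hv hv' =>
        Finset.mem_coe.2 (Finset.mem_inter.2 ⟨hA2 hv', hv⟩)) (by simp)
    rcases hor with ⟨h1, h2⟩ | h1
    · have := hlink (h1 ▸ hM.card)
      rwa [h1, h2, hU] at this
    · exfalso
      have hAB : ∀ v ∈ A, v ∈ B → v ∈ A2 := fun v h1 h2 => hWA (Finset.mem_inter.2 ⟨h1, h2⟩)
      have h_inter : A1 ∩ (A2 ∪ B) = A1 ∩ A2 := by
        ext v
        simp only [Finset.mem_inter, Finset.mem_union]
        exact ⟨fun h => ⟨h.1, h.2.elim id (hAB v (hA1 h.1))⟩, fun h => ⟨h.1, Or.inl h.2⟩⟩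
      have hr : Rigid G U X A1 (A2 ∪ B) := by
        refine ⟨⟨?_, ?_⟩, hXA, by rw [h_inter]; exact h1.le,
          ⟨w, ?_⟩, by rw [h_inter]; exact hlink (h1.le.trans hM.card)⟩
        · rw [← Finset.union_assoc, hA, hU]
        · intro x hx hx' y hy hy' hxy
          simp only [Finset.mem_union, not_or] at hx' hy
          by_cases hyA : y ∈ A
          · exact hsA x hx hx'.1 y (hy.elim id (hAB y hyA)) hy' hxy
          · exact hs x (hA1 hx) hx'.2 y (hy.resolve_left fun h => hyA (hA2 h)) hyA hxy
        · simp only [Finset.mem_sdiff, Finset.mem_union]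
          exact ⟨Or.inr hw.1, fun h => hw.2 (hA1 h)⟩
      have h2 := hmin _ _ hr
      have h3 : A1 = A := Finset.eq_of_subset_of_card_le hA1 h2
      have h4 : A ∩ B ⊆ A1 ∩ A2 := fun v hv => Finset.mem_inter.2 ⟨by
        rw [h3]; exact (Finset.mem_inter.1 hv).1, hWA hv⟩
      have h5 := Finset.card_le_card h4
      omega
  · -- order less than `|X|`
    set Z := A ∩ B with hZ
    set G' := addClique G Z with hG'
    have hle : ∀ u v, G.Adj u v → G'.Adj u v := fun u v h => ⟨h.ne, Or.inl h⟩
    have hAU : A ⊆ U := by rw [← hU]; exact Finset.subset_union_left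
    have hBU : B ⊆ U := by rw [← hU]; exact Finset.subset_union_right
    have hAlt : A.card < U.card := Finset.card_lt_card
      ⟨hAU, fun h => hw.2 (h (hBU hw.1))⟩
    have hmem : ∀ v ∈ U, v ∈ A ∨ v ∈ B := fun v hv => Finset.mem_union.1 (hU ▸ hv)
    have hlift : ∀ A' Y : Finset V, A' ⊆ A → Z ⊆ A' → Y ⊆ A' → Linked G' A' Y →
        Linked G (A' ∪ B) Y := by
      intro A' Y h1 h2 h3 h4
      have h5 : A' ∩ B = Z := by
        ext v
        simp only [hZ, Finset.mem_inter]
        exact ⟨fun h => ⟨h1 h.1, h.2⟩, fun h => ⟨h2 (by simp [hZ, h]), h.2⟩⟩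
      refine Linked.of_clique h3 (fun u _ v _ huv => ?_) h4 (by rwa [h5])
      exact huv.2.imp_right fun h => ⟨(Finset.mem_inter.1 h.1).2, (Finset.mem_inter.1 h.2).2⟩
    suffices hM' : Massed G' A X a κ by
      have := hlift A X subset_rfl Finset.inter_subset_left hX (IH G' A X hAlt hM')
      rwa [hU] at this
    refine ⟨hX, hM.card, ?_, ?_⟩
    · have h1 := hM.dense
      have h2 := hM.sep A B ⟨hU, hs⟩ hX hc
      have h3 : rho G U (U \ X) ≤ rho G B (B \ A) + rho G' A (A \ X) := by
        unfold rho
        rw [← Finset.card_union_add_card_inter]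
        refine le_trans (Finset.card_le_card ?_) (Nat.le_add_right _ _)
        rintro ⟨u, v⟩ huv
        simp only [Finset.mem_filter, Finset.mem_product, Finset.mem_union, Finset.mem_sdiff]
          at huv ⊢
        obtain ⟨⟨hu, hv⟩, huv, hor⟩ := huv
        by_cases huA : u ∈ A
        · by_cases hvA : v ∈ A
          · right
            exact ⟨⟨huA, hvA⟩, hle _ _ huv, by tauto⟩
          · left
            have hvB := (hmem v hv).resolve_left hvA
            have huB : u ∈ B := by
              by_contra h
              exact hs u huA h v hvB hvA huv
            exact ⟨⟨huB, hvB⟩, huv, Or.inr ⟨hvB, hvA⟩⟩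
        · left
          have huB := (hmem u hu).resolve_left huA
          have hvB : v ∈ B := by
            by_contra h
            exact hs v ((hmem v hv).resolve_right h) h u huB huA huv.symm
          exact ⟨⟨huB, hvB⟩, huv, Or.inl ⟨huB, huA⟩⟩
      have h4 : (U \ X).card = (B \ A).card + (A \ X).card := by
        rw [← Finset.card_union_of_disjoint]
        · congr 1
          ext v
          simp only [Finset.mem_sdiff, Finset.mem_union, ← hU]
          have := @hX v
          tauto
        · rw [Finset.disjoint_left]
          intro v hv hv'
          exact (Finset.mem_sdiff.1 hv).2 (Finset.mem_sdiff.1 hv').1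
      rw [h4, mul_add] at h1
      omega
    · intro A0 B0 hsep0 hX0 hlt0
      by_contra! hcon
      obtain ⟨A', B', hbad, hle', hmin'⟩ := Bad.exists_min (G := G') (U := A) (X := X) (a := a)
        ⟨hsep0, hX0, hcon⟩
      have hlt' : (A' ∩ B').card < X.card := hle'.trans_lt hlt0
      obtain ⟨⟨hU', hs'⟩, hX', hb'⟩ := id hbad
      have hA'A : A' ⊆ A := by rw [← hU']; exact Finset.subset_union_left
      have hB'A : B' ⊆ A := by rw [← hU']; exact Finset.subset_union_right
      by_cases hZA : Z ⊆ A'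
      · have h1 : B' \ (A' ∪ B) = B' \ A' := by
          ext v
          simp only [Finset.mem_sdiff, Finset.mem_union, not_or]
          exact ⟨fun h => ⟨h.1, h.2.1⟩, fun h => ⟨h.1, h.2, fun hv => h.2 (hZA
            (Finset.mem_inter.2 ⟨hB'A h.1, hv⟩))⟩⟩
        have h2 : (A' ∪ B) ∩ B' = A' ∩ B' := by
          ext v
          simp only [Finset.mem_inter, Finset.mem_union]
          exact ⟨fun h => ⟨h.1.elim id fun hv => hZA (Finset.mem_inter.2 ⟨hB'A h.2, hv⟩), h.2⟩,
            fun h => ⟨Or.inl h.1, h.2⟩⟩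
        have h3 := hM.sep (A' ∪ B) B' ⟨?_, ?_⟩ (hX'.trans Finset.subset_union_left)
          (by rwa [h2])
        · rw [h1] at h3
          have h4 : rho G' B' (B' \ A') ≤ rho G B' (B' \ A') := by
            apply rho_le_of
            intro u hu v hv huv hor
            refine ⟨hu, hv, huv.2.resolve_right fun h => ?_, hor⟩
            rcases hor with h' | h'
            · exact (Finset.mem_sdiff.1 h').2 (hZA h.1)
            · exact (Finset.mem_sdiff.1 h').2 (hZA h.2)
          omega
        · rw [Finset.union_right_comm, hU', hU]
        · intro x hx hx' y hy hy' hxy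
          simp only [Finset.mem_union, not_or] at hx hy'
          by_cases hxA : x ∈ A'
          · exact hs' x hxA hx' y hy hy'.1 (hle _ _ hxy)
          · have hxB := hx.resolve_left hxA
            have hxA2 : x ∉ A := fun h => hxA (hZA (Finset.mem_inter.2 ⟨h, hxB⟩))
            exact hs y (hB'A hy) hy'.2 x hxB hxA2 hxy.symm
      · have hZB : Z ⊆ B' := by
          obtain ⟨z, hz, hzA⟩ := Finset.not_subset.1 hZA
          have hmem' : ∀ v ∈ Z, v ∈ A' ∨ v ∈ B' := fun v hv =>
            Finset.mem_union.1 (hU'.symm ▸ (Finset.mem_inter.1 hv).1)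
          intro v hv
          by_contra hvB
          have hvz : v ≠ z := by
            rintro rfl
            exact (hmem' v hv).elim hzA hvB
          exact hs' v ((hmem' v hv).resolve_right hvB) hvB z ((hmem' z hz).resolve_left hzA) hzA
            ⟨hvz, Or.inr ⟨hv, hz⟩⟩
        have hm : Massed G' B' (A' ∩ B') a κ := hbad.massed (hlt'.le.trans hM.card) hmin'
        have hl := hlift B' (A' ∩ B') hB'A hZB Finset.inter_subset_right
          (IH G' B' _ ((Finset.card_le_card hB'A).trans_lt hAlt) hm)
        have h_inter : A' ∩ (B' ∪ B) = A' ∩ B' := by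
          ext v
          simp only [Finset.mem_inter, Finset.mem_union]
          exact ⟨fun h => ⟨h.1, h.2.elim id fun hv => hZB (Finset.mem_inter.2 ⟨hA'A h.1, hv⟩)⟩,
            fun h => ⟨h.1, Or.inl h.2⟩⟩
        have hr : Rigid G U X A' (B' ∪ B) := by
          refine ⟨⟨?_, ?_⟩, hX', by rw [h_inter]; exact hlt'.le, ⟨w, ?_⟩, by rwa [h_inter]⟩
          · rw [← Finset.union_assoc, hU', hU]
          · intro x hx hx' y hy hy' hxy
            simp only [Finset.mem_union, not_or] at hx' hy
            by_cases hyB : y ∈ B'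
            · exact hs' x hx hx'.1 y hyB hy' (hle _ _ hxy)
            · have hyB2 := hy.resolve_left hyB
              exact hs x (hA'A hx) hx'.2 y hyB2 (fun h => hyB (hZB
                (Finset.mem_inter.2 ⟨h, hyB2⟩))) hxy
          · simp only [Finset.mem_sdiff, Finset.mem_union]
            exact ⟨Or.inr hw.1, fun h => hw.2 (hA'A h)⟩
        have h1 := hmin _ _ hr
        have h2 : A' = A := Finset.eq_of_subset_of_card_le hA'A h1
        have h3 : B' \ A' = ∅ := by
          rw [h2]; exact Finset.sdiff_eq_empty_iff_subset.2 hB'A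
        rw [h3] at hb'
        simp [rho] at hb'

end EdgeSep

namespace EdgeSep
open Classical

variable {V : Type}

/-- `G` with the neighbourhood of `u` added to that of `v`. -/
def contr (G : SimpleGraph V) (u v : V) : SimpleGraph V where
  Adj a b := a ≠ b ∧ (G.Adj a b ∨ (a = v ∧ G.Adj u b) ∨ (b = v ∧ G.Adj u a))
  symm := ⟨fun a b (h : a ≠ b ∧ (G.Adj a b ∨ (a = v ∧ G.Adj u b) ∨ (b = v ∧ G.Adj u a))) =>
    ⟨h.1.symm, h.2.imp (fun h' => h'.symm) Or.symm⟩⟩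
  loopless := ⟨fun a (h : a ≠ a ∧ _) => h.1 rfl⟩

lemma Linked.of_contr {G : SimpleGraph V} {U X : Finset V} {u v : V} (huv : G.Adj u v)
    (hu : u ∉ U) (hX : X ⊆ U) (h : Linked (contr G u v) U X) : Linked G (insert u U) X :=
  h.of_contract huv hu hX fun a _ b _ (h : a ≠ b ∧ _) => h.2

/-- Contracting `u v` loses few edges unless `u` and `v` have many common neighbours. -/
lemma rho_contr {G : SimpleGraph V} {U X : Finset V} {u v : V} (huv : G.Adj u v) (hu : u ∈ U)
    (hv : v ∈ U) (huX : u ∉ X) :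
    rho G U (U \ X) ≤ rho (contr G u v) (U.erase u) (U.erase u \ X) +
      2 * (1 + (nbr G (nbr G U u) v).card + X.card) := by
  set G' := contr G u v with hG'
  set old := ((U.erase u ×ˢ U.erase u).filter fun p => G.Adj p.1 p.2 ∧ (p.1 ∈ U \ X ∨ p.2 ∈ U \ X))
    with hold
  set N := nbr G U u with hN
  set new := N.filter (fun b => b ≠ v ∧ ¬ G.Adj v b ∧ b ∉ X) with hnew
  have h1 : rho G U (U \ X) ≤ old.card + 2 * N.card := by
    have : ((U ×ˢ U).filter fun p => G.Adj p.1 p.2 ∧ (p.1 ∈ U \ X ∨ p.2 ∈ U \ X)) ⊆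
        (old ∪ ({u} ×ˢ N)) ∪ (N ×ˢ {u}) := by
      rintro ⟨a, b⟩ hab
      simp only [hold, hN, Finset.mem_filter, Finset.mem_product, Finset.mem_union, mem_nbr,
        Finset.mem_singleton, Finset.mem_erase] at hab ⊢
      obtain ⟨⟨ha, hb⟩, hadj, hor⟩ := hab
      by_cases hau : a = u
      · subst hau
        exact Or.inl (Or.inr ⟨rfl, hb, hadj⟩)
      · by_cases hbu : b = u
        · subst hbu
          exact Or.inr ⟨⟨ha, hadj.symm⟩, rfl⟩
        · exact Or.inl (Or.inl ⟨⟨⟨hau, ha⟩, hbu, hb⟩, hadj, hor⟩)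
    have h2 := Finset.card_le_card this
    have h3 := Finset.card_union_le (old ∪ ({u} ×ˢ N)) (N ×ˢ {u})
    have h4 := Finset.card_union_le old ({u} ×ˢ N)
    rw [Finset.card_product, Finset.card_singleton] at h3 h4
    unfold rho
    omega
  have h2 : old.card + 2 * new.card ≤ rho G' (U.erase u) (U.erase u \ X) := by
    have hd1 : Disjoint old ({v} ×ˢ new ∪ new ×ˢ {v}) := by
      rw [Finset.disjoint_left]
      rintro ⟨a, b⟩ h h'
      simp only [hold, hnew, Finset.mem_filter, Finset.mem_product, Finset.mem_union,
        Finset.mem_singleton] at h h'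
      rcases h' with ⟨rfl, h'⟩ | ⟨h', rfl⟩
      · exact h'.2.2.1 h.2.1
      · exact h'.2.2.1 h.2.1.symm
    have hd2 : Disjoint ({v} ×ˢ new) (new ×ˢ {v}) := by
      rw [Finset.disjoint_left]
      rintro ⟨a, b⟩ h h'
      simp only [hnew, Finset.mem_filter, Finset.mem_product, Finset.mem_singleton] at h h'
      exact h'.1.2.1 h.1
    have hcard : (old ∪ ({v} ×ˢ new ∪ new ×ˢ {v})).card = old.card + 2 * new.card := by
      rw [Finset.card_union_of_disjoint hd1, Finset.card_union_of_disjoint hd2,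
        Finset.card_product, Finset.card_product, Finset.card_singleton]
      ring
    rw [← hcard]
    apply Finset.card_le_card
    rintro ⟨a, b⟩ hab
    have hnewmem : ∀ b ∈ new, b ≠ u ∧ b ∈ U ∧ b ∉ X ∧ b ≠ v ∧ G.Adj u b := fun b hb => by
      simp only [hnew, hN, Finset.mem_filter, mem_nbr] at hb
      exact ⟨hb.1.2.ne', hb.1.1, hb.2.2.2, hb.2.1, hb.1.2⟩
    rw [Finset.mem_union, Finset.mem_union, Finset.mem_product, Finset.mem_product,
      Finset.mem_singleton, Finset.mem_singleton] at hab
    rw [Finset.mem_filter, Finset.mem_product]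
    simp only [Finset.mem_erase, Finset.mem_sdiff]
    rcases hab with h | ⟨h1, h2⟩ | ⟨h1, h2⟩
    · simp only [hold, Finset.mem_filter, Finset.mem_product, Finset.mem_erase,
        Finset.mem_sdiff] at h
      exact ⟨h.1, ⟨h.2.1.ne, Or.inl h.2.1⟩, by tauto⟩
    · obtain ⟨h3, h4, h5, h6, h7⟩ := hnewmem b h2
      simp only at h1
      subst h1
      exact ⟨⟨⟨huv.ne', hv⟩, h3, h4⟩, ⟨h6.symm, Or.inr (Or.inl ⟨rfl, h7⟩)⟩, Or.inr ⟨⟨h3, h4⟩, h5⟩⟩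
    · obtain ⟨h3, h4, h5, h6, h7⟩ := hnewmem a h1
      simp only at h2
      subst h2
      exact ⟨⟨⟨h3, h4⟩, huv.ne', hv⟩, ⟨h6, Or.inr (Or.inr ⟨rfl, h7⟩)⟩, Or.inl ⟨⟨h3, h4⟩, h5⟩⟩
  have h3 : N.card ≤ new.card + (1 + (nbr G N v).card + X.card) := by
    have : N ⊆ new ∪ ({v} ∪ nbr G N v ∪ X) := by
      intro b hb
      simp only [hnew, Finset.mem_union, Finset.mem_filter, Finset.mem_singleton, mem_nbr]
      tauto
    have h4 := Finset.card_le_card this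
    have h5 := Finset.card_union_le new ({v} ∪ nbr G N v ∪ X)
    have h6 := Finset.card_union_le ({v} ∪ nbr G N v) X
    have h7 := Finset.card_union_le {v} (nbr G N v)
    rw [Finset.card_singleton] at h7
    omega
  omega

lemma common_nbr_of_not_rigid [Finite V] {G : SimpleGraph V} {U X : Finset V} {a κ : ℕ}
    (IH : ∀ (G' : SimpleGraph V) (U' X' : Finset V), U'.card < U.card → Massed G' U' X' a κ →
      Linked G' U' X') (hM : Massed G U X a κ) (h : ¬ ∃ A B, Rigid G U X A B)
    (hnl : ¬ Linked G U X) {u v : V} (hu : u ∈ U) (huX : u ∉ X) (hv : v ∈ U) (huv : G.Adj u v) :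
    rho G U (U \ X) + a ≤ a * (U \ X).card + 2 * (1 + (nbr G (nbr G U u) v).card + X.card) := by
  set G' := contr G u v with hG'
  set U' := U.erase u with hU'
  have hUi : insert u U' = U := Finset.insert_erase hu
  have huU' : u ∉ U' := Finset.notMem_erase u U
  have hX' : X ⊆ U' := fun x hx => Finset.mem_erase.2 ⟨fun h => huX (h ▸ hx), hM.sub hx⟩
  have hvU' : v ∈ U' := Finset.mem_erase.2 ⟨huv.ne', hv⟩
  have hlt : U'.card < U.card := Finset.card_erase_lt_of_mem hu
  by_cases hd : rho G' U' (U' \ X) ≤ a * (U' \ X).card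
  · have h1 := rho_contr huv hu hv huX
    have h2 : (U' \ X).card + 1 = (U \ X).card := by
      have : U' \ X = (U \ X).erase u := by ext; simp [hU']; tauto
      rw [this]
      exact Finset.card_erase_add_one (by simp [hu, huX])
    rw [← h2, mul_add]
    change rho G U (U \ X) ≤ rho G' U' (U' \ X) + _ at h1
    omega
  exfalso
  apply hnl
  rw [← hUi]
  refine Linked.of_contr huv huU' hX' (IH G' U' X hlt ⟨hX', hM.card, not_le.1 hd, ?_⟩)
  intro A0 B0 hsep0 hX0 hlt0
  by_contra! hcon
  obtain ⟨A', B', hbad, hle', hmin'⟩ := Bad.exists_min (G := G') (U := U') (X := X) (a := a)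
    ⟨hsep0, hX0, hcon⟩
  have hlt' : (A' ∩ B').card < X.card := hle'.trans_lt hlt0
  obtain ⟨⟨hUu, hs'⟩, hXA', hb'⟩ := id hbad
  have hA'U : A' ⊆ U' := by rw [← hUu]; exact Finset.subset_union_left
  have hB'U : B' ⊆ U' := by rw [← hUu]; exact Finset.subset_union_right
  have huA' : u ∉ A' := fun h => huU' (hA'U h)
  have huB' : u ∉ B' := fun h => huU' (hB'U h)
  have hle : ∀ a b, G.Adj a b → G'.Adj a b := fun a b h => ⟨h.ne, Or.inl h⟩
  have hne : (B' \ A').Nonempty := by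
    rw [Finset.nonempty_iff_ne_empty]
    rintro h
    rw [h] at hb'
    simp [rho] at hb'
  have hnbr : ∀ b, b ≠ v → G.Adj u b → G'.Adj v b := fun b hb h =>
    ⟨hb.symm, Or.inr (Or.inl ⟨rfl, h⟩)⟩
  by_cases hvB : v ∈ B'
  · have hsub : B' ⊆ insert u B' := Finset.subset_insert _ _
    have hm : Massed G' B' (A' ∩ B') a κ := hbad.massed (hlt'.le.trans hM.card) hmin'
    have hl := Linked.of_contr huv huB' Finset.inter_subset_right
      (IH G' B' _ ((Finset.card_le_card hB'U).trans_lt hlt) hm)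
    by_cases hvA : v ∈ A'
    · have h_inter : insert u A' ∩ insert u B' = insert u (A' ∩ B') := by
        ext; simp only [Finset.mem_inter, Finset.mem_insert]; tauto
      have hsd : insert u B' \ insert u A' = B' \ A' := by
        ext w
        simp only [Finset.mem_sdiff, Finset.mem_insert]
        constructor
        · tauto
        · rintro ⟨h1, h2⟩
          exact ⟨Or.inr h1, fun h => h.elim (fun h => huB' (h ▸ h1)) h2⟩
      have hsep : IsSep G U (insert u A') (insert u B') := by
        refine ⟨?_, ?_⟩
        · rw [← hUi, ← hUu]
          ext; simp only [Finset.mem_union, Finset.mem_insert]; tauto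
        · intro x hx hxB y hy hyA hxy
          simp only [Finset.mem_insert, not_or] at hx hxB hy hyA
          exact hs' x (hx.resolve_left hxB.1) hxB.2 y (hy.resolve_left hyA.1) hyA.2 (hle _ _ hxy)
      have hrho : rho G' B' (B' \ A') ≤ rho G (insert u B') (insert u B' \ insert u A') := by
        rw [hsd]
        -- send a merged edge to the corresponding edge at `u`
        let f : V × V → V × V := fun p => if G.Adj p.1 p.2 then p else
          if p.1 = v then (u, p.2) else (p.1, u)
        refine Finset.card_le_card_of_injOn f ?_ ?_
        · rintro ⟨x, y⟩ hxy
          simp only [Finset.coe_filter, Finset.mem_product, Set.mem_ofPred_eq] at hxy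
          obtain ⟨⟨hx, hy⟩, hadj, hor⟩ := hxy
          simp only [Finset.coe_filter, Finset.mem_product, Set.mem_ofPred_eq, f]
          by_cases h1 : G.Adj x y
          · rw [if_pos h1]
            exact ⟨⟨hsub hx, hsub hy⟩, h1, hor⟩
          · rw [if_neg h1]
            have h2 := hadj.2.resolve_left h1
            by_cases h3 : x = v
            · rw [if_pos h3]
              subst h3
              have h4 : G.Adj u y := h2.elim (fun h => h.2) fun h => (hadj.1 h.1.symm).elim
              exact ⟨⟨by simp, hsub hy⟩, h4, Or.inr (hor.resolve_left fun h =>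
                (Finset.mem_sdiff.1 h).2 hvA)⟩
            · rw [if_neg h3]
              obtain ⟨rfl, h4⟩ := h2.resolve_left fun h => h3 h.1
              exact ⟨⟨hsub hx, by simp⟩, h4.symm, Or.inl (hor.resolve_right fun h =>
                (Finset.mem_sdiff.1 h).2 hvA)⟩
        · rintro ⟨x, y⟩ hxy ⟨x', y'⟩ hxy' heq
          simp only [Finset.coe_filter, Finset.mem_product, Set.mem_ofPred_eq] at hxy hxy'
          obtain ⟨⟨hx, hy⟩, hadj, -⟩ := hxy
          obtain ⟨⟨hx', hy'⟩, hadj', -⟩ := hxy'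
          have hxu : x ≠ u := fun h => huB' (h ▸ hx)
          have hyu : y ≠ u := fun h => huB' (h ▸ hy)
          have hxu' : x' ≠ u := fun h => huB' (h ▸ hx')
          have hyu' : y' ≠ u := fun h => huB' (h ▸ hy')
          have hcase : ∀ x y, G'.Adj x y → ¬ G.Adj x y → x ≠ v → y = v := fun x y h1 h2 h3 =>
            ((h1.2.resolve_left h2).resolve_left fun h => h3 h.1).1
          simp only [f] at heq
          by_cases h1 : G.Adj x y <;> by_cases h1' : G.Adj x' y' <;>
            by_cases h2 : x = v <;> by_cases h2' : x' = v <;>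
            simp only [h1, h1', h2, h2', if_true, if_false, Prod.mk.injEq] at heq ⊢ <;>
            grind
      have hbad' : Bad G U X a (insert u A') (insert u B') :=
        ⟨hsep, hXA'.trans (Finset.subset_insert _ _), by rw [hsd] at *; omega⟩
      have hcard : (insert u A' ∩ insert u B').card = (A' ∩ B').card + 1 := by
        rw [h_inter, Finset.card_insert_of_notMem]
        simp [huA']
      have hXc : (insert u A' ∩ insert u B').card = X.card := by
        have : ¬ (insert u A' ∩ insert u B').card < X.card := fun h =>
          absurd (hM.sep _ _ hsep hbad'.2.1 h) (not_le.2 hbad'.2.2)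
        omega
      have hm := hbad'.massed (κ := κ) (hXc.le.trans hM.card) fun A B hAB => by
        by_contra! h
        rw [hXc] at h
        exact absurd (hM.sep A B hAB.1 hAB.2.1 h) (not_le.2 hAB.2.2)
      refine h ⟨_, _, hsep, hbad'.2.1, hXc.le, by rwa [hsd], IH _ _ _ ?_ hm⟩
      -- the far side is proper
      refine Finset.card_lt_card ⟨?_, fun hUB => ?_⟩
      · rw [← hUi]; exact Finset.insert_subset_insert u hB'U
      · have h1 : insert u A' ⊆ insert u A' ∩ insert u B' := fun w hw =>
          Finset.mem_inter.2 ⟨hw, hUB (by rw [← hUi]; exact Finset.insert_subset_insert u hA'U hw)⟩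
        have h2 := Finset.card_le_card h1
        have h3 := Finset.card_le_card hXA'
        rw [Finset.card_insert_of_notMem huA'] at h2
        omega
    · refine h ⟨A', insert u B', ⟨?_, ?_⟩, hXA', ?_, ?_, ?_⟩
      · rw [Finset.union_insert, hUu, hUi]
      · intro x hx hxB y hy hyA hxy
        simp only [Finset.mem_insert, not_or] at hxB hy
        rcases hy with rfl | hy
        · refine hs' x hx hxB.2 v hvB hvA (hnbr x ?_ hxy.symm).symm
          rintro rfl
          exact hvA hx
        · exact hs' x hx hxB.2 y hy hyA (hle _ _ hxy)
      · rw [Finset.inter_insert_of_notMem huA']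
        exact hlt'.le
      · obtain ⟨w, hw⟩ := hne
        rw [Finset.mem_sdiff] at hw
        exact ⟨w, Finset.mem_sdiff.2 ⟨hsub hw.1, hw.2⟩⟩
      · rwa [Finset.inter_insert_of_notMem huA']
  · have hvA : v ∈ A' := (Finset.mem_union.1 (hUu.symm ▸ hvU')).resolve_right hvB
    have hsd : B' \ insert u A' = B' \ A' := by
      ext w
      simp only [Finset.mem_sdiff, Finset.mem_insert, not_or]
      exact ⟨fun h => ⟨h.1, h.2.2⟩, fun h => ⟨h.1, fun h' => huB' (h' ▸ h.1), h.2⟩⟩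
    have h1 := hM.sep (insert u A') B' ⟨?_, ?_⟩ (hXA'.trans (Finset.subset_insert _ _)) (by
      rwa [Finset.insert_inter_of_notMem huB'])
    · rw [hsd] at h1
      have h2 : rho G' B' (B' \ A') ≤ rho G B' (B' \ A') := by
        apply rho_le_of
        intro x hx y hy hxy hor
        exact ⟨hx, hy, hxy.2.resolve_right fun h => h.elim (fun h => hvB (h.1 ▸ hx))
          fun h => hvB (h.1 ▸ hy), hor⟩
      omega
    · rw [Finset.insert_union, hUu, hUi]
    · intro x hx hxB y hy hyA hxy
      simp only [Finset.mem_insert, not_or] at hx hyA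
      rcases hx with rfl | hx
      · exact hs' v hvA hvB y hy hyA.2 (hnbr y (fun h => hvB (h ▸ hy)) hxy)
      · exact hs' x hx hxB y hy hyA.2 (hle _ _ hxy)

end EdgeSep

namespace EdgeSep
open Classical

variable {V : Type}

/-- Any two vertices of `W` are joined by a small connected set avoiding a given set of
`m` vertices. -/
def Robust (G : SimpleGraph V) (W : Finset V) (m : ℕ) : Prop :=
  ∀ x ∈ W, ∀ y ∈ W, ∀ J : Finset V, J.card ≤ m → ∃ C : Finset V, C ⊆ W ∧ Conn G C ∧ x ∈ C ∧
    y ∈ C ∧ C.card ≤ 6 ∧ ∀ v ∈ C, v ∈ J → v = x ∨ v = y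

lemma exists_conn_of_walk {G : SimpleGraph V} {W J : Finset V} {x y : V} (p : G.Walk x y)
    (hp : p.length ≤ 5) (hW : ∀ v ∈ p.support, v ∈ W)
    (hJ : ∀ v ∈ p.support, v ∈ J → v = x ∨ v = y) :
    ∃ C : Finset V, C ⊆ W ∧ Conn G C ∧ x ∈ C ∧ y ∈ C ∧ C.card ≤ 6 ∧
      ∀ v ∈ C, v ∈ J → v = x ∨ v = y := by
  refine ⟨p.support.toFinset, fun v hv => hW v (by simpa using hv), ?_, by simp, by simp, ?_,
    fun v hv => hJ v (by simpa using hv)⟩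
  · convert conn_support p using 1
    ext; simp
  · have := List.toFinset_card_le p.support
    rw [Walk.length_support] at this
    omega

lemma exists_robust {G : SimpleGraph V} {D : Finset V} (hD : D.Nonempty) {b κ : ℕ}
    (hcard : D.card ≤ b) (hdeg : ∀ v ∈ D, b ≤ 2 * (1 + (nbr G D v).card + κ))
    (hκ : 1 ≤ κ) (hb : 200 * κ ≤ b) : ∃ W ⊆ D, κ ≤ W.card ∧ Robust G W (7 * κ) := by
  by_cases hR : Robust G D (7 * κ)
  · obtain ⟨v, hv⟩ := hD
    have h1 := hdeg v hv
    have h2 : (nbr G D v).card ≤ D.card := Finset.card_le_card (Finset.filter_subset _ _)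
    exact ⟨D, subset_rfl, by omega, hR⟩
  unfold Robust at hR
  push Not at hR
  obtain ⟨x0, hx0, y0, hy0, J, hJ, hC⟩ := hR
  have hne : ∀ p : G.Walk x0 y0, p.length ≤ 5 → (∀ v ∈ p.support, v ∈ D) →
      (∀ v ∈ p.support, v ∈ J → v = x0 ∨ v = y0) → False := by
    intro p h1 h2 h3
    obtain ⟨C, hCD, hc, hx, hy, h6, hav⟩ := exists_conn_of_walk p h1 h2 h3
    obtain ⟨v, hv, hvJ, h⟩ := hC C hCD hc hx hy h6
    exact h.2 ((hav v hv hvJ).resolve_left h.1)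
  set K := D \ J with hK
  have hKD : ∀ v, v ∈ K → v ∈ D ∧ v ∉ J := fun v hv => by simpa [hK] using hv
  have hdK : ∀ v ∈ D, b ≤ 2 * (1 + (nbr G K v).card + 8 * κ) := by
    intro v hv
    have h1 := hdeg v hv
    have h2 : nbr G D v ⊆ nbr G K v ∪ J := fun w hw => by
      rw [mem_nbr] at hw
      by_cases h : w ∈ J
      · exact Finset.mem_union_right _ h
      · exact Finset.mem_union_left _ (mem_nbr.2 ⟨by simp [hK, hw.1, h], hw.2⟩)
    have h3 := (Finset.card_le_card h2).trans (Finset.card_union_le _ _)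
    omega
  have hx := hdK x0 hx0
  have hy := hdK y0 hy0
  obtain ⟨x, hxn⟩ : (nbr G K x0).Nonempty := Finset.card_pos.1 (by omega)
  obtain ⟨y, hyn⟩ : (nbr G K y0).Nonempty := Finset.card_pos.1 (by omega)
  rw [mem_nbr] at hxn hyn
  set B := K.filter (fun z => z = x ∨ G.Adj x z ∨ ∃ w ∈ K, G.Adj x w ∧ G.Adj w z) with hB
  have hdisj : Disjoint B (nbr G K y) := by
    rw [Finset.disjoint_left]
    intro z hz hzy
    rw [mem_nbr] at hzy
    simp only [hB, Finset.mem_filter] at hz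
    have kx := hKD x hxn.1
    have ky := hKD y hyn.1
    have kz := hKD z hz.1
    obtain ⟨-, rfl | h | ⟨w, hw, h1, h2⟩⟩ := hz
    · refine hne (.cons hxn.2 (.cons hzy.2.symm (.cons hyn.2.symm .nil))) (by simp) ?_ ?_ <;>
        simp [*]
    · refine hne (.cons hxn.2 (.cons h (.cons hzy.2.symm (.cons hyn.2.symm .nil)))) (by simp) ?_ ?_
        <;> simp [*]
    · have kw := hKD w hw
      refine hne (.cons hxn.2 (.cons h1 (.cons h2 (.cons hzy.2.symm (.cons hyn.2.symm .nil)))))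
        (by simp) ?_ ?_ <;> simp [*]
  have hcB : 2 * B.card ≤ b + 2 + 16 * κ := by
    have h1 := Finset.card_union_of_disjoint hdisj
    have h2 : B ∪ nbr G K y ⊆ D := fun v hv => by
      rcases Finset.mem_union.1 hv with h | h
      · exact (hKD v (Finset.filter_subset _ _ h)).1
      · exact (hKD v (mem_nbr.1 h).1).1
    have h3 := Finset.card_le_card h2
    have h4 := hdK y (hKD y hyn.1).1
    omega
  set W := insert x (nbr G K x) with hW
  have hWK : ∀ w ∈ W, w ∈ K ∧ (w = x ∨ G.Adj x w) := by
    intro w hw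
    rcases Finset.mem_insert.1 hw with rfl | h
    · exact ⟨hxn.1, Or.inl rfl⟩
    · rw [mem_nbr] at h
      exact ⟨h.1, Or.inr h.2⟩
  have hWB : W ⊆ B := fun w hw => by
    have := hWK w hw
    exact Finset.mem_filter.2 ⟨this.1, this.2.imp_right Or.inl⟩
  have hmiss : ∀ w ∈ W, (W \ nbr G K w).card ≤ 2 + 16 * κ := by
    intro w hw
    have h1 : nbr G K w ⊆ B := fun z hz => by
      rw [mem_nbr] at hz
      refine Finset.mem_filter.2 ⟨hz.1, ?_⟩
      obtain ⟨h2, rfl | h3⟩ := hWK w hw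
      · exact Or.inr (Or.inl hz.2)
      · exact Or.inr (Or.inr ⟨w, h2, h3, hz.2⟩)
    have h2 : W \ nbr G K w ⊆ B \ nbr G K w := Finset.sdiff_subset_sdiff hWB subset_rfl
    have h3 := Finset.card_le_card h2
    rw [Finset.card_sdiff_of_subset h1] at h3
    have h4 := hdK w (hKD w (hWK w hw).1).1
    omega
  have hWc : b ≤ 2 * (W.card + 8 * κ) := by
    have h1 := hdK x (hKD x hxn.1).1
    have : x ∉ nbr G K x := fun h => (mem_nbr.1 h).2.ne rfl
    rw [hW, Finset.card_insert_of_notMem this]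
    omega
  refine ⟨W, fun w hw => (hKD w (hWK w hw).1).1, by omega, ?_⟩
  intro s hs t ht J' hJ'
  have hex : ∃ w ∈ W, w ∉ (W \ nbr G K s) ∪ (W \ nbr G K t) ∪ J' := by
    by_contra! hcon
    have h1 := Finset.card_le_card (show W ⊆ _ from hcon)
    have h2 := Finset.card_union_le ((W \ nbr G K s) ∪ (W \ nbr G K t)) J'
    have h3 := Finset.card_union_le (W \ nbr G K s) (W \ nbr G K t)
    have h4 := hmiss s hs
    have h5 := hmiss t ht
    omega
  obtain ⟨w, hw, hw'⟩ := hex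
  simp only [Finset.mem_union, Finset.mem_sdiff, not_or, not_and, not_not] at hw'
  have h1 := (mem_nbr.1 (hw'.1.1 hw)).2
  have h2 := (mem_nbr.1 (hw'.1.2 hw)).2
  refine exists_conn_of_walk (.cons h1 (.cons h2.symm .nil)) (by simp) ?_ ?_
  · simp [hs, ht, hw]
  · simp [hw'.2]

/-- Greedy linkage in a robust set. -/
lemma Robust.hub {G : SimpleGraph V} {W : Finset V} {κ : ℕ} (h : Robust G W (7 * κ)) :
    Hub G W W κ := by
  intro E hE hcard ι s t hst hd
  have hinj : Function.Injective s := fun i j hij => by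
    by_contra hne
    exact (hd i j hne).1 hij
  have : Finite ι := Finite.of_injective (fun i => (⟨s i, (hst i).1⟩ : E)) fun i j hij =>
    hinj (by simpa using hij)
  have := Fintype.ofFinite ι
  have hι : Fintype.card ι ≤ κ := by
    refine le_trans ?_ hcard
    rw [← Fintype.card_coe]
    exact Fintype.card_le_of_injective (fun i => (⟨s i, (hst i).1⟩ : E)) fun i j hij =>
      hinj (by simpa using hij)
  have key : ∀ T : Finset ι, ∃ C : ι → Finset V, ∀ i ∈ T, C i ⊆ W ∧ Conn G (C i) ∧ s i ∈ C i ∧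
      t i ∈ C i ∧ (C i).card ≤ 6 ∧ (∀ v ∈ C i, v ∈ E → v = s i ∨ v = t i) ∧
      ∀ j ∈ T, i ≠ j → ∀ v ∈ C i, v ∉ C j := by
    intro T
    induction T using Finset.induction_on with
    | empty => exact ⟨fun _ => ∅, by simp⟩
    | insert i T hi ih =>
      obtain ⟨C, hC⟩ := ih
      obtain ⟨D, h1, h2, h3, h4, h5, h6⟩ := h (s i) (hE (hst i).1) (t i) (hE (hst i).2)
        (E ∪ T.biUnion C) (by
          have h1 := Finset.card_union_le E (T.biUnion C)
          have h2 := Finset.card_biUnion_le_card_mul T C 6 fun j hj => (hC j hj).2.2.2.2.1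
          have h3 : T.card ≤ Fintype.card ι := Finset.card_le_univ T
          omega)
      have hDd : ∀ j ∈ T, ∀ v ∈ D, v ∉ C j := by
        intro j hj v hv hvj
        have hij : i ≠ j := fun h => hi (h ▸ hj)
        have := h6 v hv (Finset.mem_union_right _ (Finset.mem_biUnion.2 ⟨j, hj, hvj⟩))
        obtain ⟨-, -, -, -, -, h7, -⟩ := hC j hj
        have d1 := hd i j hij
        have d2 := hd j i hij.symm
        rcases this with rfl | rfl
        · rcases h7 _ hvj (hst i).1 with h | h
          exacts [d1.1 h, d1.2.1 h]
        · rcases h7 _ hvj (hst i).2 with h | h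
          exacts [d2.2.1 h.symm, d1.2.2 h]
      refine ⟨fun j => if j = i then D else C j, fun j hj => ?_⟩
      by_cases hji : j = i
      · subst hji
        simp only [if_true]
        refine ⟨h1, h2, h3, h4, h5, fun v hv hvE => h6 v hv (Finset.mem_union_left _ hvE), ?_⟩
        intro j' hj' hne v hv
        rw [if_neg hne.symm]
        exact hDd j' (Finset.mem_of_mem_insert_of_ne hj' hne.symm) v hv
      · simp only [if_neg hji]
        have hjT := Finset.mem_of_mem_insert_of_ne hj hji
        obtain ⟨c1, c2, c3, c4, c5, c6, c7⟩ := hC j hjT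
        refine ⟨c1, c2, c3, c4, c5, c6, ?_⟩
        intro j' hj' hne v hv
        by_cases hji' : j' = i
        · simp only [if_pos hji']
          exact fun hv' => hDd j hjT v hv' hv
        · simp only [if_neg hji']
          exact c7 j' (Finset.mem_of_mem_insert_of_ne hj' hji') hne v hv
  obtain ⟨C, hC⟩ := key Finset.univ
  have hC := fun i => hC i (Finset.mem_univ i)
  exact ⟨fun i => C i, fun i => (hC i).2.1, fun i => (hC i).2.2.1, fun i => (hC i).2.2.2.1,
    fun i => Finset.coe_subset.2 (hC i).1, fun i v hv hvE => (hC i).2.2.2.2.2.1 v hv (by simpa using hvE),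
    fun i j hij v hv => (hC i).2.2.2.2.2.2 j (Finset.mem_univ j) hij v hv⟩

end EdgeSep

namespace EdgeSep
open Classical

variable {V : Type}

/-- A dense rooted graph without small dense separations is linked. -/
theorem massed_linked [Finite V] {κ : ℕ} (hκ : 1 ≤ κ) : ∀ (n : ℕ) (G : SimpleGraph V)
    (U X : Finset V), U.card = n → Massed G U X (200 * κ) κ → Linked G U X := by
  intro n
  induction n using Nat.strong_induction_on with
  | _ n ih =>
  intro G U X hn hM
  have IH : ∀ (G' : SimpleGraph V) (U' X' : Finset V), U'.card < U.card →
      Massed G' U' X' (200 * κ) κ → Linked G' U' X' :=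
    fun G' U' X' h h' => ih _ (hn ▸ h) G' U' X' rfl h'
  by_contra hnl
  have hnr : ¬ ∃ A B, Rigid G U X A B := fun h => hnl (linked_of_rigid IH hM h)
  set a := 200 * κ with ha
  set Y := U \ X with hY
  have hdense := hM.dense
  obtain ⟨ξ, hξ⟩ : ∃ ξ, rho G U Y = a * Y.card + ξ := ⟨_, (Nat.add_sub_of_le hdense.le).symm⟩
  have hξ1 : 1 ≤ ξ := by change a * Y.card < rho G U Y at hdense; omega
  -- a vertex of small degree
  obtain ⟨u, huY, hdeg⟩ : ∃ u ∈ Y, (nbr G U u).card ≤ a + ξ := by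
    by_contra! hcon
    have h1 : ∑ u ∈ Y, (nbr G U u).card ≤ rho G U Y := by
      rw [← Finset.card_sigma]
      refine Finset.card_le_card_of_injOn (fun p => (p.1, p.2)) ?_ ?_
      · rintro ⟨p, q⟩ hpq
        simp only [Finset.mem_coe, Finset.mem_sigma, mem_nbr, Finset.mem_filter,
          Finset.mem_product] at hpq ⊢
        exact ⟨⟨(Finset.mem_sdiff.1 hpq.1).1, hpq.2.1⟩, hpq.2.2, Or.inl hpq.1⟩
      · rintro ⟨p, q⟩ _ ⟨p', q'⟩ _ h
        simpa using h
    have h2 : Y.card * (a + ξ + 1) ≤ ∑ u ∈ Y, (nbr G U u).card := by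
      rw [← smul_eq_mul]
      exact Finset.card_nsmul_le_sum _ _ _ fun u hu => hcon u hu
    rcases Nat.eq_zero_or_pos Y.card with h0 | h0
    · rw [Finset.card_eq_zero] at h0
      rw [h0] at hξ
      have : rho G U ∅ = 0 := by simp [rho]
      rw [this] at hξ
      omega
    · nlinarith
  obtain ⟨huU, huX⟩ := Finset.mem_sdiff.1 huY
  set D := nbr G U u with hD
  by_cases hDe : D.Nonempty
  · have hdegD : ∀ v ∈ D, a + ξ ≤ 2 * (1 + (nbr G D v).card + κ) := by
      intro v hv
      obtain ⟨hvU, huv⟩ := mem_nbr.1 hv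
      have h1 := common_nbr_of_not_rigid IH hM hnr hnl huU huX hvU huv
      have h2 := hM.card
      change rho G U Y + a ≤ a * Y.card + 2 * (1 + (nbr G D v).card + X.card) at h1
      omega
    obtain ⟨W, hWD, hκW, hR⟩ := exists_robust hDe hdeg hdegD hκ (by omega)
    have hWU : W ⊆ U := hWD.trans (Finset.filter_subset _ _)
    obtain ⟨A, B, z, P, hsep, hXA, hWB, hF, hor⟩ := exists_fan G hM.sub hWU
    have hle : (A ∩ B).card ≤ X.card := by
      rcases hor with ⟨h, -⟩ | h
      · rw [h]
      · exact h.le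
    have hl : Linked G B (A ∩ B) := hF.linked hR.hub (hle.trans hM.card) (fun v hv _ => hv)
      (Set.union_subset subset_rfl (Finset.coe_subset.2 hWB))
    rcases hor with ⟨h1, h2⟩ | h
    · rw [h1, h2] at hl
      exact hnl hl
    · refine hnr ⟨A, B, hsep, hXA, hle, ?_, hl⟩
      by_contra hcon
      rw [Finset.not_nonempty_iff_eq_empty, Finset.sdiff_eq_empty_iff_subset] at hcon
      have h1 : W ⊆ A ∩ B := Finset.subset_inter (hWB.trans hcon) hWB
      have h2 := Finset.card_le_card h1
      have h3 := hM.card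
      omega
  · have hno : ∀ b ∈ U, ¬ G.Adj u b := fun b hb h => hDe ⟨b, mem_nbr.2 ⟨hb, h⟩⟩
    have hXU : X ⊆ U.erase u := fun x hx => Finset.mem_erase.2 ⟨fun h => huX (h ▸ hx), hM.sub hx⟩
    refine hnl ((IH G (U.erase u) X (Finset.card_erase_lt_of_mem huU) ⟨hXU, hM.card, ?_, ?_⟩).mono
      (Finset.erase_subset _ _))
    · have h1 : rho G U Y ≤ rho G (U.erase u) (U.erase u \ X) := by
        refine rho_le_of fun p hp q hq hpq hor => ?_
        have hpu : p ≠ u := fun h => hno q hq (h ▸ hpq)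
        have hqu : q ≠ u := fun h => hno p hp (h ▸ hpq.symm)
        simp only [hY, Finset.mem_sdiff, Finset.mem_erase] at hor ⊢
        tauto
      have h2 : (U.erase u \ X).card ≤ Y.card :=
        Finset.card_le_card (Finset.sdiff_subset_sdiff (Finset.erase_subset _ _) subset_rfl)
      calc a * (U.erase u \ X).card ≤ a * Y.card := Nat.mul_le_mul_left _ h2
        _ < _ := hdense.trans_le h1
    · intro A B hsep hXA hlt
      have hBU : B ⊆ U.erase u := by rw [← hsep.1]; exact Finset.subset_union_right
      have huB : u ∉ B := fun h => Finset.notMem_erase u U (hBU h)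
      have h1 : insert u A ∩ B = A ∩ B := by
        ext v; simp only [Finset.mem_inter, Finset.mem_insert]
        constructor
        · rintro ⟨rfl | h, h'⟩
          exacts [absurd h' huB, ⟨h, h'⟩]
        · exact fun h => ⟨Or.inr h.1, h.2⟩
      have h2 : B \ insert u A = B \ A := by
        ext v; simp only [Finset.mem_sdiff, Finset.mem_insert]
        constructor
        · exact fun h => ⟨h.1, fun h' => h.2 (Or.inr h')⟩
        · rintro ⟨h, h'⟩
          exact ⟨h, fun h'' => h''.elim (fun h3 => huB (h3 ▸ h)) h'⟩
      have := hM.sep (insert u A) B ⟨by rw [Finset.insert_union, hsep.1, Finset.insert_erase huU],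
        fun p hp hpB q hq hqA hpq => ?_⟩ (hXA.trans (Finset.subset_insert _ _)) (by rwa [h1])
      · rwa [h2] at this
      · rcases Finset.mem_insert.1 hp with rfl | hp
        · exact hno q (Finset.mem_of_mem_erase (hBU hq)) hpq
        · exact hsep.2 p hp hpB q hq (fun h => hqA (Finset.mem_insert_of_mem h)) hpq

end EdgeSep

namespace EdgeSep
open Classical

variable {V : Type}

lemma exists_walk_coe {G : SimpleGraph V} (A : G.Subgraph) {a b : V} (p : G.Walk a b)
    (ha : a ∈ A.verts) (hb : b ∈ A.verts) (he : ∀ e ∈ p.edges, e ∈ A.edgeSet) :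
    ∃ q : A.coe.Walk ⟨a, ha⟩ ⟨b, hb⟩, q.map A.hom = p := by
  induction p with
  | nil => exact ⟨Walk.nil, rfl⟩
  | @cons a c b hadj p ih =>
    have h : A.Adj a c := he s(a, c) (by simp)
    obtain ⟨q, hq⟩ := ih h.snd_mem hb fun e h => he e (by simp [h])
    have h' : A.coe.Adj ⟨a, ha⟩ ⟨c, h.snd_mem⟩ := h
    exact ⟨Walk.cons h' q, congrArg (Walk.cons hadj) hq⟩

/-- The union of a system of branch paths. -/
def unionOfPaths {α : Type} {H : SimpleGraph α} {G : SimpleGraph V} (f : α → V)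
    (P : ∀ ⦃x y⦄, H.Adj x y → G.Walk (f x) (f y)) : G.Subgraph where
  verts := {v | v ∈ Set.range f ∨ ∃ x y, ∃ h : H.Adj x y, v ∈ (P h).support}
  Adj a b := ∃ x y, ∃ h : H.Adj x y, s(a, b) ∈ (P h).edges
  adj_sub := by
    rintro a b ⟨x, y, h, hab⟩
    exact (P h).adj_of_mem_edges hab
  edge_vert := by
    rintro a b ⟨x, y, h, hab⟩
    exact Or.inr ⟨x, y, h, (P h).fst_mem_support_of_mem_edges hab⟩
  symm := ⟨by
    rintro a b ⟨x, y, h, hab⟩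
    exact ⟨x, y, h, Sym2.eq_swap ▸ hab⟩⟩

lemma mem_unionOfPaths {α : Type} {H : SimpleGraph α} {G : SimpleGraph V} (f : α → V)
    (P : ∀ ⦃x y⦄, H.Adj x y → G.Walk (f x) (f y)) (e : Sym2 V) :
    e ∈ (unionOfPaths f P).edgeSet ↔ ∃ x y, ∃ h : H.Adj x y, e ∈ (P h).edges := by
  induction e
  rfl

lemma isSubdivision_unionOfPaths {α : Type} {H : SimpleGraph α} {G : SimpleGraph V} (f : α → V)
    (P : ∀ ⦃x y⦄, H.Adj x y → G.Walk (f x) (f y)) (hf : Function.Injective f)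
    (hP : ∀ ⦃x y⦄ (h : H.Adj x y), (P h).IsPath)
    (hrev : ∀ ⦃x y⦄ (h : H.Adj x y), P h.symm = (P h).reverse)
    (hend : ∀ ⦃x y⦄ (h : H.Adj x y), ∀ v ∈ (P h).support, v ∈ Set.range f → v = f x ∨ v = f y)
    (hdisj : ∀ ⦃x y x' y'⦄ (h : H.Adj x y) (h' : H.Adj x' y'), s(x, y) ≠ s(x', y') →
      ∀ v ∈ (P h).support, v ∈ (P h').support → v ∈ Set.range f) :
    IsSubdivision H (unionOfPaths f P).coe := by
  set A := unionOfPaths f P with hA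
  have hfA : ∀ x, f x ∈ A.verts := fun x => Or.inl ⟨x, rfl⟩
  have key : ∀ x y (h : H.Adj x y), ∃ q : A.coe.Walk ⟨f x, hfA x⟩ ⟨f y, hfA y⟩,
      q.map A.hom = P h := fun x y h =>
    exists_walk_coe A (P h) _ _ fun e he => (mem_unionOfPaths f P e).2 ⟨x, y, h, he⟩
  choose Q hQ using key
  have hinj : Function.Injective A.hom := A.hom_injective
  have hsupp : ∀ x y (h : H.Adj x y) (v : A.verts), v ∈ (Q x y h).support ↔ (v : V) ∈ (P h).support := by
    intro x y h v
    have h1 : (P h).support = (Q x y h).support.map A.hom :=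
      (congrArg Walk.support (hQ x y h)).symm.trans (Walk.support_map _ _)
    rw [h1]
    exact (List.mem_map_of_injective hinj).symm
  have hrange : ∀ v : A.verts, v ∈ Set.range (fun x => (⟨f x, hfA x⟩ : A.verts)) ↔
      (v : V) ∈ Set.range f := by
    intro v
    simp [Subtype.ext_iff]
  refine ⟨fun x => ⟨f x, hfA x⟩, fun x y h => Q x y h, ?_, ?_, ?_, ?_, ?_, ?_, ?_⟩
  · intro x y hxy
    exact hf (Subtype.ext_iff.1 hxy)
  · intro x y h
    have := hP h
    rw [← hQ x y h] at this
    exact Walk.IsPath.of_map this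
  · intro x y h
    apply Walk.map_injective_of_injective hinj
    exact (hQ y x h.symm).trans ((hrev h).trans ((congrArg Walk.reverse (hQ x y h)).symm.trans
      (Walk.reverse_map _ _)))
  · intro x y h v hv hvr
    rcases hend h v ((hsupp x y h v).1 hv) ((hrange v).1 hvr) with h | h
    · exact Or.inl (Subtype.ext h)
    · exact Or.inr (Subtype.ext h)
  · intro x y x' y' h h' hne v hv hv'
    exact (hrange v).2 (hdisj h h' hne v ((hsupp x y h v).1 hv) ((hsupp x' y' h' v).1 hv'))
  · intro v
    rcases v.2 with h | ⟨x, y, h, hv⟩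
    · exact Or.inl ((hrange v).2 h)
    · exact Or.inr ⟨x, y, h, (hsupp x y h v).2 hv⟩
  · intro e he
    induction e with
    | _ a b =>
    obtain ⟨x, y, h, hab⟩ : ∃ x y, ∃ h : H.Adj x y, s((a : V), (b : V)) ∈ (P h).edges := he
    refine ⟨x, y, h, ?_⟩
    have h1 : (P h).edges = (Q x y h).edges.map (Sym2.map A.hom) :=
      (congrArg Walk.edges (hQ x y h)).symm.trans (Walk.edges_map _ _)
    rw [h1] at hab
    obtain ⟨e, he, hee⟩ := List.mem_map.1 hab
    rwa [Sym2.map.injective hinj (hee.trans (Sym2.map_mk A.hom a b).symm)] at he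

end EdgeSep

namespace EdgeSep
open Classical

variable {V : Type}

/-- Twice the number of edges inside `U`. -/
noncomputable def vol (G : SimpleGraph V) (U : Finset V) : ℕ := ∑ v ∈ U, (nbr G U v).card

/-- `G[T]` has large minimum degree and no small separations. -/
structure Good (G : SimpleGraph V) (T : Finset V) (κ : ℕ) : Prop where
  nonempty : T.Nonempty
  deg : ∀ v ∈ T, 200 * κ < (nbr G T v).card
  conn : ∀ A B, IsSep G T A B → (A ∩ B).card < κ → A ⊆ B ∨ B ⊆ A

lemma nbr_card_le {G : SimpleGraph V} {U : Finset V} {v : V} : (nbr G U v).card ≤ U.card :=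
  Finset.card_le_card (Finset.filter_subset _ _)

lemma nbr_mono {G : SimpleGraph V} {U U' : Finset V} (h : U ⊆ U') (v : V) :
    nbr G U v ⊆ nbr G U' v := Finset.filter_subset_filter _ h

lemma vol_le_add {G : SimpleGraph V} {T A B : Finset V} (h : IsSep G T A B) :
    vol G T ≤ vol G A + vol G B := by
  have key : ∀ U, vol G U = ((U ×ˢ U).filter fun p => G.Adj p.1 p.2).card := by
    intro U
    unfold vol
    rw [← Finset.card_sigma]
    refine Finset.card_bij' (fun p _ => (p.1, p.2)) (fun p _ => ⟨p.1, p.2⟩) ?_ ?_ ?_ ?_ <;>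
      simp [mem_nbr] <;> tauto
  rw [key, key, key]
  refine le_trans (Finset.card_le_card ?_) (Finset.card_union_le _ _)
  rintro ⟨a, b⟩ hab
  simp only [Finset.mem_filter, Finset.mem_product, Finset.mem_union] at hab ⊢
  rw [← h.1, Finset.mem_union, Finset.mem_union] at hab
  have h1 := h.2 a
  have h2 := h.2 b
  have h3 := hab.2.symm
  by_cases haA : a ∈ A <;> by_cases haB : a ∈ B <;> by_cases hbA : b ∈ A <;>
    by_cases hbB : b ∈ B <;> simp_all

lemma vol_erase {G : SimpleGraph V} {T : Finset V} {v : V} (hv : v ∈ T) :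
    vol G T ≤ vol G (T.erase v) + 2 * (nbr G T v).card := by
  unfold vol
  rw [← Finset.add_sum_erase _ _ hv]
  have h1 : ∀ u ∈ T.erase v, (nbr G T u).card ≤ (nbr G (T.erase v) u).card +
      if G.Adj v u then 1 else 0 := by
    intro u _
    split_ifs with h
    · refine (Finset.card_le_card (t := insert v (nbr G (T.erase v) u)) ?_).trans
        (Finset.card_insert_le _ _)
      intro w hw
      rw [mem_nbr] at hw
      rw [Finset.mem_insert, mem_nbr, Finset.mem_erase]
      tauto
    · refine Finset.card_le_card fun w hw => ?_
      rw [mem_nbr] at hw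
      rw [mem_nbr, Finset.mem_erase]
      exact ⟨⟨fun h' => h (h' ▸ hw.2.symm), hw.1⟩, hw.2⟩
  have h2 := Finset.sum_le_sum h1
  rw [Finset.sum_add_distrib, ← Finset.card_filter] at h2
  have h3 : ((T.erase v).filter (fun u => G.Adj v u)).card ≤ (nbr G T v).card :=
    Finset.card_le_card (Finset.filter_subset_filter _ (Finset.erase_subset _ _))
  omega

/-- Every dense graph contains a highly connected dense subgraph. -/
theorem exists_good {G : SimpleGraph V} {U : Finset V} {κ : ℕ} (hκ : 1 ≤ κ) (hU : U.Nonempty)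
    (hd : 400 * κ * U.card ≤ vol G U) : ∃ T ⊆ U, Good G T κ := by
  let Q : Finset V → Prop := fun T => T ⊆ U ∧ 2 * κ ≤ T.card ∧
    400 * κ * T.card < vol G T + 400 * κ * κ
  have hQU : Q U := by
    have h1 : vol G U ≤ U.card * U.card := by
      rw [← smul_eq_mul]
      exact Finset.sum_le_card_nsmul _ _ _ fun v _ => nbr_card_le
    have h2 := hU.card_pos
    refine ⟨subset_rfl, ?_, by nlinarith⟩
    have : 400 * κ ≤ U.card := Nat.le_of_mul_le_mul_right (hd.trans h1) h2
    omega
  obtain ⟨T, ⟨hTU, hT2, hTd⟩, hmin⟩ := exists_minimal_of_wellFoundedLT Q ⟨U, hQU⟩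
  have hlt : ∀ S, S ⊆ T → S ≠ T → 2 * κ ≤ S.card → vol G S + 400 * κ * κ ≤ 400 * κ * S.card := by
    intro S hS hne h2
    by_contra! hcon
    exact hne (hS.antisymm (hmin ⟨hS.trans hTU, h2, hcon⟩ hS))
  have hT2' : 2 * κ < T.card := by
    refine lt_of_le_of_ne hT2 fun h => ?_
    have h1 : vol G T ≤ T.card * T.card := by
      rw [← smul_eq_mul]
      exact Finset.sum_le_card_nsmul _ _ _ fun v _ => nbr_card_le
    rw [← h] at h1 hTd
    nlinarith
  have hdeg : ∀ v ∈ T, 200 * κ < (nbr G T v).card := by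
    intro v hv
    have h1 := Finset.card_erase_add_one hv
    have h2 := hlt (T.erase v) (Finset.erase_subset _ _)
      (fun h => Finset.notMem_erase v T (by rw [h]; exact hv)) (by omega)
    have h3 := vol_erase (G := G) hv
    rw [← h1, mul_add] at hTd
    omega
  refine ⟨T, hTU, Finset.card_pos.1 (by omega), hdeg, fun A B hAB hc => ?_⟩
  by_contra! hcon
  obtain ⟨a, haA, haB⟩ := Finset.not_subset.1 hcon.1
  obtain ⟨b, hbB, hbA⟩ := Finset.not_subset.1 hcon.2
  have hAT : A ⊆ T := by rw [← hAB.1]; exact Finset.subset_union_left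
  have hBT : B ⊆ T := by rw [← hAB.1]; exact Finset.subset_union_right
  have hA : nbr G T a ⊆ A := fun w hw => by
    rw [mem_nbr, ← hAB.1, Finset.mem_union] at hw
    by_contra h
    exact hAB.2 a haA haB w (hw.1.resolve_left h) h hw.2
  have hB : nbr G T b ⊆ B := fun w hw => by
    rw [mem_nbr, ← hAB.1, Finset.mem_union] at hw
    by_contra h
    exact hAB.2 w (hw.1.resolve_right h) h b hbB hbA hw.2.symm
  have h1 := hdeg a (hAT haA)
  have h2 := hdeg b (hBT hbB)
  have h3 := Finset.card_le_card hA
  have h4 := Finset.card_le_card hB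
  have h5 := hlt A hAT (fun h => hbA (h ▸ hBT hbB)) (by omega)
  have h6 := hlt B hBT (fun h => haB (h ▸ hAT haA)) (by omega)
  have h7 := vol_le_add hAB
  have h8 := Finset.card_union_add_card_inter A B
  rw [hAB.1] at h8
  nlinarith

lemma Good.massed {G : SimpleGraph V} {T X : Finset V} {κ : ℕ} (h : Good G T κ)
    (hX : X ⊆ T) (hc : X.card ≤ κ) : Massed G T X (200 * κ) κ := by
  refine ⟨hX, hc, ?_, fun A B hAB hXA hlt => ?_⟩
  · have h1 : ∑ u ∈ T \ X, (nbr G T u).card ≤ rho G T (T \ X) := by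
      rw [← Finset.card_sigma]
      refine Finset.card_le_card_of_injOn (fun p => (p.1, p.2)) ?_ ?_
      · rintro ⟨p, q⟩ hpq
        simp only [Finset.mem_coe, Finset.mem_sigma, mem_nbr, Finset.mem_filter,
          Finset.mem_product] at hpq ⊢
        exact ⟨⟨(Finset.mem_sdiff.1 hpq.1).1, hpq.2.1⟩, hpq.2.2, Or.inl hpq.1⟩
      · rintro ⟨p, q⟩ _ ⟨p', q'⟩ _ h
        simpa using h
    have h2 : (T \ X).card • (200 * κ + 1) ≤ ∑ u ∈ T \ X, (nbr G T u).card :=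
      Finset.card_nsmul_le_sum _ _ _ fun u hu => h.deg u (Finset.mem_sdiff.1 hu).1
    have h3 : 0 < (T \ X).card := by
      obtain ⟨v, hv⟩ := h.nonempty
      have h4 := h.deg v hv
      have h5 : (nbr G T v).card ≤ T.card := nbr_card_le
      have h6 := Finset.le_card_sdiff X T
      omega
    rw [smul_eq_mul] at h2
    nlinarith
  · rcases h.conn A B hAB (hlt.trans_le hc) with h' | h'
    · rw [Finset.inter_eq_left.2 h'] at hlt
      exact absurd (Finset.card_le_card hXA) (not_le.2 hlt)
    · rw [Finset.sdiff_eq_empty_iff_subset.2 h']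
      simp [rho]

lemma Good.linked [Finite V] {G : SimpleGraph V} {T X : Finset V} {κ : ℕ} (h : Good G T κ)
    (hκ : 1 ≤ κ) (hX : X ⊆ T) (hc : X.card ≤ κ) : Linked G T X :=
  massed_linked hκ _ G T X rfl (h.massed hX hc)

end EdgeSep

namespace EdgeSep
open Classical

variable {V : Type}

/-- A subdivision from paths with interiors in disjoint sets `D e`, one for each edge of `H`
in one orientation. -/
lemma exists_subdivision_of_paths {α : Type} [Finite α] {H : SimpleGraph α} {G : SimpleGraph V}
    (f : α → V) (hf : Function.Injective f) (φ : α → ℕ) (hφ : Function.Injective φ)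
    (D : Sym2 α → Set V) (hD : ∀ e e', e ≠ e' → ∀ w, w ∈ D e → w ∉ D e')
    (Lo Hi : Sym2 α → Set (Sym2 V))
    (hW : ∀ x y, H.Adj x y → φ x < φ y → ∃ p : G.Walk (f x) (f y), p.IsPath ∧
      (∀ w ∈ p.support, w ∈ Set.range f → w = f x ∨ w = f y) ∧
      (∀ w ∈ p.support, w ∈ Set.range f ∨ w ∈ D s(x, y)) ∧ (∀ e ∈ Lo s(x, y), e ∈ p.edges) ∧
      ∀ e ∈ p.edges, e ∈ Hi s(x, y)) :
    ∃ A : G.Subgraph, IsSubdivision H A.coe ∧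
      (∀ x y, H.Adj x y → ∀ e ∈ Lo s(x, y), e ∈ A.edgeSet) ∧
      ∀ e ∈ A.edgeSet, ∃ x y, H.Adj x y ∧ e ∈ Hi s(x, y) := by
  have hW' : ∀ x y, H.Adj x y → φ x < φ y → ∃ p : G.Walk (f x) (f y), p.IsPath ∧
      (∀ w ∈ p.support, w ∈ Set.range f → w = f x ∨ w = f y) ∧
      (∀ w ∈ p.support, w ∈ Set.range f ∨ w ∈ D s(x, y)) ∧ (∀ e ∈ Lo s(x, y), e ∈ p.edges) ∧
      ∀ e ∈ p.edges, e ∈ Hi s(x, y) := hW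
  choose W hW using hW'
  have hor : ∀ x y, H.Adj x y → ¬ φ x < φ y → φ y < φ x := fun x y h hn =>
    lt_of_le_of_ne (not_lt.1 hn) fun h' => h.ne (hφ h'.symm)
  let P : ∀ ⦃x y⦄, H.Adj x y → G.Walk (f x) (f y) := fun x y h =>
    if hlt : φ x < φ y then W x y h hlt else (W y x h.symm (hor x y h hlt)).reverse
  have hP : ∀ x y (h : H.Adj x y), (P h).IsPath ∧
      (∀ w ∈ (P h).support, w ∈ Set.range f → w = f x ∨ w = f y) ∧
      (∀ w ∈ (P h).support, w ∈ Set.range f ∨ w ∈ D s(x, y)) ∧ (∀ e ∈ Lo s(x, y), e ∈ (P h).edges) ∧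
      ∀ e ∈ (P h).edges, e ∈ Hi s(x, y) := by
    intro x y h
    by_cases hlt : φ x < φ y
    · simp only [P, dif_pos hlt]
      exact hW x y h hlt
    · simp only [P, dif_neg hlt]
      obtain ⟨h1, h2, h3, h4, h5⟩ := hW y x h.symm (hor x y h hlt)
      rw [Sym2.eq_swap] at h3 h4 h5
      refine ⟨h1.reverse, ?_, ?_, ?_, ?_⟩
      · simpa [or_comm] using h2
      · simpa using h3
      · simpa using h4
      · simpa using h5
  refine ⟨unionOfPaths f P, isSubdivision_unionOfPaths f P hf (fun x y h => (hP x y h).1) ?_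
    (fun x y h => (hP x y h).2.1) ?_, ?_, ?_⟩
  · intro x y h
    by_cases hlt : φ x < φ y
    · have hlt' : ¬ φ y < φ x := by omega
      simp only [P, dif_pos hlt, dif_neg hlt']
    · have hlt' := hor x y h hlt
      simp only [P, dif_neg hlt, dif_pos hlt', Walk.reverse_reverse]
  · intro x y x' y' h h' hne w hw hw'
    rcases (hP x y h).2.2.1 w hw with h1 | h1
    · exact h1
    · exact ((hP x' y' h').2.2.1 w hw').resolve_right (hD _ _ hne w h1)
  · intro x y h e he
    exact (mem_unionOfPaths f P e).2 ⟨x, y, h, (hP x y h).2.2.2.1 e he⟩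
  · intro e he
    obtain ⟨x, y, h, he⟩ := (mem_unionOfPaths f P e).1 he
    exact ⟨x, y, h, (hP x y h).2.2.2.2 e he⟩

lemma exists_injective_extending {α : Type} [Fintype α] {u v : α} (huv : u ≠ v) {T : Finset V}
    (hT : Fintype.card α ≤ T.card) {a b : V} (ha : a ∈ T) (hb : b ∈ T) (hab : a ≠ b) :
    ∃ f : α → V, Function.Injective f ∧ f u = a ∧ f v = b ∧ ∀ x, f x ∈ T := by
  obtain ⟨g⟩ : Nonempty (α ↪ T) := Function.Embedding.nonempty_of_card_le (by simpa using hT)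
  let a' : T := ⟨a, ha⟩
  let b' : T := ⟨b, hb⟩
  let σ := Equiv.swap (g u) a'
  let τ := Equiv.swap (σ (g v)) b'
  refine ⟨fun x => τ (σ (g x)), fun x y h => g.injective (σ.injective (τ.injective
    (Subtype.ext h))), ?_, ?_, fun x => (τ (σ (g x))).2⟩
  · have h1 : σ (g u) = a' := Equiv.swap_apply_left _ _
    have h2 : a' ≠ σ (g v) := fun h => huv (g.injective (σ.injective (h1.trans h)))
    have h3 : a' ≠ b' := fun h => hab (congrArg Subtype.val h)
    simp only [h1, τ, Equiv.swap_apply_of_ne_of_ne h2 h3]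
    rfl
  · simp only [τ, Equiv.swap_apply_left]
    rfl

lemma exists_private_nbrs {α : Type} [Fintype α] {G : SimpleGraph V} {T : Finset V} {f : α → V}
    (hdeg : ∀ x, Fintype.card α + Fintype.card α ^ 2 ≤ (nbr G T (f x)).card) :
    ∃ l : α × α → V, Function.Injective l ∧
      ∀ p, l p ∈ T ∧ G.Adj (f p.1) (l p) ∧ l p ∉ Set.range f := by
  let t : α × α → Finset V := fun p => nbr G T (f p.1) \ Finset.univ.image f
  have ht : ∀ p, Fintype.card α ^ 2 ≤ (t p).card := by
    intro p
    have h1 : _ ≤ (t p).card := Finset.le_card_sdiff (Finset.univ.image f) (nbr G T (f p.1))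
    have h2 : (Finset.univ.image f).card ≤ Fintype.card α := Finset.card_image_le
    have h3 := hdeg p.1
    omega
  obtain ⟨l, hl, hlt⟩ := (Finset.all_card_le_biUnion_card_iff_exists_injective t).1 fun s => by
    rcases s.eq_empty_or_nonempty with rfl | ⟨p, hp⟩
    · simp
    · have h1 : s.card ≤ Fintype.card α ^ 2 := by
        refine (Finset.card_le_univ s).trans ?_
        rw [Fintype.card_prod, pow_two]
      exact (h1.trans (ht p)).trans (Finset.card_le_card (Finset.subset_biUnion_of_mem t hp))
  refine ⟨l, hl, fun p => ?_⟩
  have := hlt p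
  simp only [t, Finset.mem_sdiff, mem_nbr, Finset.mem_image, Finset.mem_univ, true_and] at this
  exact ⟨this.1.1, this.1.2, this.2⟩

/-- A path with both ends in a good set and interior outside it extends to a subdivision. -/
theorem Good.exists_subdivision [Finite V] {α : Type} [Fintype α] {H : SimpleGraph α} {u v : α}
    (huv : H.Adj u v) {G : SimpleGraph V} {T : Finset V} (hT : Good G T (2 * Fintype.card α ^ 2))
    {a b : V} (ha : a ∈ T) (hb : b ∈ T) (hab : a ≠ b) (Q : G.Walk a b) (hQ : Q.IsPath)
    (hQT : ∀ w ∈ Q.support, w ∈ T → w = a ∨ w = b) :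
    ∃ A : G.Subgraph, IsSubdivision H A.coe ∧ (∀ e ∈ Q.edges, e ∈ A.edgeSet) ∧
      ∀ e ∈ A.edgeSet, e ∈ Q.edges ∨ ∀ w ∈ e, w ∈ T := by
  set k := Fintype.card α with hk
  have hk1 : 1 ≤ k := Fintype.card_pos_iff.2 ⟨u⟩
  have hkk : k ≤ k ^ 2 := by nlinarith
  have hTk : ∀ w ∈ T, k + k ^ 2 ≤ (nbr G T w).card := fun w hw => by
    have := hT.deg w hw
    omega
  obtain ⟨f, hf, rfl, rfl, hfT⟩ := exists_injective_extending huv.ne (T := T)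
    (by have := hTk a ha; have h2 := nbr_card_le (G := G) (U := T) (v := a); omega) ha hb hab
  obtain ⟨l, hl, hlp⟩ := exists_private_nbrs (f := f) fun x => hTk _ (hfT x)
  let φ : α → ℕ := fun x => Fintype.equivFin α x
  have hφ : Function.Injective φ := fun x y h => (Fintype.equivFin α).injective (Fin.ext h)
  let X : Finset V := Finset.univ.image f ∪ Finset.univ.image l
  have hXT : X ⊆ T := by
    intro w hw
    simp only [X, Finset.mem_union, Finset.mem_image, Finset.mem_univ, true_and] at hw
    rcases hw with ⟨x, rfl⟩ | ⟨x, rfl⟩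
    exacts [hfT x, (hlp x).1]
  have hXc : X.card ≤ 2 * k ^ 2 := by
    have h1 := Finset.card_union_le (Finset.univ.image f) (Finset.univ.image l)
    have h2 : (Finset.univ.image f).card ≤ Fintype.card α := Finset.card_image_le
    have h3 : (Finset.univ.image l).card ≤ Fintype.card (α × α) := Finset.card_image_le
    rw [Fintype.card_prod, ← pow_two, ← hk] at h3
    change X.card ≤ _ at h1
    omega
  let ι := {p : α × α // H.Adj p.1 p.2 ∧ φ p.1 < φ p.2 ∧ s(p.1, p.2) ≠ s(u, v)}
  obtain ⟨C, hC⟩ := hT.linked (by omega) hXT hXc ι (fun i => l i.1) (fun i => l i.1.swap)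
    (fun i => by simp [X]) (fun i j hij => by
      have h1 : i.1 ≠ j.1 := fun h => hij (Subtype.ext h)
      refine ⟨hl.ne h1, hl.ne fun h => ?_, hl.ne fun h => h1 (Prod.swap_injective h)⟩
      have h2 := i.2.2.1
      have h3 := j.2.2.1
      rw [h] at h2
      simp only [Prod.fst_swap, Prod.snd_swap] at h2
      omega)
  have hCf : ∀ i, ∀ w ∈ C i, w ∉ Set.range f := by
    rintro i w hw ⟨x, rfl⟩
    rcases hC.avoid i _ hw (by simp [X]) with h | h
    · exact (hlp i.1).2.2 ⟨x, h⟩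
    · exact (hlp i.1.swap).2.2 ⟨x, h⟩
  obtain ⟨A, hA, hLo, hHi⟩ := exists_subdivision_of_paths (H := H) (G := G) f hf φ hφ
    (fun e => {w | (e = s(u, v) ∧ w ∉ T) ∨ ∃ i : ι, s(i.1.1, i.1.2) = e ∧ w ∈ C i})
    (by
      rintro e e' hne w (⟨rfl, h1⟩ | ⟨i, rfl, hi⟩) (⟨rfl, h2⟩ | ⟨j, rfl, hj⟩)
      · exact hne rfl
      · exact h1 (hC.sub j hj)
      · exact h2 (hC.sub i hi)
      · by_cases hij : i = j
        · exact hne (hij ▸ rfl)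
        · exact hC.disj i j hij w hi hj)
    (fun e => {e' | e = s(u, v) ∧ e' ∈ Q.edges})
    (fun e => {e' | e' ∈ Q.edges ∨ ∀ w ∈ e', w ∈ T})
    (by
      intro x y hxy hlt
      by_cases he : s(x, y) = s(u, v)
      · have hR : ∀ w ∈ Q.support, w ∈ Set.range f → w = f u ∨ w = f v := by
          rintro _ hw ⟨x, rfl⟩
          exact hQT _ hw (hfT x)
        have hI : ∀ w ∈ Q.support, w ∈ Set.range f ∨
            w ∈ {w | (s(x, y) = s(u, v) ∧ w ∉ T) ∨ ∃ i : ι, s(i.1.1, i.1.2) = s(x, y) ∧ w ∈ C i} := by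
          intro w hw
          by_cases h : w ∈ T
          · rcases hQT w hw h with rfl | rfl
            exacts [Or.inl ⟨u, rfl⟩, Or.inl ⟨v, rfl⟩]
          · exact Or.inr (Or.inl ⟨he, h⟩)
        rcases Sym2.eq_iff.1 he with ⟨rfl, rfl⟩ | ⟨rfl, rfl⟩
        · exact ⟨Q, hQ, hR, hI, fun e h => h.2, fun e h => Or.inl h⟩
        · refine ⟨Q.reverse, hQ.reverse, ?_, ?_, ?_, ?_⟩
          · simpa [or_comm] using hR
          · simpa using hI
          · rintro e ⟨-, h⟩
            simpa using h
          · intro e h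
            exact Or.inl (by simpa using h)
      · let i : ι := ⟨(x, y), hxy, hlt, he⟩
        obtain ⟨_, rfl, p, hp⟩ := hC.conn i _ (hC.left i) _ (hC.right i)
        let q : G.Walk (f x) (f y) :=
          (Walk.cons (hlp (x, y)).2.1 (p.concat (hlp (y, x)).2.1.symm)).bypass
        have hq : ∀ w ∈ q.support, w = f x ∨ w = f y ∨ w ∈ C i := by
          intro w hw
          have := Walk.support_bypass_subset_support _ hw
          simp only [Walk.support_cons, Walk.support_concat, List.mem_cons, List.mem_append,
            List.not_mem_nil, or_false] at this
          rcases this with h | h | h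
          · exact Or.inl h
          · exact Or.inr (Or.inr (by simpa using hp w h))
          · exact Or.inr (Or.inl h)
        refine ⟨q, Walk.bypass_isPath _, ?_, ?_, ?_, ?_⟩
        · intro w hw hwf
          rcases hq w hw with h | h | h
          exacts [Or.inl h, Or.inr h, absurd hwf (hCf i w h)]
        · intro w hw
          rcases hq w hw with rfl | rfl | h
          exacts [Or.inl ⟨x, rfl⟩, Or.inl ⟨y, rfl⟩, Or.inr (Or.inr ⟨i, rfl, h⟩)]
        · rintro e ⟨h, -⟩
          exact absurd h he
        · intro e h
          refine Or.inr fun w hw => ?_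
          rcases hq w (Walk.mem_support_of_mem_edges h hw) with rfl | rfl | h
          exacts [hfT x, hfT y, hC.sub i h])
  refine ⟨A, hA, fun e he => hLo u v huv e ⟨rfl, he⟩, fun e he => ?_⟩
  obtain ⟨x, y, -, h⟩ := hHi e he
  exact h

end EdgeSep

namespace EdgeSep
open Classical

variable {V : Type}

/-- Each `e ∈ E` is separated from every other `e'` by a member of `F`. -/
def Cover (E : Set (Sym2 V)) (F : Finset (Set (Sym2 V))) : Prop :=
  ∀ e ∈ E, ∀ e', e' ≠ e → ∃ A ∈ F, e ∈ A ∧ e' ∉ A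

lemma Cover.union {E E' : Set (Sym2 V)} {F F' : Finset (Set (Sym2 V))} (h : Cover E F)
    (h' : Cover E' F') : Cover (E ∪ E') (F ∪ F') := by
  rintro e (he | he) e' hne
  · obtain ⟨A, hA, h⟩ := h e he e' hne
    exact ⟨A, Finset.mem_union_left _ hA, h⟩
  · obtain ⟨A, hA, h⟩ := h' e he e' hne
    exact ⟨A, Finset.mem_union_right _ hA, h⟩

lemma Cover.mono {E E' : Set (Sym2 V)} {F : Finset (Set (Sym2 V))} (h : Cover E F)
    (h' : ∀ e ∈ E', e ∈ E) : Cover E' F := fun e he => h e (h' e he)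

lemma cover_singles (E : Finset (Sym2 V)) : Cover (E : Set (Sym2 V)) (E.image fun e => {e}) :=
  fun e he _ hne => ⟨{e}, Finset.mem_image.2 ⟨e, he, rfl⟩, rfl, hne⟩

/-- The edges of `G[U]`. -/
def edg (G : SimpleGraph V) (U : Finset V) : Set (Sym2 V) := {e | e ∈ G.edgeSet ∧ ∀ v ∈ e, v ∈ U}

lemma mk_mem_edg {G : SimpleGraph V} {U : Finset V} {a b : V} :
    s(a, b) ∈ edg G U ↔ G.Adj a b ∧ a ∈ U ∧ b ∈ U := by
  simp [edg]

lemma edg_mono {G : SimpleGraph V} {U U' : Finset V} (h : U ⊆ U') : edg G U ⊆ edg G U' :=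
  fun _ he => ⟨he.1, fun v hv => h (he.2 v hv)⟩

/-- The edge set of a path with at least one edge inside `U`. -/
def IsPathSet (G : SimpleGraph V) (U : Finset V) (A : Set (Sym2 V)) : Prop :=
  ∃ a b, ∃ p : G.Walk a b, a ≠ b ∧ p.IsPath ∧ (∀ v ∈ p.support, v ∈ U) ∧ A = {e | e ∈ p.edges}

lemma IsPathSet.mono {G : SimpleGraph V} {U U' : Finset V} {A : Set (Sym2 V)}
    (h : IsPathSet G U A) (hU : U ⊆ U') : IsPathSet G U' A := by
  obtain ⟨a, b, p, h1, h2, h3, h4⟩ := h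
  exact ⟨a, b, p, h1, h2, fun v hv => hU (h3 v hv), h4⟩

/-- `f` enumerates a path with `n` vertices. -/
structure PathFun (G : SimpleGraph V) (f : ℕ → V) (n : ℕ) : Prop where
  inj : ∀ i < n, ∀ j < n, f i = f j → i = j
  adj : ∀ i, i + 1 < n → G.Adj (f i) (f (i + 1))

lemma PathFun.edge_inj {G : SimpleGraph V} {f : ℕ → V} {n : ℕ} (h : PathFun G f n) {s t : ℕ}
    (hs : s + 1 < n) (ht : t + 1 < n) (he : s(f s, f (s + 1)) = s(f t, f (t + 1))) : s = t := by
  rcases Sym2.eq_iff.1 he with ⟨h1, -⟩ | ⟨h1, h2⟩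
  · exact h.inj s (by omega) t (by omega) h1
  · have := h.inj s (by omega) (t + 1) ht h1
    have := h.inj (s + 1) hs t (by omega) h2
    omega

/-- Prepending a descending segment. -/
lemma PathFun.down {G : SimpleGraph V} {f : ℕ → V} {n : ℕ} (h : PathFun G f n) {p q : ℕ}
    (hpq : p ≤ q) {b : V} (W : G.Walk (f q) b) (hW : W.IsPath)
    (hs : ∀ v ∈ W.support, ∃ i, p ≤ i ∧ i ≤ q ∧ v = f i) {q' : ℕ} (hq : q ≤ q') (hn : q' < n) :
    ∃ W' : G.Walk (f q') b, W'.IsPath ∧ (∀ v ∈ W'.support, ∃ i, p ≤ i ∧ i ≤ q' ∧ v = f i) ∧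
      ∀ e, e ∈ W'.edges ↔ e ∈ W.edges ∨ ∃ t, q ≤ t ∧ t < q' ∧ e = s(f t, f (t + 1)) := by
  induction q', hq using Nat.le_induction with
  | base => exact ⟨W, hW, hs, fun e => ⟨Or.inl, fun h => h.elim id (by rintro ⟨t, h1, h2, -⟩; omega)⟩⟩
  | succ m hm ih =>
    obtain ⟨W', h1, h2, h3⟩ := ih (by omega)
    refine ⟨Walk.cons (h.adj m hn).symm W', ?_, ?_, ?_⟩
    · rw [Walk.cons_isPath_iff]
      refine ⟨h1, fun hv => ?_⟩
      obtain ⟨i, hi, hi', he⟩ := h2 _ hv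
      have := h.inj (m + 1) hn i (by omega) he
      omega
    · intro v hv
      rw [Walk.support_cons, List.mem_cons] at hv
      rcases hv with rfl | hv
      · exact ⟨m + 1, by omega, le_rfl, rfl⟩
      · obtain ⟨i, hi, hi', he⟩ := h2 _ hv
        exact ⟨i, hi, by omega, he⟩
    · intro e
      rw [Walk.edges_cons, List.mem_cons, h3]
      constructor
      · rintro (rfl | h | ⟨t, ht, ht', rfl⟩)
        · exact Or.inr ⟨m, hm, by omega, Sym2.eq_swap⟩
        · exact Or.inl h
        · exact Or.inr ⟨t, ht, by omega, rfl⟩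
      · rintro (h | ⟨t, ht, ht', rfl⟩)
        · exact Or.inr (Or.inl h)
        · by_cases htm : t = m
          · subst htm
            exact Or.inl Sym2.eq_swap
          · exact Or.inr (Or.inr ⟨t, ht, by omega, rfl⟩)

/-- Prepending an ascending segment. -/
lemma PathFun.up {G : SimpleGraph V} {f : ℕ → V} {n : ℕ} (h : PathFun G f n) {p q : ℕ}
    (hpq : p ≤ q) (hn : q < n) {b : V} (W : G.Walk (f p) b) (hW : W.IsPath)
    (hs : ∀ v ∈ W.support, ∃ i, p ≤ i ∧ i ≤ q ∧ v = f i) (d : ℕ) : ∀ p', p' + d = p →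
    ∃ W' : G.Walk (f p') b, W'.IsPath ∧ (∀ v ∈ W'.support, ∃ i, p' ≤ i ∧ i ≤ q ∧ v = f i) ∧
      ∀ e, e ∈ W'.edges ↔ e ∈ W.edges ∨ ∃ t, p' ≤ t ∧ t < p ∧ e = s(f t, f (t + 1)) := by
  induction d with
  | zero =>
    rintro p' rfl
    exact ⟨W, hW, hs, fun e => ⟨Or.inl, fun h => h.elim id (by rintro ⟨t, h1, h2, -⟩; omega)⟩⟩
  | succ d ih =>
    intro p' hp'
    obtain ⟨W', h1, h2, h3⟩ := ih (p' + 1) (by omega)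
    refine ⟨Walk.cons (h.adj p' (by omega)) W', ?_, ?_, ?_⟩
    · rw [Walk.cons_isPath_iff]
      refine ⟨h1, fun hv => ?_⟩
      obtain ⟨i, hi, hi', he⟩ := h2 _ hv
      have := h.inj p' (by omega) i (by omega) he
      omega
    · intro v hv
      rw [Walk.support_cons, List.mem_cons] at hv
      rcases hv with rfl | hv
      · exact ⟨p', le_rfl, by omega, rfl⟩
      · obtain ⟨i, hi, hi', he⟩ := h2 _ hv
        exact ⟨i, by omega, hi', he⟩
    · intro e
      rw [Walk.edges_cons, List.mem_cons, h3]
      constructor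
      · rintro (rfl | h | ⟨t, ht, ht', rfl⟩)
        · exact Or.inr ⟨p', le_rfl, by omega, rfl⟩
        · exact Or.inl h
        · exact Or.inr ⟨t, by omega, by omega, rfl⟩
      · rintro (h | ⟨t, ht, ht', rfl⟩)
        · exact Or.inr (Or.inl h)
        · by_cases htm : t = p'
          · subst htm
            exact Or.inl rfl
          · exact Or.inr (Or.inr ⟨t, by omega, by omega, rfl⟩)

/-- A nested set of chords of a path. -/
structure Nested (G : SimpleGraph V) (f : ℕ → V) (n : ℕ) (R : Finset (ℕ × ℕ)) : Prop where
  lt : ∀ x ∈ R, x.1 < x.2 ∧ x.2 < n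
  adj : ∀ x ∈ R, G.Adj (f x.1) (f x.2)
  nest : ∀ x ∈ R, ∀ y ∈ R, x ≠ y → (x.1 < y.1 ∧ y.2 < x.2) ∨ (y.1 < x.1 ∧ x.2 < y.2)

def rungs (f : ℕ → V) (R : Finset (ℕ × ℕ)) : Set (Sym2 V) := {e | ∃ x ∈ R, e = s(f x.1, f x.2)}

/-- Two zigzag paths through all chords of a nested set, sharing no other edges. -/
lemma Nested.snake {G : SimpleGraph V} {f : ℕ → V} {n : ℕ} (h : PathFun G f n) :
    ∀ (m : ℕ) (R : Finset (ℕ × ℕ)), R.card = m + 1 → Nested G f n R →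
    ∃ x ∈ R, ∃ a b, ∃ A : G.Walk (f x.1) a, ∃ B : G.Walk (f x.2) b, A.IsPath ∧ B.IsPath ∧
      (∀ y ∈ R, x.1 ≤ y.1 ∧ y.2 ≤ x.2) ∧
      (∀ v ∈ A.support, ∃ i, x.1 ≤ i ∧ i ≤ x.2 ∧ v = f i) ∧
      (∀ v ∈ B.support, ∃ i, x.1 ≤ i ∧ i ≤ x.2 ∧ v = f i) ∧
      (∀ e ∈ rungs f R, e ∈ A.edges ∧ e ∈ B.edges) ∧
      (∀ e ∈ A.edges, e ∉ rungs f R → ∃ t, x.1 ≤ t ∧ t < x.2 ∧ e = s(f t, f (t + 1))) ∧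
      (∀ e ∈ B.edges, e ∉ rungs f R → ∃ t, x.1 ≤ t ∧ t < x.2 ∧ e = s(f t, f (t + 1))) ∧
      ∀ e ∈ A.edges, e ∈ B.edges → e ∈ rungs f R := by
  intro m
  induction m with
  | zero =>
    intro R hR hN
    obtain ⟨x, rfl⟩ := Finset.card_eq_one.1 hR
    have hx := hN.adj x (by simp)
    have hlt := hN.lt x (by simp)
    refine ⟨x, by simp, _, _, Walk.cons hx .nil, Walk.cons hx.symm .nil, ?_, ?_, ?_, ?_, ?_, ?_, ?_,
      ?_, ?_⟩
    · simp [hx.ne]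
    · simp [hx.ne']
    · simp
    · intro v hv
      simp only [Walk.support_cons, Walk.support_nil, List.mem_cons, List.not_mem_nil, or_false] at hv
      rcases hv with rfl | rfl
      exacts [⟨x.1, le_rfl, hlt.1.le, rfl⟩, ⟨x.2, hlt.1.le, le_rfl, rfl⟩]
    · intro v hv
      simp only [Walk.support_cons, Walk.support_nil, List.mem_cons, List.not_mem_nil, or_false] at hv
      rcases hv with rfl | rfl
      exacts [⟨x.2, hlt.1.le, le_rfl, rfl⟩, ⟨x.1, le_rfl, hlt.1.le, rfl⟩]
    · rintro e ⟨y, hy, rfl⟩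
      rw [Finset.mem_singleton.1 hy]
      simp [Sym2.eq_swap]
    · intro e he hn
      simp only [Walk.edges_cons, Walk.edges_nil, List.mem_singleton] at he
      exact absurd ⟨x, by simp, he⟩ hn
    · intro e he hn
      simp only [Walk.edges_cons, Walk.edges_nil, List.mem_singleton] at he
      exact absurd ⟨x, by simp, he.trans Sym2.eq_swap⟩ hn
    · intro e he _
      simp only [Walk.edges_cons, Walk.edges_nil, List.mem_singleton] at he
      exact ⟨x, by simp, he⟩
  | succ m ih =>
    intro R hR hN
    obtain ⟨x, hx, hmin⟩ := R.exists_min_image (fun y => y.1) (Finset.card_pos.1 (by omega))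
    have hxy : ∀ y ∈ R, y ≠ x → x.1 < y.1 ∧ y.2 < x.2 := fun y hy hne => by
      have := hmin y hy
      rcases hN.nest y hy x hx hne with h | h
      · omega
      · exact h
    have hN' : Nested G f n (R.erase x) :=
      ⟨fun y hy => hN.lt y (Finset.mem_of_mem_erase hy), fun y hy => hN.adj y (Finset.mem_of_mem_erase hy),
        fun y hy z hz => hN.nest y (Finset.mem_of_mem_erase hy) z (Finset.mem_of_mem_erase hz)⟩
    obtain ⟨y, hy, a, b, A, B, hA, hB, hall, hAs, hBs, hru, hAe, hBe, hAB⟩ :=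
      ih (R.erase x) (by rw [Finset.card_erase_of_mem hx]; omega) hN'
    have hyR := Finset.mem_of_mem_erase hy
    obtain ⟨hy1, hy2⟩ := hxy y hyR (Finset.ne_of_mem_erase hy)
    have hylt := hN.lt y hyR
    have hxlt := hN.lt x hx
    have hxa := hN.adj x hx
    obtain ⟨B', hB', hBs', hBe'⟩ := h.down hylt.1.le B hB hBs hy2.le hxlt.2
    obtain ⟨A', hA', hAs', hAe'⟩ := h.up hylt.1.le hylt.2 A hA hAs (y.1 - x.1) x.1 (by omega)
    have hrung : ∀ e, e ∈ rungs f R ↔ e = s(f x.1, f x.2) ∨ e ∈ rungs f (R.erase x) := by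
      intro e
      constructor
      · rintro ⟨z, hz, rfl⟩
        by_cases hzx : z = x
        · exact Or.inl (hzx ▸ rfl)
        · exact Or.inr ⟨z, Finset.mem_erase.2 ⟨hzx, hz⟩, rfl⟩
      · rintro (rfl | ⟨z, hz, rfl⟩)
        exacts [⟨x, hx, rfl⟩, ⟨z, Finset.mem_of_mem_erase hz, rfl⟩]
    refine ⟨x, hx, _, _, Walk.cons hxa B', Walk.cons hxa.symm A', ?_, ?_, ?_, ?_, ?_, ?_, ?_, ?_, ?_⟩
    · rw [Walk.cons_isPath_iff]
      refine ⟨hB', fun hv => ?_⟩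
      obtain ⟨i, h1, h2, h3⟩ := hBs' _ hv
      have := h.inj x.1 (by omega) i (by omega) h3
      omega
    · rw [Walk.cons_isPath_iff]
      refine ⟨hA', fun hv => ?_⟩
      obtain ⟨i, h1, h2, h3⟩ := hAs' _ hv
      have := h.inj x.2 (by omega) i (by omega) h3
      omega
    · intro z hz
      by_cases hzx : z = x
      · subst hzx; simp
      · have := hxy z hz hzx
        omega
    · intro v hv
      rw [Walk.support_cons, List.mem_cons] at hv
      rcases hv with rfl | hv
      · exact ⟨x.1, le_rfl, hxlt.1.le, rfl⟩
      · obtain ⟨i, h1, h2, h3⟩ := hBs' _ hv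
        exact ⟨i, by omega, h2, h3⟩
    · intro v hv
      rw [Walk.support_cons, List.mem_cons] at hv
      rcases hv with rfl | hv
      · exact ⟨x.2, hxlt.1.le, le_rfl, rfl⟩
      · obtain ⟨i, h1, h2, h3⟩ := hAs' _ hv
        exact ⟨i, by omega, by omega, h3⟩
    · intro e he
      rw [Walk.edges_cons, Walk.edges_cons, List.mem_cons, List.mem_cons, hBe', hAe']
      rcases (hrung e).1 he with rfl | h
      · exact ⟨Or.inl rfl, Or.inl Sym2.eq_swap⟩
      · exact ⟨Or.inr (Or.inl (hru e h).2), Or.inr (Or.inl (hru e h).1)⟩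
    · intro e he hn
      rw [hrung, not_or] at hn
      rw [Walk.edges_cons, List.mem_cons, hBe'] at he
      rcases he with he | he | ⟨t, h1, h2, h3⟩
      · exact absurd he hn.1
      · obtain ⟨t, h1, h2, h3⟩ := hBe e he hn.2
        exact ⟨t, by omega, by omega, h3⟩
      · exact ⟨t, by omega, by omega, h3⟩
    · intro e he hn
      rw [hrung, not_or] at hn
      rw [Walk.edges_cons, List.mem_cons, hAe'] at he
      rcases he with he | he | ⟨t, h1, h2, h3⟩
      · exact absurd (he.trans Sym2.eq_swap) hn.1
      · obtain ⟨t, h1, h2, h3⟩ := hAe e he hn.2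
        exact ⟨t, by omega, by omega, h3⟩
      · exact ⟨t, by omega, by omega, h3⟩
    · intro e he he'
      by_contra hn
      rw [hrung, not_or] at hn
      rw [Walk.edges_cons, List.mem_cons, hBe'] at he
      rw [Walk.edges_cons, List.mem_cons, hAe'] at he'
      have he := he.resolve_left hn.1
      have he' := he'.resolve_left fun h => hn.1 (h.trans Sym2.eq_swap)
      rcases he with he | ⟨t, h1, h2, rfl⟩ <;> rcases he' with he' | ⟨t', h1', h2', h3'⟩
      · exact hn.2 (hAB e he' he)
      · obtain ⟨t, h1, h2, rfl⟩ := hBe e he hn.2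
        have := h.edge_inj (by omega) (by omega) h3'
        omega
      · obtain ⟨t', h1', h2', h3'⟩ := hAe _ he' hn.2
        have := h.edge_inj (by omega) (by omega) h3'
        omega
      · have := h.edge_inj (by omega) (by omega) h3'
        omega

end EdgeSep

namespace EdgeSep
open Classical

variable {V : Type}

lemma Nested.family {G : SimpleGraph V} {f : ℕ → V} {n : ℕ} (h : PathFun G f n) {U : Finset V}
    (hU : ∀ i < n, f i ∈ U) {R : Finset (ℕ × ℕ)} (hN : Nested G f n R) :
    ∃ F : Finset (Set (Sym2 V)), F.card ≤ 2 ∧ (∀ A ∈ F, IsPathSet G U A) ∧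
      ∀ e ∈ rungs f R, ∀ e' ∉ rungs f R, ∃ A ∈ F, e ∈ A ∧ e' ∉ A := by
  rcases R.eq_empty_or_nonempty with rfl | hne
  · exact ⟨∅, by simp, by simp, by rintro e ⟨x, hx, -⟩; simp at hx⟩
  obtain ⟨x, hx, a, b, A, B, hA, hB, -, hAs, hBs, hru, -, -, hAB⟩ := Nested.snake h (R.card - 1) R
    (by have := hne.card_pos; omega) hN
  have hxlt := hN.lt x hx
  have hxr : s(f x.1, f x.2) ∈ rungs f R := ⟨x, hx, rfl⟩
  have hmem : ∀ {v : V}, (∃ i, x.1 ≤ i ∧ i ≤ x.2 ∧ v = f i) → v ∈ U := by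
    rintro v ⟨i, -, hi, rfl⟩
    exact hU i (by omega)
  have hend : ∀ {a b : V} (W : G.Walk a b), W.IsPath → s(f x.1, f x.2) ∈ W.edges → a ≠ b := by
    rintro a b W hW he rfl
    rw [(Walk.isPath_iff_nil.1 hW).eq_nil] at he
    simp at he
  refine ⟨{{e | e ∈ A.edges}, {e | e ∈ B.edges}}, Finset.card_le_two, ?_, ?_⟩
  · intro C hC
    rw [Finset.mem_insert, Finset.mem_singleton] at hC
    rcases hC with rfl | rfl
    · exact ⟨_, _, A, hend A hA (hru _ hxr).1, hA, fun v hv => hmem (hAs v hv), rfl⟩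
    · exact ⟨_, _, B, hend B hB (hru _ hxr).2, hB, fun v hv => hmem (hBs v hv), rfl⟩
  · intro e he e' he'
    by_cases hA' : e' ∈ A.edges
    · exact ⟨_, Finset.mem_insert_of_mem (Finset.mem_singleton_self _), (hru e he).2,
        fun hB' => he' (hAB e' hA' hB')⟩
    · exact ⟨_, Finset.mem_insert_self _ _, (hru e he).1, hA'⟩

/-- The chords of a path with both ends in a set of `m` vertices are separated by `O(m)` paths. -/
lemma PathFun.cover_chords {G : SimpleGraph V} {f : ℕ → V} {n : ℕ} (h : PathFun G f n)
    {U : Finset V} (hU : ∀ i < n, f i ∈ U) {X : Finset ℕ} (hX : ∀ i ∈ X, i < n) :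
    ∃ F : Finset (Set (Sym2 V)), F.card ≤ 12 * X.card ∧ (∀ A ∈ F, IsPathSet G U A) ∧
      Cover (edg G (X.image f)) F := by
  let r : ℕ → ℕ := fun i => (X.filter (· < i)).card
  have hr : ∀ i ∈ X, ∀ j, i < j → r i < r j := by
    intro i hi j hij
    refine Finset.card_lt_card (Finset.ssubset_iff_of_subset ?_ |>.2 ⟨i, ?_, ?_⟩)
    · intro k hk
      rw [Finset.mem_filter] at hk ⊢
      exact ⟨hk.1, hk.2.trans hij⟩
    · simp [hi, hij]
    · simp
  have hrX : ∀ i ∈ X, r i < X.card := by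
    intro i hi
    refine Finset.card_lt_card (Finset.ssubset_iff_of_subset (Finset.filter_subset _ _) |>.2
      ⟨i, hi, ?_⟩)
    simp
  let R : ℕ → ℕ → Finset (ℕ × ℕ) := fun w c =>
    (X ×ˢ X).filter fun x => x.1 < x.2 ∧ G.Adj (f x.1) (f x.2) ∧ r x.1 + (w + 1) * r x.2 = c
  have hR : ∀ w c x, x ∈ R w c ↔ (x.1 ∈ X ∧ x.2 ∈ X) ∧ x.1 < x.2 ∧ G.Adj (f x.1) (f x.2) ∧
      r x.1 + (w + 1) * r x.2 = c := fun w c x => by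
    simp only [R, Finset.mem_filter, Finset.mem_product]
  have hN : ∀ w c, Nested G f n (R w c) := by
    intro w c
    refine ⟨fun x hx => ?_, fun x hx => ?_, fun x hx y hy hne => ?_⟩
    · rw [hR] at hx
      exact ⟨hx.2.1, hX _ hx.1.2⟩
    · rw [hR] at hx
      exact hx.2.2.1
    · rw [hR] at hx hy
      have key : ∀ x y : ℕ × ℕ, x.2 ∈ X → x.1 ∈ X → r x.1 + (w + 1) * r x.2 = c →
          r y.1 + (w + 1) * r y.2 = c → x.1 < y.1 → y.2 < x.2 := by
        intro x y hx hx1 h1 h2 hlt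
        have h3 := hr x.1 hx1 y.1 hlt
        by_contra! hcon
        have h4 : r x.2 ≤ r y.2 := by
          rcases hcon.eq_or_lt with h5 | h5
          · rw [h5]
          · exact (hr x.2 hx y.2 h5).le
        have h6 := Nat.mul_le_mul_left (w + 1) h4
        omega
      rcases lt_trichotomy x.1 y.1 with hlt | heq | hlt
      · exact Or.inl ⟨hlt, key x y hx.1.2 hx.1.1 hx.2.2.2 hy.2.2.2 hlt⟩
      · exfalso
        have h1 : r x.2 = r y.2 := by
          have h2 := hx.2.2.2.trans hy.2.2.2.symm
          rw [heq] at h2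
          exact Nat.eq_of_mul_eq_mul_left (Nat.succ_pos w) (Nat.add_left_cancel h2)
        apply hne
        refine Prod.ext heq ?_
        rcases lt_trichotomy x.2 y.2 with h2 | h2 | h2
        · have := hr x.2 hx.1.2 y.2 h2
          omega
        · exact h2
        · have := hr y.2 hy.1.2 x.2 h2
          omega
      · exact Or.inr ⟨hlt, key y x hy.1.2 hy.1.1 hy.2.2.2 hx.2.2.2 hlt⟩
  choose F hF1 hF2 hF3 using fun w c => Nested.family h hU (hN w c)
  refine ⟨(Finset.range (3 * X.card)).biUnion (F 0) ∪ (Finset.range (3 * X.card)).biUnion (F 1),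
    ?_, ?_, ?_⟩
  · have h1 := Finset.card_union_le ((Finset.range (3 * X.card)).biUnion (F 0))
      ((Finset.range (3 * X.card)).biUnion (F 1))
    have h2 := Finset.card_biUnion_le_card_mul (Finset.range (3 * X.card)) (F 0) 2 fun c _ => hF1 0 c
    have h3 := Finset.card_biUnion_le_card_mul (Finset.range (3 * X.card)) (F 1) 2 fun c _ => hF1 1 c
    rw [Finset.card_range] at h2 h3
    omega
  · intro A hA
    simp only [Finset.mem_union, Finset.mem_biUnion] at hA
    rcases hA with ⟨c, -, hA⟩ | ⟨c, -, hA⟩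
    exacts [hF2 _ _ A hA, hF2 _ _ A hA]
  · intro e he e' hne
    obtain ⟨p, q, hp, hq, hlt, hadj, rfl⟩ : ∃ p q, p ∈ X ∧ q ∈ X ∧ p < q ∧ G.Adj (f p) (f q) ∧
        e = s(f p, f q) := by
      induction e with
      | _ a b =>
      rw [mk_mem_edg, Finset.mem_image, Finset.mem_image] at he
      obtain ⟨hadj, ⟨p, hp, rfl⟩, q, hq, rfl⟩ := he
      rcases lt_trichotomy p q with h1 | rfl | h1
      · exact ⟨p, q, hp, hq, h1, hadj, rfl⟩
      · exact absurd rfl hadj.ne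
      · exact ⟨q, p, hq, hp, h1, hadj.symm, Sym2.eq_swap⟩
    have hpr := hrX p hp
    have hqr := hrX q hq
    have hm : ∀ w, s(f p, f q) ∈ rungs f (R w (r p + (w + 1) * r q)) := fun w =>
      ⟨(p, q), (hR _ _ _).2 ⟨⟨hp, hq⟩, hlt, hadj, rfl⟩, rfl⟩
    by_cases h0 : e' ∈ rungs f (R 0 (r p + (0 + 1) * r q))
    · by_cases h1 : e' ∈ rungs f (R 1 (r p + (1 + 1) * r q))
      · exfalso
        obtain ⟨x, hx, rfl⟩ := h0
        obtain ⟨y, hy, hxy⟩ := h1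
        rw [hR] at hx hy
        have hx1 := hX _ hx.1.1
        have hx2 := hX _ hx.1.2
        have hy1 := hX _ hy.1.1
        have hy2 := hX _ hy.1.2
        obtain rfl : x = y := by
          rcases Sym2.eq_iff.1 hxy with ⟨h1, h2⟩ | ⟨h1, h2⟩
          · exact Prod.ext (h.inj _ hx1 _ hy1 h1) (h.inj _ hx2 _ hy2 h2)
          · have e1 := h.inj _ hx1 _ hy2 h1
            have e2 := h.inj _ hx2 _ hy1 h2
            omega
        have e1 : r x.1 = r p := by omega
        have e2 : r x.2 = r q := by omega
        have inj : ∀ i ∈ X, ∀ j ∈ X, r i = r j → i = j := by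
          intro i hi j hj hij
          rcases lt_trichotomy i j with h2 | h2 | h2
          · have := hr i hi j h2
            omega
          · exact h2
          · have := hr j hj i h2
            omega
        rw [inj _ hx.1.1 _ hp e1, inj _ hx.1.2 _ hq e2] at hne
        exact hne rfl
      · obtain ⟨A, hA, h2⟩ := hF3 1 _ _ (hm 1) e' h1
        exact ⟨A, Finset.mem_union_right _ (Finset.mem_biUnion.2 ⟨_, by
          rw [Finset.mem_range]; omega, hA⟩), h2⟩
    · obtain ⟨A, hA, h2⟩ := hF3 0 _ _ (hm 0) e' h0
      exact ⟨A, Finset.mem_union_left _ (Finset.mem_biUnion.2 ⟨_, by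
        rw [Finset.mem_range]; omega, hA⟩), h2⟩

end EdgeSep

namespace EdgeSep
open Classical

variable {V : Type}

/-- `g'` arises from the path `g` by a rotation with fixed start. -/
def Rot (G : SimpleGraph V) (n : ℕ) (g g' : ℕ → V) : Prop :=
  ∃ i, i + 1 < n ∧ G.Adj (g (n - 1)) (g i) ∧ g' = fun j => if j ≤ i then g j else g (n + i - j)

lemma PathFun.rot {G : SimpleGraph V} {n : ℕ} {g g' : ℕ → V} (h : PathFun G g n)
    (hr : Rot G n g g') : PathFun G g' n ∧ (∀ i < n, ∃ j < n, g i = g' j) := by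
  obtain ⟨i, hi, hadj, rfl⟩ := hr
  refine ⟨⟨fun a ha b hb hab => ?_, fun a ha => ?_⟩, fun a ha => ?_⟩
  · by_cases h1 : a ≤ i <;> by_cases h2 : b ≤ i <;> simp only [h1, h2, if_true, if_false] at hab <;>
      have := h.inj _ (by omega) _ (by omega) hab <;> omega
  · rcases lt_trichotomy a i with h1 | rfl | h1
    · simp only [if_pos h1.le, if_pos (Nat.succ_le_of_lt h1)]
      exact h.adj a ha
    · simp only [le_refl, if_true, if_neg (Nat.not_succ_le_self a)]
      rw [show n + a - (a + 1) = n - 1 by omega]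
      exact hadj.symm
    · simp only [if_neg (not_le.2 h1), if_neg (show ¬ a + 1 ≤ i by omega)]
      have := h.adj (n + i - (a + 1)) (by omega)
      rw [show n + i - (a + 1) + 1 = n + i - a by omega] at this
      exact this.symm
  · by_cases h1 : a ≤ i
    · exact ⟨a, ha, by simp [h1]⟩
    · refine ⟨n + i - a, by omega, ?_⟩
      simp only [if_neg (show ¬ n + i - a ≤ i by omega)]
      congr 1
      omega

/-- For a longest path, the ends of its rotations together with their neighbours lie on few
vertices of the path. -/
lemma exists_posa (G : SimpleGraph V) {U : Finset V} (hU : U.Nonempty) :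
    ∃ (f : ℕ → V) (n : ℕ) (S : Finset V) (X : Finset ℕ), PathFun G f n ∧ (∀ i < n, f i ∈ U) ∧
      S.Nonempty ∧ S ⊆ U ∧ (∀ i ∈ X, i < n) ∧ X.card ≤ 4 * S.card ∧
      edg G U ⊆ edg G (U \ S) ∪ edg G (X.image f) := by
  let P : ℕ → Prop := fun n => ∃ f : ℕ → V, PathFun G f n ∧ ∀ i < n, f i ∈ U
  have hP : ∀ n, P n → n ≤ U.card := by
    rintro n ⟨f, hf, hfU⟩
    have := Finset.card_le_card_of_injOn (s := Finset.range n) (t := U) f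
      (fun i hi => hfU i (by simpa using hi))
      (fun i hi j hj => hf.inj i (by simpa using hi) j (by simpa using hj))
    simpa using this
  have hP1 : P 1 := by
    obtain ⟨v, hv⟩ := hU
    exact ⟨fun _ => v, ⟨fun i hi j hj _ => by omega, fun i hi => by omega⟩, fun _ _ => hv⟩
  set n := Nat.findGreatest P U.card with hn
  have hn1 : 1 ≤ n := Nat.le_findGreatest (hP 1 hP1) hP1
  obtain ⟨f, hf, hfU⟩ : P n := Nat.findGreatest_spec (hP 1 hP1) hP1
  have hmax : ¬ P (n + 1) := fun h =>
    absurd (Nat.le_findGreatest (hP _ h) h) (by rw [← hn]; omega)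
  let S : Finset V := U.filter fun x => ∃ g, Relation.ReflTransGen (Rot G n) f g ∧ g (n - 1) = x
  have hinv : ∀ g, Relation.ReflTransGen (Rot G n) f g → PathFun G g n ∧ (∀ i < n, g i ∈ U) ∧
      (∀ i < n, ∃ j < n, f i = g j) := by
    intro g hg
    induction hg with
    | refl => exact ⟨hf, hfU, fun i hi => ⟨i, hi, rfl⟩⟩
    | tail _ hr ih =>
      obtain ⟨h1, h2, h3⟩ := ih
      obtain ⟨h4, h5⟩ := h1.rot hr
      refine ⟨h4, fun i hi => ?_, fun i hi => ?_⟩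
      · obtain ⟨a, ha, -, rfl⟩ := hr
        dsimp only
        split_ifs
        exacts [h2 _ hi, h2 _ (by omega)]
      · obtain ⟨j, hj, e⟩ := h3 i hi
        obtain ⟨k, hk, e'⟩ := h5 j hj
        exact ⟨k, hk, e.trans e'⟩
  have hS : ∀ g, Relation.ReflTransGen (Rot G n) f g → g (n - 1) ∈ S := fun g hg =>
    Finset.mem_filter.2 ⟨(hinv g hg).2.1 _ (by omega), g, hg, rfl⟩
  have hcons : ∀ g, Relation.ReflTransGen (Rot G n) f g → ∀ x y, x ∉ S → y ∉ S →
      (∃ j, j + 1 < n ∧ s(f j, f (j + 1)) = s(x, y)) →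
      ∃ j, j + 1 < n ∧ s(g j, g (j + 1)) = s(x, y) := by
    intro g hg x y hx hy hex
    induction hg with
    | refl => exact hex
    | tail hg hr ih =>
      obtain ⟨j, hj, e⟩ := ih
      have hS' := hS _ (hg.tail hr)
      obtain ⟨i, hi, hadj, rfl⟩ := hr
      rcases lt_trichotomy j i with h1 | rfl | h1
      · refine ⟨j, hj, ?_⟩
        simp only [if_pos h1.le, if_pos (Nat.succ_le_of_lt h1)]
        exact e
      · exfalso
        simp only [if_neg (show ¬ n - 1 ≤ j by omega), show n + j - (n - 1) = j + 1 by omega] at hS'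
        rcases Sym2.eq_iff.1 e with ⟨-, e⟩ | ⟨-, e⟩
        exacts [hy (e ▸ hS'), hx (e ▸ hS')]
      · refine ⟨n + i - (j + 1), by omega, ?_⟩
        simp only [if_neg (show ¬ n + i - (j + 1) ≤ i by omega),
          if_neg (show ¬ n + i - (j + 1) + 1 ≤ i by omega)]
        rw [show n + i - (n + i - (j + 1)) = j + 1 by omega,
          show n + i - (n + i - (j + 1) + 1) = j by omega, Sym2.eq_swap]
        exact e
  let P0 : Finset ℕ := (Finset.range n).filter fun j => f j ∈ S
  let X : Finset ℕ := (Finset.range n).filter fun j => j ∈ P0 ∨ j = 0 ∨ j + 1 ∈ P0 ∨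
    (1 ≤ j ∧ j - 1 ∈ P0)
  have hP0 : ∀ j, j ∈ P0 ↔ j < n ∧ f j ∈ S := fun j => by simp [P0]
  have hSpos : ∀ x ∈ S, ∃ j ∈ P0, f j = x := by
    intro x hx
    obtain ⟨-, g, hg, rfl⟩ := Finset.mem_filter.1 (id hx)
    obtain ⟨h1, h2, h3⟩ := hinv g hg
    have hsurj := Finset.surj_on_of_inj_on_of_card_le (s := Finset.range n) (t := (Finset.range n).image g)
      (fun i _ => f i) (fun i hi => by
        obtain ⟨j, hj, e⟩ := h3 i (by simpa using hi)
        exact Finset.mem_image.2 ⟨j, by simpa using hj, e.symm⟩)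
      (fun i j hi hj e => hf.inj i (by simpa using hi) j (by simpa using hj) e)
      (Finset.card_image_le) (g (n - 1)) (Finset.mem_image.2 ⟨n - 1, by simp; omega, rfl⟩)
    obtain ⟨i, hi, e⟩ := hsurj
    exact ⟨i, (hP0 i).2 ⟨by simpa using hi, e ▸ hx⟩, e.symm⟩
  have hXc : X.card ≤ 4 * S.card := by
    have h1 : X ⊆ ((P0 ∪ {0}) ∪ P0.image (· - 1)) ∪ P0.image (· + 1) := by
      intro j hj
      simp only [X, Finset.mem_filter] at hj
      simp only [Finset.mem_union, Finset.mem_singleton, Finset.mem_image]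
      rcases hj.2 with h | h | h | h
      · exact Or.inl (Or.inl (Or.inl h))
      · exact Or.inl (Or.inl (Or.inr h))
      · exact Or.inl (Or.inr ⟨_, h, rfl⟩)
      · exact Or.inr ⟨_, h.2, by omega⟩
    have h2 : P0.card ≤ S.card := Finset.card_le_card_of_injOn f (fun j hj => ((hP0 j).1 hj).2)
      fun i hi j hj => hf.inj i ((hP0 i).1 hi).1 j ((hP0 j).1 hj).1
    have h3 : 0 < S.card := Finset.card_pos.2 ⟨_, hS f .refl⟩
    have h4 := Finset.card_le_card h1
    have h5 := Finset.card_union_le ((P0 ∪ {0}) ∪ P0.image (· - 1)) (P0.image (· + 1))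
    have h6 := Finset.card_union_le (P0 ∪ {0}) (P0.image (· - 1))
    have h7 := Finset.card_union_le P0 {0}
    have h8 : (P0.image (· - 1)).card ≤ P0.card := Finset.card_image_le
    have h9 : (P0.image (· + 1)).card ≤ P0.card := Finset.card_image_le
    rw [Finset.card_singleton] at h7
    omega
  have hSX : ∀ x ∈ S, x ∈ X.image f := by
    intro x hx
    obtain ⟨j, hj, rfl⟩ := hSpos x hx
    exact Finset.mem_image.2 ⟨j, Finset.mem_filter.2 ⟨by simpa using ((hP0 j).1 hj).1, Or.inl hj⟩, rfl⟩
  have hNX : ∀ x ∈ S, ∀ y ∈ U, G.Adj x y → y ∈ X.image f := by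
    intro x hx y hy hxy
    obtain ⟨-, g, hg, rfl⟩ := Finset.mem_filter.1 (id hx)
    obtain ⟨h1, h2, h3⟩ := hinv g hg
    -- `y` is on the path
    obtain ⟨i, hi, rfl⟩ : ∃ i < n, g i = y := by
      by_contra! hcon
      refine hmax ⟨fun j => if j < n then g j else y, ⟨fun a ha b hb hab => ?_, fun a ha => ?_⟩,
        fun i hi => ?_⟩
      · by_cases ha' : a < n <;> by_cases hb' : b < n <;>
          simp only [ha', hb', if_true, if_false] at hab
        · exact h1.inj a ha' b hb' hab
        · exact absurd hab (hcon a ha')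
        · exact absurd hab.symm (hcon b hb')
        · omega
      · have ha' : a < n := by omega
        by_cases ha2 : a + 1 < n
        · simp only [ha', ha2, if_true]
          exact h1.adj a ha2
        · simp only [ha', ha2, if_true, if_false]
          rw [show a = n - 1 by omega]
          exact hxy
      · dsimp only
        split_ifs with h
        exacts [h2 i h, hy]
    have hin : i + 1 < n := by
      by_contra hcon
      obtain rfl : i = n - 1 := by omega
      exact hxy.ne rfl
    have hSi : g (i + 1) ∈ S := by
      have := hS _ (hg.tail ⟨i, hin, hxy, rfl⟩)
      simpa only [if_neg (show ¬ n - 1 ≤ i by omega), show n + i - (n - 1) = i + 1 by omega] using this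
    -- locate `y` on the original path
    obtain ⟨j, hj, hji⟩ : ∃ j < n, f j = g i := by
      have hsurj := Finset.surj_on_of_inj_on_of_card_le (s := Finset.range n)
        (t := (Finset.range n).image g) (fun i _ => f i) (fun i hi => by
          obtain ⟨j, hj, e⟩ := h3 i (by simpa using hi)
          exact Finset.mem_image.2 ⟨j, by simpa using hj, e.symm⟩)
        (fun i j hi hj e => hf.inj i (by simpa using hi) j (by simpa using hj) e)
        (Finset.card_image_le) (g i) (Finset.mem_image.2 ⟨i, by simpa using hi, rfl⟩)
      obtain ⟨j, hj, e⟩ := hsurj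
      exact ⟨j, by simpa using hj, e.symm⟩
    rw [← hji]
    refine Finset.mem_image.2 ⟨j, Finset.mem_filter.2 ⟨by simpa using hj, ?_⟩, rfl⟩
    by_contra! hcon
    obtain ⟨c1, c2, c3, c4⟩ := hcon
    have hjS : f j ∉ S := fun h => c1 ((hP0 j).2 ⟨hj, h⟩)
    have hjn : j + 1 < n := by
      by_contra h
      have := hS f .refl
      rw [show n - 1 = j by omega] at this
      exact hjS this
    have hjS1 : f (j + 1) ∉ S := fun h => c3 ((hP0 _).2 ⟨hjn, h⟩)
    have hjS2 : f (j - 1) ∉ S := fun h => c4 (by omega) ((hP0 _).2 ⟨by omega, h⟩)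
    obtain ⟨a, ha, ea⟩ := hcons g hg (f j) (f (j + 1)) hjS hjS1 ⟨j, hjn, rfl⟩
    obtain ⟨b, hb, eb⟩ := hcons g hg (f (j - 1)) (f j) hjS2 hjS ⟨j - 1, by omega, by
      rw [Nat.sub_add_cancel (by omega)]⟩
    rw [hji] at ea eb
    rcases Sym2.eq_iff.1 ea with ⟨e1, e2⟩ | ⟨e1, e2⟩
    · have := h1.inj a (by omega) i hi e1
      subst this
      exact hjS1 (e2 ▸ hSi)
    · have := h1.inj _ ha i hi e2
      subst this
      rcases Sym2.eq_iff.1 eb with ⟨e3, e4⟩ | ⟨e3, e4⟩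
      · have := h1.inj _ hb _ ha e4
        obtain rfl : b = a := by omega
        have := hf.inj _ (by omega) _ (by omega) (e1.symm.trans e3)
        omega
      · have := h1.inj _ (by omega) _ ha e3
        subst this
        exact hjS2 (e4 ▸ hSi)
  refine ⟨f, n, S, X, hf, hfU, ⟨_, hS f .refl⟩, Finset.filter_subset _ _,
    fun i hi => by simpa using (Finset.mem_filter.1 hi).1, hXc, fun e he => ?_⟩
  induction e with
  | _ a b =>
  rw [mk_mem_edg] at he
  rw [Set.mem_union, mk_mem_edg, mk_mem_edg, Finset.mem_sdiff, Finset.mem_sdiff]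
  by_cases ha : a ∈ S
  · exact Or.inr ⟨he.1, hSX a ha, hNX a ha b he.2.2 he.1⟩
  · by_cases hb : b ∈ S
    · exact Or.inr ⟨he.1, hNX b hb a he.2.1 he.1.symm, hSX b hb⟩
    · exact Or.inl ⟨he.1, ⟨he.2.1, ha⟩, he.2.2, hb⟩

/-- The edges of a graph are strongly separated by linearly many paths. -/
theorem exists_path_cover (G : SimpleGraph V) : ∀ (n : ℕ) (U : Finset V), U.card = n →
    ∃ F : Finset (Set (Sym2 V)), F.card ≤ 48 * U.card ∧ (∀ A ∈ F, IsPathSet G U A) ∧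
      Cover (edg G U) F := by
  intro n
  induction n using Nat.strong_induction_on with
  | _ n ih =>
  intro U hn
  rcases U.eq_empty_or_nonempty with rfl | hU
  · refine ⟨∅, by simp, by simp, ?_⟩
    intro e he
    induction e with
    | _ a b => simp [mk_mem_edg] at he
  obtain ⟨f, m, S, X, hf, hfU, hS, hSU, hX, hXc, hsub⟩ := exists_posa G hU
  have hc := Finset.card_sdiff_add_card_eq_card hSU
  have hS' := hS.card_pos
  obtain ⟨F1, h1, h2, h3⟩ := ih (U \ S).card (by omega) (U \ S) rfl
  obtain ⟨F2, h4, h5, h6⟩ := hf.cover_chords hfU hX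
  refine ⟨F1 ∪ F2, ?_, fun A hA => ?_, (h3.union h6).mono hsub⟩
  · have := Finset.card_union_le F1 F2
    omega
  · rcases Finset.mem_union.1 hA with h | h
    · exact (h2 A h).mono Finset.sdiff_subset
    · exact h5 A h

end EdgeSep

namespace EdgeSep
open Classical

variable {V : Type}

/-- A labelling of `K` in which `s` is the only local minimum and `t` the only local maximum. -/
structure Ord (G : SimpleGraph V) (K : Finset V) (s t : V) (g : V → ℚ) : Prop where
  hs : s ∈ K
  ht : t ∈ K
  adj : G.Adj s t
  inj : ∀ v ∈ K, ∀ w ∈ K, g v = g w → v = w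
  down : ∀ v ∈ K, v ≠ s → ∃ w ∈ K, G.Adj v w ∧ g w < g v
  up : ∀ v ∈ K, v ≠ t → ∃ w ∈ K, G.Adj v w ∧ g v < g w

lemma Ord.symm {G : SimpleGraph V} {K : Finset V} {s t : V} {g : V → ℚ} (h : Ord G K s t g) :
    Ord G K t s (fun v => -g v) :=
  ⟨h.ht, h.hs, h.adj.symm, fun v hv w hw e => h.inj v hv w hw (neg_injective e),
    fun v hv hne => (h.up v hv hne).imp fun _ h => ⟨h.1, h.2.1, neg_lt_neg h.2.2⟩,
    fun v hv hne => (h.down v hv hne).imp fun _ h => ⟨h.1, h.2.1, neg_lt_neg h.2.2⟩⟩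

lemma ord_pair {G : SimpleGraph V} {s t : V} (h : G.Adj s t) :
    ∃ g, Ord G {s, t} s t g := by
  refine ⟨fun v => if v = s then 0 else 1, by simp, by simp, h, ?_, ?_, ?_⟩
  · intro v hv w hw e
    simp only [Finset.mem_insert, Finset.mem_singleton] at hv hw
    rcases hv with rfl | rfl <;> rcases hw with rfl | rfl <;> simp_all [h.ne']
  · intro v hv hne
    simp only [Finset.mem_insert, Finset.mem_singleton] at hv
    obtain rfl := hv.resolve_left hne
    exact ⟨s, by simp, h.symm, by simp [hne]⟩
  · intro v hv hne
    simp only [Finset.mem_insert, Finset.mem_singleton] at hv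
    obtain rfl := hv.resolve_right hne
    exact ⟨t, by simp, h, by simp [h.ne']⟩

lemma Ord.descend {G : SimpleGraph V} {K : Finset V} {s t : V} {g : V → ℚ} (h : Ord G K s t g) :
    ∀ (n : ℕ) (v : V), v ∈ K → (K.filter fun w => g w < g v).card = n →
    ∃ p : G.Walk v s, ∀ w ∈ p.support, w ∈ K ∧ g w ≤ g v := by
  intro n
  induction n using Nat.strong_induction_on with
  | _ n ih =>
    intro v hv hn
    by_cases hvs : v = s
    · subst hvs
      exact ⟨.nil, by simpa using hv⟩
    obtain ⟨w, hw, hadj, hlt⟩ := h.down v hv hvs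
    have : (K.filter fun x => g x < g w).card < n := by
      rw [← hn]
      refine Finset.card_lt_card (Finset.ssubset_iff_of_subset ?_ |>.2 ⟨w, ?_, ?_⟩)
      · intro x hx
        rw [Finset.mem_filter] at hx ⊢
        exact ⟨hx.1, hx.2.trans hlt⟩
      · simp [hw, hlt]
      · simp
    obtain ⟨p, hp⟩ := ih _ this w hw rfl
    refine ⟨.cons hadj p, fun x hx => ?_⟩
    rw [Walk.support_cons, List.mem_cons] at hx
    rcases hx with rfl | hx
    · exact ⟨hv, le_rfl⟩
    · exact ⟨(hp x hx).1, (hp x hx).2.trans hlt.le⟩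

/-- A vertex with two neighbours in `K` has disjoint routes to `s` and `t`. -/
lemma Ord.routes {G : SimpleGraph V} {K : Finset V} {s t : V} {g : V → ℚ} (h : Ord G K s t g)
    {a : V} (ha : 2 ≤ (nbr G K a).card) :
    ∃ (x : Bool → V) (p : ∀ i, G.Walk (x i) (bif i then t else s)), (∀ i, G.Adj a (x i)) ∧
      (∀ i, ∀ v ∈ (p i).support, v ∈ K) ∧ ∀ i j, i ≠ j → ∀ v ∈ (p i).support, v ∉ (p j).support := by
  obtain ⟨x, hx, y, hy, hne⟩ := Finset.one_lt_card.1 ha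
  rw [mem_nbr] at hx hy
  wlog hlt : g x < g y generalizing x y
  · refine this y hy x hx hne.symm ?_
    exact lt_of_le_of_ne (not_lt.1 hlt) fun e => hne (h.inj x hx.1 y hy.1 e.symm)
  obtain ⟨p, hp⟩ := h.descend _ x hx.1 rfl
  obtain ⟨q, hq⟩ := h.symm.descend _ y hy.1 rfl
  have hd : ∀ v ∈ p.support, v ∉ q.support := fun v hv hv' => by
    have h1 := (hp v hv).2
    have h2 := (hq v hv').2
    linarith
  refine ⟨fun i => bif i then y else x, fun i => match i with | true => q | false => p, ?_, ?_, ?_⟩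
  · rintro (_ | _)
    exacts [hx.2, hy.2]
  · rintro (_ | _) v hv
    exacts [(hp v hv).1, (hq v hv).1]
  · rintro (_ | _) (_ | _) hij v hv
    · exact absurd rfl hij
    · exact hd v hv
    · exact fun hv' => hd v hv' hv
    · exact absurd rfl hij

/-- The edge set of a cycle inside `U`. -/
def IsCycleSet (G : SimpleGraph V) (U : Finset V) (A : Set (Sym2 V)) : Prop :=
  ∃ a, ∃ p : G.Walk a a, p.IsCycle ∧ (∀ v ∈ p.support, v ∈ U) ∧ A = {e | e ∈ p.edges}

lemma exists_cycle_through {G : SimpleGraph V} {K : Finset V} {a b x y : V} (W : G.Walk a b)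
    (hW : W.IsPath) (hab : a ≠ b) (hWK : ∀ v ∈ W.support, v ∉ K) (hax : G.Adj a x)
    (hby : G.Adj b y) (q : G.Walk y x) (hq : ∀ v ∈ q.support, v ∈ K) {U : Finset V}
    (hKU : K ⊆ U) (hWU : ∀ v ∈ W.support, v ∈ U) :
    ∃ A, IsCycleSet G U A ∧ (∀ e ∈ W.edges, e ∈ A) ∧
      ∀ e ∈ A, e ∈ W.edges ∨ e = s(a, x) ∨ e = s(b, y) ∨ e ∈ q.edges := by
  have hq' : ∀ v ∈ q.bypass.support, v ∈ K := fun v hv => hq v (q.support_bypass_subset_support hv)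
  have hyK := hq y q.start_mem_support
  have hxK := hq x q.end_mem_support
  have hpath : (W.append (.cons hby q.bypass)).IsPath := by
    rw [Walk.isPath_def, Walk.support_append, Walk.support_cons, List.tail_cons, List.nodup_append]
    refine ⟨hW.support_nodup, q.bypass_isPath.support_nodup, ?_⟩
    rintro v hv w hw rfl
    exact hWK v hv (hq' v hw)
  refine ⟨_, ⟨x, .cons hax.symm (W.append (.cons hby q.bypass)), ?_, ?_, rfl⟩, ?_, ?_⟩
  · rw [Walk.cons_isCycle_iff]
    refine ⟨hpath, ?_⟩
    rw [Walk.edges_append, Walk.edges_cons, List.mem_append, List.mem_cons]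
    rintro (he | he | he)
    · exact hWK x (W.fst_mem_support_of_mem_edges he) hxK
    · rcases Sym2.eq_iff.1 he with ⟨rfl, -⟩ | ⟨-, h⟩
      · exact hWK x W.end_mem_support hxK
      · exact hab h
    · exact hWK a W.start_mem_support (hq' a (Walk.snd_mem_support_of_mem_edges _ he))
  · intro v hv
    rw [Walk.support_cons, List.mem_cons, Walk.mem_support_append_iff, Walk.support_cons,
      List.mem_cons] at hv
    rcases hv with rfl | hv | rfl | hv
    exacts [hKU hxK, hWU v hv, hWU _ W.end_mem_support, hKU (hq' v hv)]
  · intro e he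
    change e ∈ (Walk.cons hax.symm (W.append (.cons hby q.bypass))).edges
    rw [Walk.edges_cons, Walk.edges_append]
    exact List.mem_cons_of_mem _ (List.mem_append_left _ he)
  · intro e he
    change e ∈ (Walk.cons hax.symm (W.append (.cons hby q.bypass))).edges at he
    rw [Walk.edges_cons, Walk.edges_append, Walk.edges_cons, List.mem_cons, List.mem_append,
      List.mem_cons] at he
    rcases he with rfl | he | he | he
    exacts [Or.inr (Or.inl Sym2.eq_swap), Or.inl he, Or.inr (Or.inr (Or.inl he)),
      Or.inr (Or.inr (Or.inr (q.edges_bypass_subset_edges he)))]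

/-- A path whose ends have two neighbours in `K` closes to cycles through `K` in four ways, with no
common edge outside the path. -/
lemma Ord.close {G : SimpleGraph V} {K U : Finset V} {s t : V} {g : V → ℚ} (h : Ord G K s t g)
    {a b : V} (W : G.Walk a b) (hW : W.IsPath) (hab : a ≠ b) (hWK : ∀ v ∈ W.support, v ∉ K)
    (ha : 2 ≤ (nbr G K a).card) (hb : 2 ≤ (nbr G K b).card) (hKU : K ⊆ U)
    (hWU : ∀ v ∈ W.support, v ∈ U) :
    ∃ F : Finset (Set (Sym2 V)), F.card ≤ 4 ∧ (∀ A ∈ F, IsCycleSet G U A) ∧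
      ∀ e ∈ W.edges, ∀ e' ∉ W.edges, ∃ A ∈ F, e ∈ A ∧ e' ∉ A := by
  obtain ⟨x, p, hax, hpK, hpd⟩ := h.routes ha
  obtain ⟨y, q, hby, hqK, hqd⟩ := h.routes hb
  have haK := hWK a W.start_mem_support
  have hbK := hWK b W.end_mem_support
  have hmid : ∀ i j, ∃ r : G.Walk (y j) (x i), (∀ v ∈ r.support, v ∈ K) ∧
      ∀ e ∈ r.edges, e ∈ (q j).edges ∨ e ∈ (p i).edges ∨ (i ≠ j ∧ e = s(s, t)) := by
    intro i j
    obtain ⟨r, hrK, hr⟩ : ∃ r : G.Walk (bif j then t else s) (bif i then t else s),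
        (∀ v ∈ r.support, v ∈ K) ∧ ∀ e ∈ r.edges, i ≠ j ∧ e = s(s, t) := by
      cases i <;> cases j
      · exact ⟨.nil, by simpa using h.hs, by simp⟩
      · exact ⟨.cons h.adj.symm .nil, by simpa using ⟨h.ht, h.hs⟩, by simp [Sym2.eq_swap]⟩
      · exact ⟨.cons h.adj .nil, by simpa using ⟨h.hs, h.ht⟩, by simp⟩
      · exact ⟨.nil, by simpa using h.ht, by simp⟩
    refine ⟨(q j).append (r.append (p i).reverse), fun v hv => ?_, fun e he => ?_⟩
    · rw [Walk.mem_support_append_iff, Walk.mem_support_append_iff, Walk.support_reverse,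
        List.mem_reverse] at hv
      rcases hv with hv | hv | hv
      exacts [hqK j v hv, hrK v hv, hpK i v hv]
    · rw [Walk.edges_append, Walk.edges_append, Walk.edges_reverse, List.mem_append,
        List.mem_append, List.mem_reverse] at he
      rcases he with he | he | he
      exacts [Or.inl he, Or.inr (Or.inr (hr e he)), Or.inr (Or.inl he)]
  choose r hrK hr using hmid
  have hcyc := fun i j => exists_cycle_through W hW hab hWK (hax i) (hby j) (r i j) (hrK i j) hKU hWU
  choose A hA hWA hAe using hcyc
  refine ⟨(Finset.univ : Finset (Bool × Bool)).image fun ij => A ij.1 ij.2,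
    Finset.card_image_le.trans (by simp), ?_, ?_⟩
  · intro B hB
    obtain ⟨ij, -, rfl⟩ := Finset.mem_image.1 hB
    exact hA _ _
  · intro e he e' he'
    suffices ∃ i j, e' ∉ A i j by
      obtain ⟨i, j, hij⟩ := this
      exact ⟨A i j, Finset.mem_image.2 ⟨(i, j), Finset.mem_univ _, rfl⟩, hWA i j e he, hij⟩
    have key : ∀ {c : V} {z : Bool → V} (P : ∀ i, G.Walk (z i) (bif i then t else s)), c ∉ K →
        (∀ i, ∀ v ∈ (P i).support, v ∈ K) →
        (∀ i j, i ≠ j → ∀ v ∈ (P i).support, v ∉ (P j).support) →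
        (e' = s(s, t) → ∀ i, e' ≠ s(c, z i) ∧ e' ∉ (P i).edges) ∧
        ∃ i, e' ≠ s(c, z i) ∧ e' ∉ (P i).edges := by
      intro c z P hc hPK hPd
      have hst : ∀ i, s(s, t) ≠ s(c, z i) ∧ s(s, t) ∉ (P i).edges := by
        intro i
        constructor
        · intro he
          have : c ∈ s(s, t) := he ▸ Sym2.mem_mk_left _ _
          rcases Sym2.mem_iff.1 this with rfl | rfl
          exacts [hc h.hs, hc h.ht]
        · intro he
          have h1 := (P i).fst_mem_support_of_mem_edges he
          have h2 := (P i).snd_mem_support_of_mem_edges he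
          cases i
          · exact hPd true false (by simp) t (P true).end_mem_support h2
          · exact hPd false true (by simp) s (P false).end_mem_support h1
      refine ⟨fun he => he ▸ hst, ?_⟩
      by_contra hcon
      push Not at hcon
      have hv : ∀ i, ∃ v ∈ (P i).support, v ∈ e' := by
        intro i
        by_cases hi : e' = s(c, z i)
        · exact ⟨z i, (P i).start_mem_support, hi ▸ Sym2.mem_mk_right _ _⟩
        · have := hcon i hi
          induction e' using Sym2.ind with
          | _ v w => exact ⟨v, (P i).fst_mem_support_of_mem_edges this, Sym2.mem_mk_left _ _⟩
      by_cases h0 : e' = s(c, z false)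
      · obtain ⟨v, hv1, hv2⟩ := hv true
        rw [h0, Sym2.mem_iff] at hv2
        rcases hv2 with rfl | rfl
        · exact hc (hPK _ _ hv1)
        · exact hPd false true (by simp) _ (P false).start_mem_support hv1
      · have h0 := hcon false h0
        obtain ⟨v, hv1, hv2⟩ := hv true
        exact hPd true false (by simp) v hv1 (Walk.mem_support_of_mem_edges h0 hv2)
    obtain ⟨ha1, i, hi⟩ := key p haK hpK hpd
    obtain ⟨hb1, j, hj⟩ := key q hbK hqK hqd
    by_cases hst : e' = s(s, t)
    · refine ⟨false, false, fun hmem => ?_⟩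
      rcases hAe _ _ _ hmem with h | h | h | h
      · exact he' h
      · exact (ha1 hst false).1 h
      · exact (hb1 hst false).1 h
      · rcases hr _ _ _ h with h | h | h
        exacts [(hb1 hst false).2 h, (ha1 hst false).2 h, h.1 rfl]
    · refine ⟨i, j, fun hmem => ?_⟩
      rcases hAe _ _ _ hmem with h | h | h | h
      · exact he' h
      · exact hi.1 h
      · exact hj.1 h
      · rcases hr _ _ _ h with h | h | h
        exacts [hj.2 h, hi.2 h, hst h.2]

/-- Adding an ear keeps the ordering. -/
lemma Ord.ear_of_lt {G : SimpleGraph V} {K : Finset V} {s t : V} {g : V → ℚ} (h : Ord G K s t g)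
    {f : ℕ → V} {n : ℕ} (hf : PathFun G f (n + 1)) (hfK : ∀ i ≤ n, f i ∉ K) {u u' : V}
    (hu : u ∈ K) (hu' : u' ∈ K) (h0 : G.Adj (f 0) u) (h1 : G.Adj (f n) u') (hlt : g u < g u') :
    ∃ g', Ord G (K ∪ (Finset.range (n + 1)).image f) s t g' := by
  obtain ⟨m, hm, hmin⟩ := (K.filter fun w => g u < g w).exists_min_image g
    ⟨u', Finset.mem_filter.2 ⟨hu', hlt⟩⟩
  rw [Finset.mem_filter] at hm
  have hmu' := hmin u' (Finset.mem_filter.2 ⟨hu', hlt⟩)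
  obtain ⟨ℓ, hℓ⟩ : ∃ ℓ : V → ℕ, ∀ i ≤ n, ℓ (f i) = i := by
    refine ⟨Function.invFunOn f {i | i ≤ n}, fun i hi => ?_⟩
    exact Set.InjOn.leftInvOn_invFunOn
      (fun a ha b hb hab => hf.inj a (Nat.lt_succ_of_le ha) b (Nat.lt_succ_of_le hb) hab) hi
  set L : ℕ → ℚ := fun i => g u + (g m - g u) * ((i + 1) / (n + 2)) with hL
  have hn : (0 : ℚ) < n + 2 := by positivity
  have hd : 0 < g m - g u := by linarith [hm.2]
  have hLlt : ∀ i j, i < j → L i < L j := by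
    intro i j hij
    simp only [hL]
    have : (i : ℚ) < j := by exact_mod_cast hij
    gcongr
  have hL0 : ∀ i, g u < L i := by
    intro i
    simp only [hL]
    have : 0 < (g m - g u) * (((i : ℚ) + 1) / (n + 2)) := by positivity
    linarith
  have hL1 : ∀ i ≤ n, L i < g m := by
    intro i hi
    simp only [hL]
    have h1 : ((i : ℚ) + 1) / (n + 2) < 1 := by
      rw [div_lt_one hn]
      have : (i : ℚ) ≤ n := by exact_mod_cast hi
      linarith
    nlinarith
  set g' : V → ℚ := fun v => if v ∈ K then g v else L (ℓ v) with hg'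
  have hgK : ∀ v ∈ K, g' v = g v := fun v hv => by simp [hg', hv]
  have hgf : ∀ i ≤ n, g' (f i) = L i := fun i hi => by simp [hg', hfK i hi, hℓ i hi]
  have hmem : ∀ v, v ∈ K ∪ (Finset.range (n + 1)).image f ↔ v ∈ K ∨ ∃ i ≤ n, v = f i := by
    intro v
    rw [Finset.mem_union, Finset.mem_image]
    simp only [Finset.mem_range, Nat.lt_succ_iff]
    constructor
    · rintro (h | ⟨i, hi, rfl⟩)
      exacts [Or.inl h, Or.inr ⟨i, hi, rfl⟩]
    · rintro (h | ⟨i, hi, rfl⟩)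
      exacts [Or.inl h, Or.inr ⟨i, hi, rfl⟩]
  have hcross : ∀ v ∈ K, ∀ i ≤ n, g v ≠ L i := by
    intro v hv i hi e
    have := hmin v (Finset.mem_filter.2 ⟨hv, e ▸ hL0 i⟩)
    have := hL1 i hi
    linarith
  refine ⟨g', (hmem _).2 (Or.inl h.hs), (hmem _).2 (Or.inl h.ht), h.adj, ?_, ?_, ?_⟩
  · intro v hv w hw e
    rcases (hmem v).1 hv with hv | ⟨i, hi, rfl⟩ <;> rcases (hmem w).1 hw with hw | ⟨j, hj, rfl⟩
    · rw [hgK v hv, hgK w hw] at e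
      exact h.inj v hv w hw e
    · rw [hgK v hv, hgf j hj] at e
      exact absurd e (hcross v hv j hj)
    · rw [hgK w hw, hgf i hi] at e
      exact absurd e.symm (hcross w hw i hi)
    · rw [hgf i hi, hgf j hj] at e
      rcases lt_trichotomy i j with hij | rfl | hij
      · exact absurd e (hLlt i j hij).ne
      · rfl
      · exact absurd e (hLlt j i hij).ne'
  · intro v hv hne
    rcases (hmem v).1 hv with hv | ⟨i, hi, rfl⟩
    · obtain ⟨w, hw, hadj, hlt⟩ := h.down v hv hne
      exact ⟨w, (hmem w).2 (Or.inl hw), hadj, by rwa [hgK v hv, hgK w hw]⟩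
    · rcases i with _ | i
      · exact ⟨u, (hmem u).2 (Or.inl hu), h0, by rw [hgK u hu, hgf 0 hi]; exact hL0 0⟩
      · refine ⟨f i, (hmem _).2 (Or.inr ⟨i, by omega, rfl⟩), (hf.adj i (by omega)).symm, ?_⟩
        rw [hgf i (by omega), hgf (i + 1) hi]
        exact hLlt _ _ (by omega)
  · intro v hv hne
    rcases (hmem v).1 hv with hv | ⟨i, hi, rfl⟩
    · obtain ⟨w, hw, hadj, hlt⟩ := h.up v hv hne
      exact ⟨w, (hmem w).2 (Or.inl hw), hadj, by rwa [hgK v hv, hgK w hw]⟩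
    · rcases hi.lt_or_eq with hlt | rfl
      · refine ⟨f (i + 1), (hmem _).2 (Or.inr ⟨i + 1, hlt, rfl⟩), hf.adj i (by omega), ?_⟩
        rw [hgf i hi, hgf (i + 1) hlt]
        exact hLlt _ _ (by omega)
      · refine ⟨u', (hmem u').2 (Or.inl hu'), h1, ?_⟩
        rw [hgK u' hu', hgf i hi]
        exact (hL1 i hi).trans_le hmu'

lemma Ord.ear {G : SimpleGraph V} {K : Finset V} {s t : V} {g : V → ℚ} (h : Ord G K s t g)
    {f : ℕ → V} {n : ℕ} (hf : PathFun G f (n + 1)) (hfK : ∀ i ≤ n, f i ∉ K) {u u' : V}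
    (hu : u ∈ K) (hu' : u' ∈ K) (h0 : G.Adj (f 0) u) (h1 : G.Adj (f n) u') (hne : u ≠ u') :
    ∃ g', Ord G (K ∪ (Finset.range (n + 1)).image f) s t g' := by
  rcases lt_trichotomy (g u) (g u') with hlt | e | hlt
  · exact h.ear_of_lt hf hfK hu hu' h0 h1 hlt
  · exact absurd (h.inj u hu u' hu' e) hne
  · obtain ⟨g', hg'⟩ := h.symm.ear_of_lt hf hfK hu hu' h0 h1 (neg_lt_neg hlt)
    exact ⟨_, hg'.symm⟩

end EdgeSep

namespace EdgeSep
open Classical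

variable {V : Type}

/-- `E` is covered by at most `N` sets satisfying `P`. -/
def HasCover (P : Set (Sym2 V) → Prop) (E : Set (Sym2 V)) (N : ℕ) : Prop :=
  ∃ F : Finset (Set (Sym2 V)), F.card ≤ N ∧ (∀ A ∈ F, P A) ∧ Cover E F

lemma HasCover.union {P : Set (Sym2 V) → Prop} {E E' : Set (Sym2 V)} {N N' : ℕ}
    (h : HasCover P E N) (h' : HasCover P E' N') : HasCover P (E ∪ E') (N + N') := by
  obtain ⟨F, h1, h2, h3⟩ := h
  obtain ⟨F', h1', h2', h3'⟩ := h'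
  refine ⟨F ∪ F', (Finset.card_union_le _ _).trans (by omega), fun A hA => ?_, h3.union h3'⟩
  exact (Finset.mem_union.1 hA).elim (h2 A) (h2' A)

lemma HasCover.mono {P P' : Set (Sym2 V) → Prop} {E E' : Set (Sym2 V)} {N N' : ℕ}
    (h : HasCover P E N) (hP : ∀ A, P A → P' A) (hE : E' ⊆ E) (hN : N ≤ N') : HasCover P' E' N' := by
  obtain ⟨F, h1, h2, h3⟩ := h
  exact ⟨F, h1.trans hN, fun A hA => hP A (h2 A hA), h3.mono hE⟩

lemma HasCover.singles {P : Set (Sym2 V) → Prop} (E : Finset (Sym2 V)) (hP : ∀ e ∈ E, P {e}) :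
    HasCover P E E.card := by
  refine ⟨_, Finset.card_image_le, fun A hA => ?_, cover_singles E⟩
  obtain ⟨e, he, rfl⟩ := Finset.mem_image.1 hA
  exact hP e he

/-- Replace every member of a covering family by a bounded number of pieces. -/
lemma HasCover.refine_on {P P' : Set (Sym2 V) → Prop} {E X : Set (Sym2 V)} {N c : ℕ}
    (h : HasCover P E N) (hP : ∀ A, P A → ∃ F : Finset (Set (Sym2 V)), F.card ≤ c ∧
      (∀ B ∈ F, P' B) ∧ ∀ e ∈ A, ∀ e' ∉ A, e' ∈ X → ∃ B ∈ F, e ∈ B ∧ e' ∉ B) :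
    ∃ F : Finset (Set (Sym2 V)), F.card ≤ c * N ∧ (∀ B ∈ F, P' B) ∧
      ∀ e ∈ E, ∀ e', e' ≠ e → e' ∈ X → ∃ B ∈ F, e ∈ B ∧ e' ∉ B := by
  obtain ⟨F, h1, h2, h3⟩ := h
  choose! f hf1 hf2 hf3 using hP
  refine ⟨F.biUnion f, ?_, ?_, ?_⟩
  · calc (F.biUnion f).card ≤ ∑ A ∈ F, (f A).card := Finset.card_biUnion_le
      _ ≤ ∑ A ∈ F, c := Finset.sum_le_sum fun A hA => hf1 A (h2 A hA)
      _ ≤ c * N := by rw [Finset.sum_const, smul_eq_mul, mul_comm]; gcongr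
  · intro B hB
    obtain ⟨A, hA, hB⟩ := Finset.mem_biUnion.1 hB
    exact hf2 A (h2 A hA) B hB
  · intro e he e' hne hX
    obtain ⟨A, hA, heA, heA'⟩ := h3 e he e' hne
    obtain ⟨B, hB, hBe⟩ := hf3 A (h2 A hA) e heA e' heA' hX
    exact ⟨B, Finset.mem_biUnion.2 ⟨A, hA, hB⟩, hBe⟩

lemma HasCover.refine {P P' : Set (Sym2 V) → Prop} {E : Set (Sym2 V)} {N c : ℕ}
    (h : HasCover P E N) (hP : ∀ A, P A → ∃ F : Finset (Set (Sym2 V)), F.card ≤ c ∧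
      (∀ B ∈ F, P' B) ∧ ∀ e ∈ A, ∀ e' ∉ A, ∃ B ∈ F, e ∈ B ∧ e' ∉ B) :
    HasCover P' E (c * N) := by
  have := h.refine_on (X := Set.univ) (c := c) (P' := P') (by simpa using hP)
  simpa [HasCover, Cover] using this

/-- The edges of `G` between `A` and `B`. -/
def edb (G : SimpleGraph V) (A B : Finset V) : Set (Sym2 V) :=
  {e | ∃ v ∈ A, ∃ w ∈ B, G.Adj v w ∧ e = s(v, w)}

lemma edg_union (G : SimpleGraph V) (A B : Finset V) :
    edg G (A ∪ B) ⊆ edg G A ∪ edg G B ∪ edb G B A := by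
  intro e he
  induction e using Sym2.ind with
  | _ v w =>
    rw [mk_mem_edg, Finset.mem_union, Finset.mem_union] at he
    obtain ⟨h, h1, h2⟩ := he
    rcases h1 with h1 | h1 <;> rcases h2 with h2 | h2
    · exact Or.inl (Or.inl (mk_mem_edg.2 ⟨h, h1, h2⟩))
    · exact Or.inr ⟨w, h2, v, h1, h.symm, Sym2.eq_swap⟩
    · exact Or.inr ⟨v, h1, w, h2, h, rfl⟩
    · exact Or.inl (Or.inr (mk_mem_edg.2 ⟨h, h1, h2⟩))

lemma edb_union (G : SimpleGraph V) (A B C : Finset V) :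
    edb G A (B ∪ C) ⊆ edb G A B ∪ edb G A C := by
  rintro e ⟨v, hv, w, hw, h⟩
  rcases Finset.mem_union.1 hw with hw | hw
  exacts [Or.inl ⟨v, hv, w, hw, h⟩, Or.inr ⟨v, hv, w, hw, h⟩]

lemma edg_subset_edb (G : SimpleGraph V) (A : Finset V) : edg G A ⊆ edb G A A := by
  intro e he
  induction e using Sym2.ind with
  | _ v w =>
    obtain ⟨h, h1, h2⟩ := mk_mem_edg.1 he
    exact ⟨v, h1, w, h2, h, rfl⟩

lemma HasCover.edb {P : Set (Sym2 V) → Prop} {G : SimpleGraph V} {U A B : Finset V} {c : ℕ}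
    (hP : ∀ e ∈ edg G U, P {e}) (hA : A ⊆ U) (hB : B ⊆ U) (hc : ∀ v ∈ A, (nbr G B v).card ≤ c) :
    HasCover P (edb G A B) (c * A.card) := by
  let E : Finset (Sym2 V) := A.biUnion fun v => (nbr G B v).image fun w => s(v, w)
  have hE : E.card ≤ c * A.card := by
    calc E.card ≤ ∑ v ∈ A, ((nbr G B v).image fun w => s(v, w)).card := Finset.card_biUnion_le
      _ ≤ ∑ v ∈ A, c := Finset.sum_le_sum fun v hv => Finset.card_image_le.trans (hc v hv)
      _ = c * A.card := by rw [Finset.sum_const, smul_eq_mul, mul_comm]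
  have hmem : ∀ e, e ∈ E ↔ e ∈ EdgeSep.edb G A B := by
    intro e
    simp only [E, Finset.mem_biUnion, Finset.mem_image, mem_nbr]
    constructor
    · rintro ⟨v, hv, w, ⟨hw, h⟩, rfl⟩
      exact ⟨v, hv, w, hw, h, rfl⟩
    · rintro ⟨v, hv, w, hw, h, rfl⟩
      exact ⟨v, hv, w, ⟨hw, h⟩, rfl⟩
  refine (HasCover.singles E fun e he => ?_).mono (fun _ => id) (fun e he => (hmem e).2 he) hE
  obtain ⟨v, hv, w, hw, h, rfl⟩ := (hmem e).1 he
  exact hP _ (mk_mem_edg.2 ⟨h, hA hv, hB hw⟩)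

/-- A single edge or a cycle of `G[U]`. -/
def Piece (G : SimpleGraph V) (U : Finset V) (A : Set (Sym2 V)) : Prop :=
  (∃ e ∈ edg G U, A = {e}) ∨ IsCycleSet G U A

lemma Piece.mono {G : SimpleGraph V} {U U' : Finset V} (hU : U ⊆ U') {A : Set (Sym2 V)}
    (h : Piece G U A) : Piece G U' A := by
  rcases h with ⟨e, he, rfl⟩ | ⟨a, p, h1, h2, h3⟩
  exacts [Or.inl ⟨e, edg_mono hU he, rfl⟩, Or.inr ⟨a, p, h1, fun v hv => hU (h2 v hv), h3⟩]

lemma exists_path_hasCover (G : SimpleGraph V) (U : Finset V) :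
    HasCover (IsPathSet G U) (edg G U) (48 * U.card) :=
  exists_path_cover G U.card U rfl

/-- The bipartite subgraph between `A` and `B`. -/
def bip (G : SimpleGraph V) (A B : Finset V) : SimpleGraph V where
  Adj a b := G.Adj a b ∧ ((a ∈ A ∧ b ∈ B) ∨ (a ∈ B ∧ b ∈ A))
  symm := ⟨fun _ _ h => ⟨h.1.symm, h.2.symm.imp And.symm And.symm⟩⟩
  loopless := ⟨fun _ h => G.loopless.irrefl _ h.1⟩

lemma bip_le (G : SimpleGraph V) (A B : Finset V) : bip G A B ≤ G := fun _ _ h => h.1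

/-- Dropping the first edge of a path if it starts in `B`. -/
lemma exists_trim {G : SimpleGraph V} {A B : Finset V} {a b : V}
    (p : (bip G A B).Walk a b) (hp : p.IsPath) (ha : a ∈ A ∨ b ∈ A) :
    ∃ a' ∈ A, ∃ q : (bip G A B).Walk a' b, q.IsPath ∧ (∀ v ∈ q.support, v ∈ p.support) ∧
      ∃ E : Finset (Sym2 V), E.card ≤ 1 ∧ (∀ e ∈ E, e ∈ p.edges) ∧
        ∀ e, e ∈ p.edges ↔ e ∈ E ∨ e ∈ q.edges := by
  by_cases haA : a ∈ A
  · exact ⟨a, haA, p, hp, fun _ => id, ∅, by simp, by simp, by simp⟩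
  cases p with
  | nil => exact absurd (ha.elim id id) haA
  | cons hadj q =>
    rename_i c
    have hc : c ∈ A := (hadj.2.resolve_left fun h => haA h.1).2
    refine ⟨c, hc, q, ((Walk.cons_isPath_iff _ _).1 hp).1, fun v hv => List.mem_cons_of_mem _ hv,
      {s(a, c)}, by simp, by simp, by simp⟩

section Close

variable {G : SimpleGraph V} {K U : Finset V} {s t : V} {g : V → ℚ}

lemma Ord.cover_inside (h : Ord G K s t g) (hKU : K ⊆ U) {L : Finset V} (hL : L ⊆ U)
    (hLK : ∀ v ∈ L, v ∉ K) (h2 : ∀ v ∈ L, 2 ≤ (nbr G K v).card) :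
    HasCover (Piece G U) (edg G L) (192 * L.card) := by
  refine ((exists_path_hasCover G L).refine (c := 4) (P' := Piece G U) ?_).mono (fun _ => id)
    subset_rfl (by omega)
  rintro A ⟨a, b, W, hab, hW, hWL, rfl⟩
  obtain ⟨F, hF, hF1, hF2⟩ := h.close W hW hab (fun v hv => hLK v (hWL v hv))
    (h2 a (hWL a W.start_mem_support)) (h2 b (hWL b W.end_mem_support)) hKU
    (fun v hv => hL (hWL v hv))
  exact ⟨F, hF, fun B hB => Or.inr (hF1 B hB), hF2⟩

lemma Ord.cover_between (h : Ord G K s t g) (hKU : K ⊆ U) {A B : Finset V} (hA : A ⊆ U)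
    (hB : B ⊆ U) (hAB : Disjoint A B) (hAK : ∀ v ∈ A, v ∉ K) (hBK : ∀ v ∈ B, v ∉ K)
    (h2 : ∀ v ∈ A, 2 ≤ (nbr G K v).card) :
    HasCover (Piece G U) (edb G B A) (288 * (A.card + B.card)) := by
  have hcard := Finset.card_union_of_disjoint hAB
  refine ((exists_path_hasCover (bip G A B) (A ∪ B)).refine (c := 6) (P' := Piece G U) ?_).mono
    (fun _ => id) ?_ (by omega)
  · rintro _ ⟨a, b, p, hab, hp, hpU, rfl⟩
    have hUU : ∀ v ∈ A ∪ B, v ∈ U ∧ v ∉ K := fun v hv => (Finset.mem_union.1 hv).elim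
      (fun hv => ⟨hA hv, hAK v hv⟩) (fun hv => ⟨hB hv, hBK v hv⟩)
    obtain ⟨a', b', ha', hb', q, hq, hqp, E, hE, hEp, hpe⟩ : ∃ a' b', a' ∈ A ∧ b' ∈ A ∧
        ∃ q : (bip G A B).Walk a' b', q.IsPath ∧ (∀ v ∈ q.support, v ∈ p.support) ∧
        ∃ E : Finset (Sym2 V), E.card ≤ 2 ∧ (∀ e ∈ E, e ∈ p.edges) ∧
          ∀ e, e ∈ p.edges ↔ e ∈ E ∨ e ∈ q.edges := by
      obtain ⟨c, hc, r, hr, hrp, E, hE, hEp, hpe⟩ : ∃ c ∈ A, ∃ r : (bip G A B).Walk c b, r.IsPath ∧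
          (∀ v ∈ r.support, v ∈ p.support) ∧ ∃ E : Finset (Sym2 V), E.card ≤ 1 ∧
          (∀ e ∈ E, e ∈ p.edges) ∧ ∀ e, e ∈ p.edges ↔ e ∈ E ∨ e ∈ r.edges := by
        by_cases hh : a ∈ A ∨ b ∈ A
        · exact exists_trim p hp hh
        · rw [not_or] at hh
          cases p with
          | nil => exact absurd rfl hab
          | cons hadj q =>
            rename_i c
            have hc : c ∈ A := (hadj.2.resolve_left fun h => hh.1 h.1).2
            exact ⟨c, hc, q, ((Walk.cons_isPath_iff _ _).1 hp).1,
              fun v hv => List.mem_cons_of_mem _ hv, {s(a, c)}, by simp, by simp, by simp⟩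
      obtain ⟨d, hd, q, hq, hqr, E', hE', hEp', hpe'⟩ := exists_trim r.reverse hr.reverse
        (Or.inr hc)
      refine ⟨c, d, hc, hd, q.reverse, hq.reverse, fun v hv => hrp v ?_, E ∪ E', ?_, ?_, ?_⟩
      · simpa using hqr v (by simpa using hv)
      · exact (Finset.card_union_le _ _).trans (by omega)
      · intro e he
        rcases Finset.mem_union.1 he with he | he
        · exact hEp e he
        · exact (hpe e).2 (Or.inr (by simpa using hEp' e he))
      · intro e
        have := hpe' e
        rw [Walk.edges_reverse, List.mem_reverse] at this
        rw [hpe, this, Finset.mem_union, Walk.edges_reverse, List.mem_reverse, or_assoc]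
    obtain ⟨F, hF, hF1, hF2⟩ : ∃ F : Finset (Set (Sym2 V)), F.card ≤ 4 ∧
        (∀ A ∈ F, IsCycleSet G U A) ∧
        ∀ e ∈ q.edges, ∀ e' ∉ q.edges, ∃ A ∈ F, e ∈ A ∧ e' ∉ A := by
      by_cases hne : a' = b'
      · subst hne
        rw [(Walk.isPath_iff_nil.1 hq).eq_nil]
        exact ⟨∅, by simp, by simp, by simp⟩
      · have := h.close (q.mapLe (bip_le G A B)) (by simpa using hq) hne
          (fun v hv => (hUU v (hpU v (hqp v (by simpa using hv)))).2) (h2 _ ha') (h2 _ hb') hKU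
          (fun v hv => (hUU v (hpU v (hqp v (by simpa using hv)))).1)
        simpa using this
    refine ⟨F ∪ E.image fun e => {e}, ?_, ?_, ?_⟩
    · have := Finset.card_image_le (s := E) (f := fun e => ({e} : Set (Sym2 V)))
      exact (Finset.card_union_le _ _).trans (by omega)
    · intro C hC
      rcases Finset.mem_union.1 hC with hC | hC
      · exact Or.inr (hF1 C hC)
      · obtain ⟨e, he, rfl⟩ := Finset.mem_image.1 hC
        have hep := hEp e he
        exact Or.inl ⟨e, ⟨edgeSet_mono (bip_le G A B) (p.edges_subset_edgeSet hep),
          fun v hv => (hUU v (hpU v (Walk.mem_support_of_mem_edges hep hv))).1⟩, rfl⟩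
    · intro e he e' he'
      change e ∈ p.edges at he
      change e' ∉ p.edges at he'
      rw [hpe, not_or] at he'
      rcases (hpe e).1 he with he | he
      · exact ⟨{e}, Finset.mem_union_right _ (Finset.mem_image.2 ⟨e, he, rfl⟩), rfl,
          fun h => he'.1 (Set.mem_singleton_iff.1 h ▸ he)⟩
      · obtain ⟨C, hC, hCe⟩ := hF2 e he e' he'.2
        exact ⟨C, Finset.mem_union_left _ hC, hCe⟩
  · rintro e ⟨v, hv, w, hw, hadj, rfl⟩
    exact mk_mem_edg.2 ⟨⟨hadj, Or.inr ⟨hv, hw⟩⟩, Finset.mem_union_right _ hv,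
      Finset.mem_union_left _ hw⟩

/-- Vertices with two neighbours in `K` can be added to the ordering. -/
lemma Ord.add (h : Ord G K s t g) (L : Finset V) (hLK : ∀ v ∈ L, v ∉ K)
    (h2 : ∀ v ∈ L, 2 ≤ (nbr G K v).card) : ∃ g', Ord G (K ∪ L) s t g' := by
  induction L using Finset.induction_on with
  | empty => exact ⟨g, by simpa using h⟩
  | insert x L hx ih =>
    obtain ⟨g', hg'⟩ := ih (fun v hv => hLK v (Finset.mem_insert_of_mem hv))
      (fun v hv => h2 v (Finset.mem_insert_of_mem hv))
    obtain ⟨u, hu, u', hu', hne⟩ := Finset.one_lt_card.1 (h2 x (Finset.mem_insert_self _ _))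
    rw [mem_nbr] at hu hu'
    have hxK := hLK x (Finset.mem_insert_self _ _)
    obtain ⟨g'', hg''⟩ := hg'.ear (f := fun _ => x) (n := 0)
      ⟨fun i hi j hj _ => by omega, fun i hi => by omega⟩ (by simp [hxK, hx])
      (Finset.mem_union_left _ hu.1) (Finset.mem_union_left _ hu'.1) hu.2 hu'.2 hne
    refine ⟨g'', ?_⟩
    have e : K ∪ insert x L = K ∪ L ∪ (Finset.range (0 + 1)).image fun _ => x := by
      ext v
      simp
    rw [e]
    exact hg''

end Close

lemma exists_ear {G : SimpleGraph V} {U K : Finset V} {s t y₀ : V} (hs : s ∈ K) (ht : t ∈ K)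
    (hst : s ≠ t) (hKU : K ⊆ U) (hy₀ : y₀ ∈ U) (hy₀K : y₀ ∉ K)
    (hns : ∀ A B, IsSep G U A B → (A ∩ B).card ≤ 1 → U ⊆ A ∨ U ⊆ B) :
    ∃ (f : ℕ → V) (n : ℕ) (u u' : V), PathFun G f (n + 1) ∧ (∀ i ≤ n, f i ∈ U ∧ f i ∉ K) ∧
      u ∈ K ∧ u' ∈ K ∧ G.Adj (f 0) u ∧ G.Adj (f n) u' ∧ u ≠ u' ∧
      ∀ y ∈ U, y ∉ K → (nbr G ((Finset.range (n + 1)).image f) y).card ≤ 3 := by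
  let C : Finset V := U.filter fun v => v ∈ comp G (↑(U \ K)) y₀
  have hy₀C : y₀ ∈ comp G (↑(U \ K)) y₀ := mem_comp_self (by simp [hy₀, hy₀K])
  have hCmem : ∀ v, v ∈ C ↔ v ∈ comp G (↑(U \ K)) y₀ := by
    intro v
    have := @comp_subset _ G (↑(U \ K)) y₀ v
    simp only [C, Finset.mem_filter, and_iff_right_iff_imp]
    intro h
    have := this h
    simp only [Finset.coe_sdiff, Set.mem_sdiff, Finset.mem_coe] at this
    exact this.1
  have hCK : ∀ v ∈ C, v ∈ U ∧ v ∉ K := by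
    intro v hv
    have := comp_subset ((hCmem v).1 hv)
    simpa using this
  let N : Finset V := K.filter fun u => ∃ y ∈ C, G.Adj y u
  have hN : 1 < N.card := by
    by_contra hN
    have hinter : (C ∪ N) ∩ (U \ C) = N := by
      ext v
      simp only [Finset.mem_inter, Finset.mem_union, Finset.mem_sdiff]
      constructor
      · rintro ⟨h | h, h'⟩
        exacts [absurd h h'.2, h]
      · intro h
        have hvK := (Finset.mem_filter.1 h).1
        exact ⟨Or.inr h, hKU hvK, fun hc => (hCK v hc).2 hvK⟩
    have hsep : IsSep G U (C ∪ N) (U \ C) := by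
      refine ⟨?_, ?_⟩
      · ext v
        simp only [Finset.mem_union, Finset.mem_sdiff]
        constructor
        · rintro ((h | h) | h)
          exacts [(hCK v h).1, hKU (Finset.mem_filter.1 h).1, h.1]
        · intro h
          by_cases hc : v ∈ C
          exacts [Or.inl (Or.inl hc), Or.inr ⟨h, hc⟩]
      · intro a ha haB b hb hbA hadj
        have hbU := (Finset.mem_sdiff.1 hb).1
        rw [Finset.mem_union, not_or] at hbA
        have haC : a ∈ C := by
          rcases Finset.mem_union.1 ha with h | h
          · exact h
          · by_contra hc
            exact haB (Finset.mem_sdiff.2 ⟨hKU (Finset.mem_filter.1 h).1, hc⟩)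
        by_cases hbK : b ∈ K
        · exact hbA.2 (Finset.mem_filter.2 ⟨hbK, a, haC, hadj⟩)
        · refine hbA.1 ((hCmem b).2 ?_)
          exact Reach.adj ((hCmem a).1 haC) hadj (by simp [hbU, hbK])
    rcases hns _ _ hsep (by rw [hinter]; omega) with h | h
    · have hKN : ∀ v ∈ K, v ∈ N := fun v hv => (Finset.mem_union.1 (h (hKU hv))).resolve_left
        fun hc => (hCK v hc).2 hv
      exact hN (Finset.one_lt_card.2 ⟨s, hKN s hs, t, hKN t ht, hst⟩)
    · exact (Finset.mem_sdiff.1 (h hy₀)).2 ((hCmem _).2 hy₀C)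
  obtain ⟨u, hu, u', hu', hne⟩ := Finset.one_lt_card.1 hN
  obtain ⟨huK, y₁, hy₁, h₁⟩ := Finset.mem_filter.1 hu
  obtain ⟨huK', y₂, hy₂, h₂⟩ := Finset.mem_filter.1 hu'
  set H := restr G (↑(U \ K)) with hH
  have hreach : H.Reachable y₁ y₂ := by
    obtain ⟨_, rfl, p, hp⟩ := (Reach.symm' ((hCmem y₁).1 hy₁)).trans' ((hCmem y₂).1 hy₂)
    refine ⟨p.transfer H fun e he => ?_⟩
    induction e using Sym2.ind with
    | _ v w =>
      exact ⟨p.adj_of_mem_edges he, by simpa using hp v (p.fst_mem_support_of_mem_edges he),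
        by simpa using hp w (p.snd_mem_support_of_mem_edges he)⟩
  obtain ⟨p, hp, hlen⟩ := hreach.exists_path_of_dist
  have hpU : ∀ i, p.getVert i ∈ U ∧ p.getVert i ∉ K := by
    intro i
    have := restr_walk p (by simpa using hCK y₁ hy₁) _ (p.getVert_mem_support i)
    simpa using this
  refine ⟨p.getVert, p.length, u, u', ⟨?_, ?_⟩, fun i _ => hpU i, huK, huK', by simpa using h₁,
    by simpa using h₂, hne, ?_⟩
  · intro i hi j hj e
    exact hp.getVert_injOn (Nat.lt_succ_iff.1 hi) (Nat.lt_succ_iff.1 hj) e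
  · intro i hi
    exact restr_le G _ (p.adj_getVert_succ (by omega))
  · intro y hy hyK
    have hfar : ∀ i j, i ≤ p.length → j ≤ p.length → G.Adj y (p.getVert i) →
        G.Adj y (p.getVert j) → j < i + 3 := by
      intro i j hi hj hai haj
      by_contra hij
      have hyS : y ∈ (↑(U \ K) : Set V) := by simp [hy, hyK]
      have hS : ∀ i, p.getVert i ∈ (↑(U \ K) : Set V) := fun i => by simpa using hpU i
      have a1 : H.Adj (p.getVert i) y := ⟨hai.symm, hS i, hyS⟩
      have a2 : H.Adj y (p.getVert j) := ⟨haj, hyS, hS j⟩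
      have := dist_le ((p.take i).append (.cons a1 (.cons a2 (p.drop j))))
      rw [Walk.length_append, Walk.length_cons, Walk.length_cons, Walk.take_length,
        Walk.drop_length] at this
      omega
    by_cases hex : ∃ i, i ≤ p.length ∧ G.Adj y (p.getVert i)
    · have hmin := Nat.find_spec hex
      set i := Nat.find hex with hi
      have hsub : nbr G ((Finset.range (p.length + 1)).image p.getVert) y ⊆
          ({i, i + 1, i + 2} : Finset ℕ).image p.getVert := by
        intro v hv
        obtain ⟨hv, hadj⟩ := mem_nbr.1 hv
        obtain ⟨j, hj, rfl⟩ := Finset.mem_image.1 hv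
        rw [Finset.mem_range] at hj
        refine Finset.mem_image_of_mem _ ?_
        have h1 := hfar i j hmin.1 (by omega) hmin.2 hadj
        have h2 : i ≤ j := Nat.find_min' hex ⟨by omega, hadj⟩
        simp only [Finset.mem_insert, Finset.mem_singleton]
        omega
      exact (Finset.card_le_card hsub).trans (Finset.card_image_le.trans Finset.card_le_three)
    · have : nbr G ((Finset.range (p.length + 1)).image p.getVert) y = ∅ := by
        refine Finset.eq_empty_of_forall_notMem fun v hv => hex ?_
        obtain ⟨hv, hadj⟩ := mem_nbr.1 hv
        obtain ⟨j, hj, rfl⟩ := Finset.mem_image.1 hv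
        exact ⟨j, Nat.lt_succ_iff.1 (Finset.mem_range.1 hj), hadj⟩
      simp [this]

end EdgeSep

namespace EdgeSep
open Classical

variable {V : Type}

/-- The state of the growing process: `K` is the old core, `L` the last layer. -/
structure Core (G : SimpleGraph V) (U : Finset V) (s t : V) (K L : Finset V) : Prop where
  sub : K ∪ L ⊆ U
  disj : Disjoint K L
  ord : ∃ g, Ord G K s t g
  ord' : ∃ g, Ord G (K ∪ L) s t g
  two : ∀ v ∈ L, 2 ≤ (nbr G K v).card
  four : ∀ v ∈ U, v ∉ K ∪ L → (nbr G K v).card ≤ 4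
  cov : HasCover (Piece G U) (edg G (K ∪ L)) (772 * K.card + 484 * L.card)

lemma core_pair {G : SimpleGraph V} {U : Finset V} {s t : V} (h : G.Adj s t) (hs : s ∈ U)
    (ht : t ∈ U) : Core G U s t {s, t} ∅ := by
  have hU : ({s, t} : Finset V) ⊆ U := by
    intro v hv
    simp only [Finset.mem_insert, Finset.mem_singleton] at hv
    rcases hv with rfl | rfl <;> assumption
  have h2 : ({s, t} : Finset V).card ≤ 2 := Finset.card_le_two
  refine ⟨by simpa using hU, by simp, ord_pair h, by simpa using ord_pair h, by simp, ?_, ?_⟩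
  · intro v _ _
    exact nbr_card_le.trans (by omega)
  · rw [Finset.union_empty]
    refine (HasCover.edb (P := Piece G U) (fun e he => Or.inl ⟨e, he, rfl⟩) hU hU (c := 2)
      fun v _ => nbr_card_le.trans h2).mono (fun _ => id) (edg_subset_edb _ _) (by omega)

lemma Core.expand {G : SimpleGraph V} {U : Finset V} {s t : V} {K L : Finset V}
    (h : Core G U s t K L) (hL : ∃ v ∈ U, v ∉ K ∪ L ∧ 2 ≤ (nbr G (K ∪ L) v).card) :
    ∃ K' L', Core G U s t K' L' ∧ (K ∪ L).card < (K' ∪ L').card := by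
  let M : Finset V := U.filter fun v => v ∉ K ∪ L ∧ 2 ≤ (nbr G (K ∪ L) v).card
  have hM : ∀ v ∈ M, v ∈ U ∧ v ∉ K ∪ L ∧ 2 ≤ (nbr G (K ∪ L) v).card := fun v hv =>
    Finset.mem_filter.1 hv
  obtain ⟨x, hx, hx'⟩ := hL
  have hdisj : Disjoint (K ∪ L) M := Finset.disjoint_left.2 fun v hv hv' => (hM v hv').2.1 hv
  have hMU : M ⊆ U := fun v hv => (hM v hv).1
  obtain ⟨g, hg⟩ := h.ord
  obtain ⟨g', hg'⟩ := h.ord'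
  have hKU : K ⊆ U := Finset.union_subset_left h.sub
  have hLU : L ⊆ U := Finset.union_subset_right h.sub
  have hsing : ∀ e ∈ edg G U, Piece G U {e} := fun e he => Or.inl ⟨e, he, rfl⟩
  refine ⟨K ∪ L, M, ⟨Finset.union_subset h.sub hMU, hdisj, h.ord',
    hg'.add M (fun v hv => (hM v hv).2.1) fun v hv => (hM v hv).2.2, fun v hv => (hM v hv).2.2,
    ?_, ?_⟩, ?_⟩
  · intro v hv hvM
    rw [Finset.mem_union, not_or] at hvM
    by_contra hc
    exact hvM.2 (Finset.mem_filter.2 ⟨hv, hvM.1, by omega⟩)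
  · have c1 := hg'.cover_inside h.sub hMU (fun v hv => (hM v hv).2.1) fun v hv => (hM v hv).2.2
    have c2 := hg.cover_between hKU hLU hMU
      (Finset.disjoint_left.2 fun v hv hv' => (hM v hv').2.1 (Finset.mem_union_right _ hv))
      (fun v hv hv' => Finset.disjoint_left.1 h.disj hv' hv)
      (fun v hv hv' => (hM v hv).2.1 (Finset.mem_union_left _ hv')) h.two
    have c3 := HasCover.edb hsing hMU hKU (c := 4) fun v hv => h.four v (hM v hv).1 (hM v hv).2.1
    have hc := Finset.card_union_of_disjoint h.disj
    refine ((h.cov.union c1).union (c3.union c2)).mono (fun _ => id) ?_ (by omega)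
    intro e he
    rcases edg_union G (K ∪ L) M he with (he | he) | he
    · exact Or.inl (Or.inl he)
    · exact Or.inl (Or.inr he)
    · exact Or.inr (edb_union G M K L he)
  · rw [Finset.card_union_of_disjoint hdisj]
    have : 0 < M.card := Finset.card_pos.2 ⟨x, Finset.mem_filter.2 ⟨hx, hx'⟩⟩
    omega

lemma Core.ear {G : SimpleGraph V} {U : Finset V} {s t : V} {K L : Finset V}
    (h : Core G U s t K L) (hL : ∀ v ∈ U, v ∉ K ∪ L → (nbr G (K ∪ L) v).card ≤ 1)
    (hne : ∃ v ∈ U, v ∉ K ∪ L)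
    (hns : ∀ A B, IsSep G U A B → (A ∩ B).card ≤ 1 → U ⊆ A ∨ U ⊆ B) :
    ∃ K' L', Core G U s t K' L' ∧ (K ∪ L).card < (K' ∪ L').card := by
  obtain ⟨g, hg⟩ := h.ord'
  obtain ⟨y, hy, hyK⟩ := hne
  obtain ⟨f, n, u, u', hf, hfU, hu, hu', h0, h1, huu, h3⟩ :=
    exists_ear hg.hs hg.ht hg.adj.ne h.sub hy hyK hns
  set Q := (Finset.range (n + 1)).image f with hQ
  have hQmem : ∀ v ∈ Q, v ∈ U ∧ v ∉ K ∪ L := by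
    intro v hv
    obtain ⟨i, hi, rfl⟩ := Finset.mem_image.1 hv
    exact hfU i (Nat.lt_succ_iff.1 (Finset.mem_range.1 hi))
  have hdisj : Disjoint (K ∪ L) Q := Finset.disjoint_left.2 fun v hv hv' => (hQmem v hv').2 hv
  have hQU : Q ⊆ U := fun v hv => (hQmem v hv).1
  have hord : ∃ g', Ord G (K ∪ L ∪ Q) s t g' :=
    hg.ear hf (fun i hi => (hfU i hi).2) hu hu' h0 h1 huu
  have hsing : ∀ e ∈ edg G U, Piece G U {e} := fun e he => Or.inl ⟨e, he, rfl⟩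
  have hc := Finset.card_union_of_disjoint hdisj
  have hc' := Finset.card_union_of_disjoint h.disj
  refine ⟨K ∪ L ∪ Q, ∅, ⟨by simpa using Finset.union_subset h.sub hQU, by simp, hord,
    by simpa using hord, by simp, ?_, ?_⟩, ?_⟩
  · intro v hv hv'
    rw [Finset.union_empty, Finset.mem_union, not_or] at hv'
    have : nbr G (K ∪ L ∪ Q) v ⊆ nbr G (K ∪ L) v ∪ nbr G Q v := by
      intro w hw
      rw [mem_nbr, Finset.mem_union] at hw
      rw [Finset.mem_union, mem_nbr, mem_nbr]
      tauto
    have := Finset.card_le_card this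
    have := Finset.card_union_le (nbr G (K ∪ L) v) (nbr G Q v)
    have := hL v hv hv'.1
    have := h3 v hv hv'.1
    omega
  · rw [Finset.union_empty]
    have c1 := HasCover.edb hsing hQU hQU (c := 3) fun v hv => h3 v (hQmem v hv).1 (hQmem v hv).2
    have c2 := HasCover.edb hsing hQU h.sub (c := 1) fun v hv => hL v (hQmem v hv).1 (hQmem v hv).2
    refine (h.cov.union (c1.union c2)).mono (fun _ => id) ?_
      (by rw [hc, hc', Finset.card_empty]; omega)
    intro e he
    rcases edg_union G (K ∪ L) Q he with (he | he) | he
    · exact Or.inl he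
    · exact Or.inr (Or.inl (edg_subset_edb _ _ he))
    · exact Or.inr (Or.inr he)
  · rw [Finset.union_empty, hc]
    have : 0 < Q.card := Finset.card_pos.2 ⟨f 0, Finset.mem_image.2 ⟨0, by simp, rfl⟩⟩
    omega

lemma IsSep.edg_subset {G : SimpleGraph V} {U A B : Finset V} (hsep : IsSep G U A B) :
    edg G U ⊆ edg G A ∪ edg G B := by
  intro e he
  induction e using Sym2.ind with
  | _ v w =>
    obtain ⟨hadj, hv, hw⟩ := mk_mem_edg.1 he
    rw [← hsep.1, Finset.mem_union] at hv hw
    by_cases hvA : v ∈ A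
    · by_cases hwA : w ∈ A
      · exact Or.inl (mk_mem_edg.2 ⟨hadj, hvA, hwA⟩)
      · by_cases hvB : v ∈ B
        · exact Or.inr (mk_mem_edg.2 ⟨hadj, hvB, hw.resolve_left hwA⟩)
        · exact absurd hadj (hsep.2 v hvA hvB w (hw.resolve_left hwA) hwA)
    · by_cases hwB : w ∈ B
      · exact Or.inr (mk_mem_edg.2 ⟨hadj, hv.resolve_left hvA, hwB⟩)
      · exact absurd hadj.symm (hsep.2 w (hw.resolve_right hwB) hwB v (hv.resolve_left hvA) hvA)

/-- The edges of a graph on `n` vertices are separated by `O(n)` edges and cycles. -/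
theorem exists_cycle_cover (G : SimpleGraph V) : ∀ (n : ℕ) (U : Finset V), U.card = n →
    U.Nonempty → HasCover (Piece G U) (edg G U) (1544 * (U.card - 1)) := by
  intro n
  induction n using Nat.strong_induction_on with
  | _ n ih =>
    intro U hUn hU
    by_cases hE : ∃ s t, G.Adj s t ∧ s ∈ U ∧ t ∈ U
    swap
    · refine ⟨∅, by simp, by simp, fun e he => ?_⟩
      induction e using Sym2.ind with
      | _ v w => exact absurd ⟨v, w, mk_mem_edg.1 he⟩ hE
    obtain ⟨s, t, hst, hs, ht⟩ := hE
    by_cases hns : ∀ A B, IsSep G U A B → (A ∩ B).card ≤ 1 → U ⊆ A ∨ U ⊆ B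
    · have hbound : ∀ m, ∃ K L, Core G U s t K L ∧ (m ≤ (K ∪ L).card ∨ K ∪ L = U) := by
        intro m
        induction m with
        | zero => exact ⟨_, _, core_pair hst hs ht, Or.inl (by omega)⟩
        | succ m ihm =>
          obtain ⟨K, L, hC, hm⟩ := ihm
          by_cases hKL : K ∪ L = U
          · exact ⟨K, L, hC, Or.inr hKL⟩
          obtain hm := hm.resolve_right hKL
          have : ∃ K' L', Core G U s t K' L' ∧ (K ∪ L).card < (K' ∪ L').card := by
            by_cases hL : ∃ v ∈ U, v ∉ K ∪ L ∧ 2 ≤ (nbr G (K ∪ L) v).card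
            · exact hC.expand hL
            · refine hC.ear (fun v hv hv' => ?_) ?_ hns
              · by_contra hc
                exact hL ⟨v, hv, hv', by omega⟩
              · by_contra hc
                push Not at hc
                exact hKL (Finset.Subset.antisymm hC.sub hc)
          obtain ⟨K', L', hC', hlt⟩ := this
          exact ⟨K', L', hC', Or.inl (by omega)⟩
      obtain ⟨K, L, hC, h⟩ := hbound (U.card + 1)
      have hKL : K ∪ L = U := h.resolve_left fun h => by
        have := Finset.card_le_card hC.sub
        omega
      have hc := Finset.card_union_of_disjoint hC.disj
      rw [hKL] at hc
      have h2 : 2 ≤ U.card := Finset.one_lt_card.2 ⟨s, hs, t, ht, hst.ne⟩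
      exact hC.cov.mono (fun _ => id) (by rw [hKL]) (by omega)
    · push Not at hns
      obtain ⟨A, B, hsep, hcard, hA, hB⟩ := hns
      have hAU : A ⊆ U := hsep.1 ▸ Finset.subset_union_left
      have hBU : B ⊆ U := hsep.1 ▸ Finset.subset_union_right
      have hA' := Finset.card_lt_card (Finset.ssubset_iff_subset_ne.2 ⟨hAU, fun e => hA e.ge⟩)
      have hB' := Finset.card_lt_card (Finset.ssubset_iff_subset_ne.2 ⟨hBU, fun e => hB e.ge⟩)
      have hsum := Finset.card_union_add_card_inter A B
      rw [hsep.1] at hsum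
      have hAne : A.Nonempty := Finset.card_pos.1 (by omega)
      have hBne : B.Nonempty := Finset.card_pos.1 (by omega)
      refine ((ih _ (by omega) A rfl hAne).mono (P' := Piece G U) (fun _ => Piece.mono hAU)
        subset_rfl le_rfl |>.union ((ih _ (by omega) B rfl hBne).mono (fun _ => Piece.mono hBU)
        subset_rfl le_rfl)).mono (fun _ => id) ?_ (by omega)
      exact hsep.edg_subset

end EdgeSep

namespace EdgeSep
open Classical

variable {V : Type}

/-- The edge set of a single edge or of a subdivision of `H` in `G`. -/
def Brick {α : Type} (H : SimpleGraph α) (G : SimpleGraph V) (A : Set (Sym2 V)) : Prop :=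
  ∃ S : G.Subgraph, (IsSingleEdge S ∨ IsSubdivision H S.coe) ∧ S.edgeSet = A

lemma brick_single {α : Type} (H : SimpleGraph α) {G : SimpleGraph V} {e : Sym2 V}
    (he : e ∈ G.edgeSet) : Brick H G {e} := by
  induction e using Sym2.ind with
  | _ v w => exact ⟨G.subgraphOfAdj he, Or.inl ⟨v, w, he, rfl⟩, edgeSet_subgraphOfAdj _⟩

lemma exists_arcs {G : SimpleGraph V} {z x y : V} {p : G.Walk z z} (hp : p.IsCycle)
    (hx : x ∈ p.support) (hy : y ∈ p.support) (hxy : x ≠ y) :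
    ∃ P : Bool → G.Walk x y, (∀ i, (P i).IsPath) ∧ (∀ i, ∀ v ∈ (P i).support, v ∈ p.support) ∧
      ∀ e, e ∈ p.edges ↔ ∃ i, e ∈ (P i).edges := by
  have hc := hp.rotate hx
  have hsupp : ∀ v, v ∈ (p.rotate x hx).support ↔ v ∈ p.support := fun v =>
    p.mem_support_rotate_iff x hx
  have hedge : ∀ e, e ∈ (p.rotate x hx).edges ↔ e ∈ p.edges := fun e =>
    (p.rotate_edges x hx).mem_iff
  generalize p.rotate x hx = c at hc hsupp hedge
  cases c with
  | nil => exact absurd rfl hc.ne_nil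
  | cons hadj q =>
    rename_i w
    obtain ⟨hq, -⟩ := (Walk.cons_isCycle_iff _ _).1 hc
    have hyq : y ∈ q.support := by
      have := (hsupp y).2 hy
      rw [Walk.support_cons, List.mem_cons] at this
      exact this.resolve_left hxy.symm
    refine ⟨fun i => match i with
      | true => .cons hadj (q.takeUntil y hyq)
      | false => (q.dropUntil y hyq).reverse, ?_, ?_, ?_⟩
    · rintro (_ | _)
      · exact (hq.dropUntil hyq).reverse
      · exact (Walk.cons_isPath_iff _ _).2
          ⟨hq.takeUntil hyq, Walk.endpoint_notMem_support_takeUntil hq hyq hxy⟩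
    · rintro (_ | _) v hv
      · rw [← hsupp, Walk.support_cons, List.mem_cons]
        simp only [Walk.support_reverse, List.mem_reverse] at hv
        exact Or.inr (q.support_dropUntil_subset_support hyq hv)
      · rw [← hsupp, Walk.support_cons, List.mem_cons]
        simp only [Walk.support_cons, List.mem_cons] at hv
        exact hv.imp_right fun h => q.support_takeUntil_subset_support hyq h
    · intro e
      rw [← hedge, Walk.edges_cons, List.mem_cons, Bool.exists_bool]
      simp only [Walk.edges_reverse, List.mem_reverse, Walk.edges_cons, List.mem_cons]
      have : e ∈ q.edges ↔ e ∈ (q.takeUntil y hyq).edges ∨ e ∈ (q.dropUntil y hyq).edges := by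
        rw [← List.mem_append, ← Walk.edges_append, Walk.take_spec]
      tauto

/-- A path through disjoint tails. -/
lemma exists_through {G : SimpleGraph V} {T : Finset V} {a a' b b' : V} {Z : Set V}
    (hZT : ∀ v ∈ Z, v ∉ T) (p : G.Walk a b) (p' : G.Walk a' b') (hp : p.IsPath) (hp' : p'.IsPath)
    (hd : ∀ v ∈ p.support, v ∉ p'.support) (hpZ : ∀ v ∈ p.support, v ∈ Z → v = a)
    (hpZ' : ∀ v ∈ p'.support, v ∈ Z → v = a') (hpT : ∀ v ∈ p.support, v ∈ T → v = b)
    (hpT' : ∀ v ∈ p'.support, v ∈ T → v = b') (P : G.Walk a a') (hP : P.IsPath)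
    (hPZ : ∀ v ∈ P.support, v ∈ Z) :
    ∃ Q : G.Walk b b', Q.IsPath ∧ (∀ w ∈ Q.support, w ∈ T → w = b ∨ w = b') ∧
      ∀ e, e ∈ Q.edges ↔ e ∈ p.edges ∨ e ∈ P.edges ∨ e ∈ p'.edges := by
  have hmem : ∀ v, v ∈ (P.append p').support ↔ v ∈ P.support ∨ v ∈ p'.support := fun v =>
    Walk.mem_support_append_iff _ _
  have h1 : (P.append p').IsPath := by
    rw [Walk.isPath_def, Walk.support_append, List.nodup_append]
    refine ⟨hP.support_nodup, hp'.support_nodup.tail, ?_⟩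
    rintro v hv w hw rfl
    obtain rfl := hpZ' v (List.mem_of_mem_tail hw) (hPZ v hv)
    have := hp'.support_nodup
    rw [← Walk.cons_tail_support, List.nodup_cons] at this
    exact this.1 hw
  refine ⟨p.reverse.append (P.append p'), ?_, ?_, ?_⟩
  · rw [Walk.isPath_def, Walk.support_append, List.nodup_append]
    refine ⟨hp.reverse.support_nodup, h1.support_nodup.tail, ?_⟩
    rintro v hv w hw rfl
    rw [Walk.support_reverse, List.mem_reverse] at hv
    rcases (hmem v).1 (List.mem_of_mem_tail hw) with h | h
    · obtain rfl := hpZ v hv (hPZ v h)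
      have := h1.support_nodup
      rw [← Walk.cons_tail_support, List.nodup_cons] at this
      exact this.1 hw
    · exact hd v hv h
  · intro w hw hwT
    rw [Walk.mem_support_append_iff, hmem, Walk.support_reverse, List.mem_reverse] at hw
    rcases hw with h | h | h
    exacts [Or.inl (hpT w h hwT), absurd hwT (hZT w (hPZ w h)), Or.inr (hpT' w h hwT)]
  · intro e
    rw [Walk.edges_append, Walk.edges_append, List.mem_append, List.mem_append,
      Walk.edges_reverse, List.mem_reverse]

lemma exists_three_paths [Finite V] {G : SimpleGraph V} {U : Finset V} {X Y : Finset V}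
    (hX : X ⊆ U) (hY : Y ⊆ U) (hX3 : 3 ≤ X.card) (hY3 : 3 ≤ Y.card)
    (hns : ∀ A B, IsSep G U A B → (A ∩ B).card ≤ 2 → U ⊆ A ∨ U ⊆ B) :
    ∃ a b C, LinkedBy G (↑X) (↑Y) (ι := Fin 3) a b C := by
  obtain ⟨a, b, C, hC, h⟩ := menger (restr G ↑U) ↑X ↑Y (Fin 3) fun S hS => by
    by_contra hcard
    rw [Fintype.card_fin] at hcard
    let R : Finset V := U.filter fun v => Reach (restr G ↑U) ↑X ↑S v
    have hRS : ∀ v ∈ R, v ∈ U ∧ Reach (restr G ↑U) ↑X ↑S v := fun v hv => Finset.mem_filter.1 hv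
    have hRU : R ⊆ U := fun v hv => (hRS v hv).1
    have h_inter : ((R ∪ S ∩ U) ∩ (U \ R)) ⊆ S := by
      intro v hv
      simp only [Finset.mem_inter, Finset.mem_union, Finset.mem_sdiff] at hv
      tauto
    have hsep : IsSep G U (R ∪ S ∩ U) (U \ R) := by
      refine ⟨?_, ?_⟩
      · ext v
        have := @hRU v
        simp only [Finset.mem_inter, Finset.mem_union, Finset.mem_sdiff]
        tauto
      · intro v hv hvB w hw hwA hadj
        have hvR : v ∈ R := by
          by_contra hc
          refine hvB (Finset.mem_sdiff.2 ⟨?_, hc⟩)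
          rcases Finset.mem_union.1 hv with h | h
          exacts [hRU h, (Finset.mem_inter.1 h).2]
        have hwU := (Finset.mem_sdiff.1 hw).1
        have hwS : w ∉ S := fun h =>
          hwA (Finset.mem_union_right _ (Finset.mem_inter.2 ⟨h, hwU⟩))
        refine (Finset.mem_sdiff.1 hw).2 (Finset.mem_filter.2 ⟨hwU, ?_⟩)
        exact Reach.adj (hRS v hvR).2 ⟨hadj, hRU hvR, hwU⟩ hwS
    rcases hns _ _ hsep ((Finset.card_le_card h_inter).trans (by omega)) with h | h
    · obtain ⟨y, hy, hyS⟩ := Finset.exists_mem_notMem_of_card_lt_card (s := S) (t := Y) (by omega)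
      have := Finset.mem_union.1 (h (hY hy))
      exact hS y hy (hRS y (this.resolve_right fun h => hyS (Finset.mem_inter.1 h).1)).2
    · obtain ⟨x, hx, hxS⟩ := Finset.exists_mem_notMem_of_card_lt_card (s := S) (t := X) (by omega)
      exact (Finset.mem_sdiff.1 (h (hX hx))).2
        (Finset.mem_filter.2 ⟨hX hx, Reach.of_mem hx hxS⟩)
  refine ⟨a, b, C, hC, fun i => ⟨(h i).1, (h i).2.1, ?_⟩⟩
  obtain ⟨p, hp, h1, h2⟩ := (h i).2.2
  exact ⟨p.mapLe (restr_le G _), by simpa using hp, by simpa using h1, h2⟩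

/-- Replace a piece outside a good set `T` by subdivisions of `H`. -/
lemma Good.refine_piece [Finite V] {α : Type} [Fintype α] {H : SimpleGraph α} {u v : α}
    (huv : H.Adj u v) {G : SimpleGraph V} {U T : Finset V} (hTU : T ⊆ U)
    (hT : Good G T (2 * Fintype.card α ^ 2))
    (hns : ∀ A B, IsSep G U A B → (A ∩ B).card ≤ 2 → U ⊆ A ∨ U ⊆ B) {Z : Set (Sym2 V)}
    (hZ : Piece G (U \ T) Z) :
    ∃ F : Finset (Set (Sym2 V)), F.card ≤ 18 ∧ (∀ B ∈ F, Brick H G B) ∧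
      ∀ e ∈ Z, ∀ e' ∉ Z, e' ∈ {e' : Sym2 V | ∃ w ∈ e', w ∉ T} → ∃ B ∈ F, e ∈ B ∧ e' ∉ B := by
  rcases hZ with ⟨e, he, rfl⟩ | ⟨z, p, hp, hpU, rfl⟩
  · refine ⟨{{e}}, by simp, ?_, ?_⟩
    · simpa using brick_single H he.1
    · rintro e₁ rfl e' he' -
      exact ⟨_, Finset.mem_singleton_self _, rfl, he'⟩
  have hX3 : 3 ≤ p.support.toFinset.card := by
    have h1 : p.support.tail.toFinset ⊆ p.support.toFinset := fun v hv => by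
      rw [List.mem_toFinset] at hv ⊢
      exact List.mem_of_mem_tail hv
    have h2 := List.toFinset_card_of_nodup hp.support_nodup
    have h3 := hp.three_le_length
    have h4 := Finset.card_le_card h1
    rw [h2, List.length_tail, Walk.length_support] at h4
    omega
  have hk : 1 ≤ Fintype.card α := Fintype.card_pos_iff.2 ⟨u⟩
  have hY3 : 3 ≤ T.card := by
    obtain ⟨x, hx⟩ := hT.nonempty
    have h1 := hT.deg x hx
    have h2 := nbr_card_le (G := G) (U := T) (v := x)
    have h3 : 1 ≤ Fintype.card α ^ 2 := Nat.one_le_pow _ _ hk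
    omega
  obtain ⟨a, b, C, hC, h⟩ := exists_three_paths (X := p.support.toFinset) (Y := T)
    (fun v hv => (Finset.mem_sdiff.1 (hpU v (List.mem_toFinset.1 hv))).1) hTU hX3 hY3 hns
  choose ha hb r hr hrC hrX hrT using h
  simp only [List.coe_toFinset, Set.mem_ofPred_eq, Finset.mem_coe] at ha hb hrX hrT
  have hdis : ∀ i j, i ≠ j → ∀ v ∈ (r i).support, v ∉ (r j).support := fun i j hij v hv hv' =>
    Set.disjoint_left.1 (hC hij) ((hrC i v).1 hv) ((hrC j v).1 hv')
  have hane : ∀ i j, i ≠ j → a i ≠ a j := fun i j hij e =>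
    Set.disjoint_left.1 (hC hij) ((hrC i _).1 (r i).start_mem_support)
      (e.symm ▸ (hrC j _).1 (r j).start_mem_support)
  have hbne : ∀ i j, i ≠ j → b i ≠ b j := fun i j hij e =>
    Set.disjoint_left.1 (hC hij) ((hrC i _).1 (r i).end_mem_support)
      (e.symm ▸ (hrC j _).1 (r j).end_mem_support)
  have hex : ∀ i j, i ≠ j → ∃ B : Bool → Set (Sym2 V), (∀ l, Brick H G (B l)) ∧
      (∀ e ∈ p.edges, ∃ l, e ∈ B l) ∧ ∀ l, ∀ e ∈ B l, e ∈ (r i).edges ∨ e ∈ p.edges ∨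
        e ∈ (r j).edges ∨ ∀ w ∈ e, w ∈ T := by
    intro i j hij
    obtain ⟨P, hP, hPp, hPe⟩ := exists_arcs hp (ha i) (ha j) (hane i j hij)
    have : ∀ l, ∃ A : G.Subgraph, IsSubdivision H A.coe ∧ (∀ e ∈ (P l).edges, e ∈ A.edgeSet) ∧
        ∀ e ∈ A.edgeSet, e ∈ (r i).edges ∨ e ∈ p.edges ∨ e ∈ (r j).edges ∨ ∀ w ∈ e, w ∈ T := by
      intro l
      obtain ⟨Q, hQ, hQT, hQe⟩ := exists_through (T := T) (Z := {v | v ∈ p.support})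
        (fun v hv => (Finset.mem_sdiff.1 (hpU v hv)).2) (r i) (r j) (hr i) (hr j) (hdis i j hij)
        (fun v hv => hrX i v ((hrC i v).1 hv)) (fun v hv => hrX j v ((hrC j v).1 hv))
        (fun v hv => hrT i v ((hrC i v).1 hv)) (fun v hv => hrT j v ((hrC j v).1 hv))
        (P l) (hP l) (hPp l)
      obtain ⟨A, hA, hA1, hA2⟩ := hT.exists_subdivision huv (hb i) (hb j) (hbne i j hij) Q hQ hQT
      refine ⟨A, hA, fun e he => hA1 e ((hQe e).2 (Or.inr (Or.inl he))), fun e he => ?_⟩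
      rcases hA2 e he with h | h
      · rcases (hQe e).1 h with h | h | h
        exacts [Or.inl h, Or.inr (Or.inl ((hPe e).2 ⟨l, h⟩)), Or.inr (Or.inr (Or.inl h))]
      · exact Or.inr (Or.inr (Or.inr h))
    choose A hA hA1 hA2 using this
    refine ⟨fun l => (A l).edgeSet, fun l => ⟨A l, Or.inr (hA l), rfl⟩, fun e he => ?_,
      fun l e he => hA2 l e he⟩
    obtain ⟨l, hl⟩ := (hPe e).1 he
    exact ⟨l, hA1 l e hl⟩
  choose! B hB hBp hBe using hex
  let I : Finset (Fin 3 × Fin 3 × Bool) := Finset.univ.filter fun x => x.1 ≠ x.2.1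
  refine ⟨I.image fun x => B x.1 x.2.1 x.2.2, ?_, ?_, ?_⟩
  · exact Finset.card_image_le.trans ((Finset.card_le_univ _).trans (by simp))
  · intro A hA
    obtain ⟨x, hx, rfl⟩ := Finset.mem_image.1 hA
    exact hB _ _ (Finset.mem_filter.1 hx).2 _
  · rintro e he e' he' ⟨w, hw, hwT⟩
    have hone : ∀ i j, i ≠ j → e' ∈ (r i).edges → e' ∉ (r j).edges := fun i j hij h h' =>
      hdis i j hij w (Walk.mem_support_of_mem_edges h hw) (Walk.mem_support_of_mem_edges h' hw)
    obtain ⟨i, j, hij, hi, hj⟩ : ∃ i j, i ≠ j ∧ e' ∉ (r i).edges ∧ e' ∉ (r j).edges := by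
      by_cases h0 : e' ∈ (r 0).edges
      · exact ⟨1, 2, by decide, hone 0 1 (by decide) h0, hone 0 2 (by decide) h0⟩
      · by_cases h1 : e' ∈ (r 1).edges
        · exact ⟨0, 2, by decide, h0, hone 1 2 (by decide) h1⟩
        · exact ⟨0, 1, by decide, h0, h1⟩
    obtain ⟨l, hl⟩ := hBp i j hij e he
    refine ⟨_, Finset.mem_image.2 ⟨(i, j, l), Finset.mem_filter.2 ⟨Finset.mem_univ _, hij⟩, rfl⟩,
      hl, fun hmem => ?_⟩
    rcases hBe i j hij l e' hmem with h | h | h | h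
    exacts [hi h, he' h, hj h, hwT (h w hw)]

end EdgeSep

namespace EdgeSep
open Classical

variable {V : Type}

lemma sum_biUnion_le {ι : Type*} (s : Finset ι) (t : ι → Finset V) (w : V → ℕ) :
    ∑ v ∈ s.biUnion t, w v ≤ ∑ i ∈ s, ∑ v ∈ t i, w v := by
  induction s using Finset.induction_on with
  | empty => simp
  | insert i s hi ih =>
    rw [Finset.biUnion_insert, Finset.sum_insert hi]
    have := Finset.sum_union_inter (s₁ := t i) (s₂ := s.biUnion t) (f := w)
    omega

/-- A greedy balanced partition of a weighted set into twelve parts. -/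
lemma exists_balanced (w : V → ℕ) (n : ℕ) (U : Finset V) (hw : ∀ v ∈ U, w v ≤ n) :
    ∃ c : V → Fin 12, ∀ j, 12 * ∑ v ∈ U with c v = j, w v ≤ ∑ v ∈ U, w v + 12 * n := by
  induction U using Finset.induction_on with
  | empty => exact ⟨fun _ => 0, by simp⟩
  | insert a U ha ih =>
    obtain ⟨c, hc⟩ := ih fun v hv => hw v (Finset.mem_insert_of_mem hv)
    have hsum : ∑ j : Fin 12, ∑ v ∈ U with c v = j, w v = ∑ v ∈ U, w v :=
      Finset.sum_fiberwise U c w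
    obtain ⟨j, -, hj⟩ := Finset.exists_min_image Finset.univ
      (fun j => ∑ v ∈ U with c v = j, w v) ⟨(0 : Fin 12), Finset.mem_univ _⟩
    have hmin : 12 * ∑ v ∈ U with c v = j, w v ≤ ∑ v ∈ U, w v := by
      rw [← hsum]
      simpa using Finset.card_nsmul_le_sum Finset.univ
        (fun j => ∑ v ∈ U with c v = j, w v) _ hj
    have hupd : ∀ i, (U.filter fun v => Function.update c a j v = i) = U.filter fun v => c v = i := by
      intro i
      refine Finset.filter_congr fun v hv => ?_
      rw [Function.update_of_ne (ne_of_mem_of_not_mem hv ha)]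
    refine ⟨Function.update c a j, fun i => ?_⟩
    rw [Finset.filter_insert, Finset.sum_insert ha, Function.update_self, hupd]
    have h1 := hc i
    have h2 := hw a (Finset.mem_insert_self _ _)
    split_ifs with h
    · subst h
      rw [Finset.sum_insert fun h => ha (Finset.mem_filter.1 h).1]
      omega
    · omega

lemma vol_sdiff {G : SimpleGraph V} {U R : Finset V} (hR : R ⊆ U) :
    vol G U ≤ vol G (U \ R) + 2 * ∑ v ∈ R, (nbr G U v).card := by
  induction R using Finset.induction_on with
  | empty => simp
  | insert a R ha ih =>
    have h1 := ih ((Finset.subset_insert _ _).trans hR)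
    have h2 := vol_erase (G := G) (Finset.mem_sdiff.2 ⟨hR (Finset.mem_insert_self _ _), ha⟩)
    have h3 := Finset.card_le_card (nbr_mono (G := G) (Finset.sdiff_subset (s := U) (t := R)) a)
    rw [Finset.sum_insert ha, Finset.sdiff_insert]
    omega

lemma IsSep.symm {G : SimpleGraph V} {U A B : Finset V} (h : IsSep G U A B) : IsSep G U B A :=
  ⟨by rw [Finset.union_comm, h.1], fun b hb hbA a ha haB hadj => h.2 a ha haB b hb hbA hadj.symm⟩

lemma IsSep.insert {G : SimpleGraph V} {U A B : Finset V} (h : IsSep G U A B) {x : V}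
    (hx : x ∈ A) : IsSep G U A (insert x B) := by
  refine ⟨?_, fun a ha haB b hb hbA => ?_⟩
  · rw [Finset.union_insert, h.1, Finset.insert_eq_of_mem]
    exact h.1 ▸ Finset.mem_union_left _ hx
  · rw [Finset.mem_insert, not_or] at haB
    exact h.2 a ha haB.2 b ((Finset.mem_insert.1 hb).resolve_left fun h => hbA (h ▸ hx)) hbA

/-- A nontrivial separation of order at most two can be made to have order two. -/
lemma IsSep.exists_order_two {G : SimpleGraph V} {U : Finset V} (hU : 4 ≤ U.card) :
    ∀ (d : ℕ) (A B : Finset V), IsSep G U A B → (A ∩ B).card + d = 2 → ¬U ⊆ A → ¬U ⊆ B →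
      ∃ A B, IsSep G U A B ∧ (A ∩ B).card = 2 ∧ ¬U ⊆ A ∧ ¬U ⊆ B := by
  have step : ∀ A B : Finset V, IsSep G U A B → ¬U ⊆ A → 1 < (A \ B).card →
      ∃ B', IsSep G U A B' ∧ (A ∩ B').card = (A ∩ B).card + 1 ∧ ¬U ⊆ A ∧ ¬U ⊆ B' := by
    intro A B h hA hc
    obtain ⟨x, hx, y, hy, hxy⟩ := Finset.one_lt_card.1 hc
    rw [Finset.mem_sdiff] at hx hy
    refine ⟨Insert.insert x B, h.insert hx.1, ?_, hA, fun hB => ?_⟩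
    · rw [Finset.inter_insert_of_mem hx.1,
        Finset.card_insert_of_notMem fun h => hx.2 (Finset.mem_inter.1 h).2]
    · have := Finset.mem_insert.1 (hB (h.1 ▸ Finset.mem_union_left _ hy.1))
      exact this.elim (fun h => hxy h.symm) hy.2
  intro d
  induction d with
  | zero => exact fun A B h hc hA hB => ⟨A, B, h, hc, hA, hB⟩
  | succ d ih =>
    intro A B h hc hA hB
    have h1 := Finset.card_union_add_card_inter A B
    have h2 := Finset.card_sdiff_add_card_inter A B
    have h3 := Finset.card_sdiff_add_card_inter B A
    rw [Finset.inter_comm B A] at h3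
    rw [h.1] at h1
    by_cases hc' : 1 < (A \ B).card
    · obtain ⟨B', h', hc1, hA', hB'⟩ := step A B h hA hc'
      exact ih A B' h' (by omega) hA' hB'
    · by_cases hc'' : 1 < (B \ A).card
      · obtain ⟨A', h', hc1, hB', hA'⟩ := step B A h.symm hB hc''
        rw [Finset.inter_comm B A] at hc1
        exact ih A' B h'.symm (by rw [Finset.inter_comm]; omega) hA' hB'
      · omega

lemma HasCover.vol {P : Set (Sym2 V) → Prop} {G : SimpleGraph V} {U : Finset V}
    (hP : ∀ e ∈ edg G U, P {e}) : HasCover P (edg G U) (vol G U) := by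
  let E : Finset (Sym2 V) := U.biUnion fun v => (nbr G U v).image fun w => s(v, w)
  have hmem : ∀ e, e ∈ E ↔ e ∈ edg G U := by
    intro e
    induction e using Sym2.ind with
    | _ x y =>
      rw [mk_mem_edg]
      simp only [E, Finset.mem_biUnion, Finset.mem_image, mem_nbr, Sym2.eq_iff]
      constructor
      · rintro ⟨v, hv, w, ⟨hw, h⟩, ⟨rfl, rfl⟩ | ⟨rfl, rfl⟩⟩
        exacts [⟨h, hv, hw⟩, ⟨h.symm, hw, hv⟩]
      · rintro ⟨h, hx, hy⟩
        exact ⟨x, hx, y, ⟨hy, h⟩, Or.inl ⟨rfl, rfl⟩⟩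
  refine (HasCover.singles E fun e he => hP e ((hmem e).1 he)).mono (fun _ => id)
    (fun e he => (hmem e).2 he) ?_
  exact Finset.card_biUnion_le.trans (Finset.sum_le_sum fun v _ => Finset.card_image_le)

/-- Dense graphs without small separations are covered via disjoint unions of good sets. -/
lemma hasCover_dense [Finite V] {α : Type} [Fintype α] {H : SimpleGraph α} {u v : α}
    (huv : H.Adj u v) {G : SimpleGraph V} {U : Finset V} (hU : U.Nonempty)
    (hd : (1600 * Fintype.card α ^ 2 + 12) * U.card ≤ vol G U)
    (hns : ∀ A B, IsSep G U A B → (A ∩ B).card ≤ 2 → U ⊆ A ∨ U ⊆ B) :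
    HasCover (Brick H G) (edg G U) (1728 * (18 * (1544 * U.card))) := by
  have hk : 1 ≤ Fintype.card α := Fintype.card_pos_iff.2 ⟨u⟩
  have hk2 : 1 ≤ Fintype.card α ^ 2 := Nat.one_le_pow _ _ hk
  obtain ⟨c, hc⟩ := exists_balanced (fun v => (nbr G U v).card) U.card U fun v _ => nbr_card_le
  have hgood : ∀ Q : Fin 3 → Fin 12, ∃ T ⊆ U, (∀ v ∈ T, ∀ i, c v ≠ Q i) ∧
      Good G T (2 * Fintype.card α ^ 2) := by
    intro Q
    let R : Finset V := Finset.univ.biUnion fun i => U.filter fun v => c v = Q i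
    have hRU : R ⊆ U := Finset.biUnion_subset.2 fun i _ => Finset.filter_subset _ _
    have h1 : 12 * ∑ v ∈ R, (nbr G U v).card ≤ 3 * (vol G U + 12 * U.card) := by
      calc 12 * ∑ v ∈ R, (nbr G U v).card
          ≤ 12 * ∑ i : Fin 3, ∑ v ∈ U with c v = Q i, (nbr G U v).card :=
            Nat.mul_le_mul_left _ (sum_biUnion_le _ _ _)
        _ = ∑ i : Fin 3, 12 * ∑ v ∈ U with c v = Q i, (nbr G U v).card := Finset.mul_sum _ _ _
        _ ≤ ∑ i : Fin 3, (vol G U + 12 * U.card) := Finset.sum_le_sum fun i _ => hc (Q i)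
        _ = 3 * (vol G U + 12 * U.card) := by simp
    have h2 := vol_sdiff (G := G) hRU
    have h3 : 400 * (2 * Fintype.card α ^ 2) * U.card ≤ vol G (U \ R) := by nlinarith
    have h4 : (U \ R).card ≤ U.card := Finset.card_le_card Finset.sdiff_subset
    have h5 : (U \ R).Nonempty := by
      by_contra h
      rw [Finset.not_nonempty_iff_eq_empty] at h
      rw [h] at h3
      have : 0 < 400 * (2 * Fintype.card α ^ 2) * U.card := by
        have := hU.card_pos
        positivity
      exact absurd (this.trans_le h3) (by simp [vol])
    obtain ⟨T, hT, hT'⟩ := exists_good (G := G) (κ := 2 * Fintype.card α ^ 2) (by omega) h5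
      ((Nat.mul_le_mul_left _ h4).trans h3)
    refine ⟨T, hT.trans Finset.sdiff_subset, fun v hv i hi => ?_, hT'⟩
    obtain ⟨hvU, hvR⟩ := Finset.mem_sdiff.1 (hT hv)
    exact hvR (Finset.mem_biUnion.2 ⟨i, Finset.mem_univ _, Finset.mem_filter.2 ⟨hvU, hi⟩⟩)
  choose T hTU hTc hT using hgood
  have hfam : ∀ Q, ∃ F : Finset (Set (Sym2 V)), F.card ≤ 18 * (1544 * U.card) ∧
      (∀ B ∈ F, Brick H G B) ∧ ∀ e ∈ edg G (U \ T Q), ∀ e', e' ≠ e →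
        e' ∈ {e' : Sym2 V | ∃ w ∈ e', w ∉ T Q} → ∃ B ∈ F, e ∈ B ∧ e' ∉ B := by
    intro Q
    rcases (U \ T Q).eq_empty_or_nonempty with h | h
    · refine ⟨∅, by simp, by simp, fun e he => ?_⟩
      rw [h] at he
      induction e using Sym2.ind with
      | _ x y => exact absurd (mk_mem_edg.1 he).2.1 (Finset.notMem_empty _)
    · have h1 := exists_cycle_cover G _ _ rfl h
      have h2 : (U \ T Q).card ≤ U.card := Finset.card_le_card Finset.sdiff_subset
      exact (h1.mono (fun _ => id) subset_rfl (by omega)).refine_on fun Z hZ =>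
        (hT Q).refine_piece huv (hTU Q) hns hZ
  choose F hF1 hF2 hF3 using hfam
  refine ⟨Finset.univ.biUnion F, ?_, fun A hA => ?_, fun e he e' hne => ?_⟩
  · refine Finset.card_biUnion_le.trans ((Finset.sum_le_sum fun Q _ => hF1 Q).trans ?_)
    simp
  · obtain ⟨Q, -, hA⟩ := Finset.mem_biUnion.1 hA
    exact hF2 Q A hA
  · induction e using Sym2.ind with
    | _ x y =>
      induction e' using Sym2.ind with
      | _ x' y' =>
        let Q : Fin 3 → Fin 12 := ![c x, c y, c x']
        obtain ⟨hadj, hx, hy⟩ := mk_mem_edg.1 he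
        have hxT : x ∉ T Q := fun h => hTc Q x h 0 rfl
        have hyT : y ∉ T Q := fun h => hTc Q y h 1 rfl
        have hxT' : x' ∉ T Q := fun h => hTc Q x' h 2 rfl
        obtain ⟨B, hB, h⟩ := hF3 Q s(x, y) (mk_mem_edg.2 ⟨hadj, Finset.mem_sdiff.2 ⟨hx, hxT⟩,
          Finset.mem_sdiff.2 ⟨hy, hyT⟩⟩) s(x', y') hne ⟨x', Sym2.mem_mk_left _ _, hxT'⟩
        exact ⟨B, Finset.mem_biUnion.2 ⟨Q, Finset.mem_univ _, hB⟩, h⟩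

theorem exists_brick_cover [Finite V] {α : Type} [Fintype α] {H : SimpleGraph α} {u v : α}
    (huv : H.Adj u v) (G : SimpleGraph V) : ∀ (n : ℕ) (U : Finset V), U.card = n → 3 ≤ n →
      HasCover (Brick H G) (edg G U) (10 ^ 9 * Fintype.card α ^ 2 * (n - 2)) := by
  have hk : 1 ≤ Fintype.card α := Fintype.card_pos_iff.2 ⟨u⟩
  have hk2 : 1 ≤ Fintype.card α ^ 2 := Nat.one_le_pow _ _ hk
  intro n
  induction n using Nat.strong_induction_on with
  | _ n ih =>
    intro U hUn hn
    generalize hK : Fintype.card α ^ 2 = K at hk2 ih ⊢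
    obtain ⟨m, rfl⟩ := Nat.exists_eq_add_of_le' hn
    by_cases hd : vol G U < (1600 * K + 12) * (m + 3)
    · refine (HasCover.vol fun e he => brick_single H he.1).mono (fun _ => id) subset_rfl ?_
      refine hd.le.trans ?_
      rw [show m + 3 - 2 = m + 1 by omega]
      nlinarith [Nat.zero_le (K * m)]
    · push Not at hd
      have hbig : 4 ≤ U.card := by
        have h1 : vol G U ≤ U.card * U.card := by
          rw [← smul_eq_mul]
          exact Finset.sum_le_card_nsmul _ _ _ fun v _ => nbr_card_le
        rw [hUn] at h1 ⊢
        have h2 := Nat.le_of_mul_le_mul_right (hd.trans h1) (by omega)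
        omega
      by_cases hns : ∀ A B, IsSep G U A B → (A ∩ B).card ≤ 2 → U ⊆ A ∨ U ⊆ B
      · refine (hasCover_dense huv (Finset.card_pos.1 (by omega)) (by rwa [hK, hUn]) hns).mono
          (fun _ => id) subset_rfl ?_
        rw [hUn, show m + 3 - 2 = m + 1 by omega]
        nlinarith [Nat.mul_le_mul_right (m + 1) hk2]
      · push Not at hns
        obtain ⟨A', B', hsep', hc', hA', hB'⟩ := hns
        obtain ⟨A, B, hsep, hc, hA, hB⟩ :=
          IsSep.exists_order_two hbig (2 - (A' ∩ B').card) A' B' hsep' (by omega) hA' hB'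
        have hAU : A ⊆ U := hsep.1 ▸ Finset.subset_union_left
        have hBU : B ⊆ U := hsep.1 ▸ Finset.subset_union_right
        have h1 := Finset.card_union_add_card_inter A B
        rw [hsep.1] at h1
        have h2 : A.card < U.card := Finset.card_lt_card ⟨hAU, hA⟩
        have h3 : B.card < U.card := Finset.card_lt_card ⟨hBU, hB⟩
        refine ((ih _ (by omega) A rfl (by omega)).union (ih _ (by omega) B rfl (by omega))).mono
          (fun _ => id) hsep.edg_subset ?_
        rw [← Nat.mul_add]
        exact Nat.mul_le_mul_left _ (by omega)

theorem hasCover_univ {α : Type} [Fintype α] {H : SimpleGraph α} {u v : α}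
    (huv : H.Adj u v) [Fintype V] (G : SimpleGraph V) :
    HasCover (Brick H G) G.edgeSet (10 ^ 9 * Fintype.card α ^ 2 * Fintype.card V) := by
  have huniv : G.edgeSet ⊆ edg G Finset.univ := fun e he => ⟨he, fun v _ => Finset.mem_univ v⟩
  by_cases hn : 3 ≤ Fintype.card V
  · exact (exists_brick_cover huv G _ Finset.univ rfl hn).mono (fun _ => id) huniv
      (Nat.mul_le_mul_left _ (Nat.sub_le _ _))
  · have hk : 1 ≤ Fintype.card α := Fintype.card_pos_iff.2 ⟨u⟩
    have hk2 : 1 ≤ Fintype.card α ^ 2 := Nat.one_le_pow _ _ hk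
    refine (HasCover.vol fun e he => brick_single H he.1).mono (fun _ => id) huniv ?_
    have h1 : vol G (Finset.univ : Finset V) ≤ Fintype.card V * Fintype.card V := by
      rw [← smul_eq_mul]
      exact Finset.sum_le_card_nsmul _ _ _ fun v _ => nbr_card_le
    refine h1.trans (Nat.mul_le_mul_right _ ?_)
    omega

end EdgeSep

/-- There is an absolute constant `C > 0` such that for every graph `H` with at least one
edge, every graph `G` on `n` vertices admits a family of subgraphs, each a single edge or
a subdivision of `H`, of size at most `C·|H|²·n` that strongly separates the edges of `G`. -/
theorem edge_separation_by_subdivisions :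
    ∃ C : ℝ, 0 < C ∧
      ∀ (α β : Type) [Fintype α] [Fintype β] (H : SimpleGraph α) (G : SimpleGraph β),
        H.edgeSet.Nonempty →
        ∃ F : Set G.Subgraph, F.Finite ∧
          (∀ A ∈ F, IsSingleEdge A ∨ IsSubdivision H A.coe) ∧
          StronglySeparatesEdges G F ∧
          (F.ncard : ℝ) ≤ C * (Fintype.card α : ℝ) ^ 2 * (Fintype.card β : ℝ) := by
  refine ⟨10 ^ 9, by norm_num, fun α β _ _ H G ⟨e, he⟩ => ?_⟩
  induction e using Sym2.ind with
  | _ u v =>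
    obtain ⟨F, hF, hP, hsep⟩ := EdgeSep.hasCover_univ he G
    choose! f hf1 hf2 using hP
    refine ⟨f '' ↑F, F.finite_toSet.image f, ?_, fun e he e' _ hne => ?_, ?_⟩
    · rintro _ ⟨A, hA, rfl⟩
      exact hf1 A hA
    · obtain ⟨A, hA, h⟩ := hsep e he e' hne.symm
      exact ⟨f A, ⟨A, hA, rfl⟩, by rwa [hf2 A hA]⟩
    · have h1 : (f '' (F : Set (Set (Sym2 β)))).ncard ≤ F.card :=
        (Set.ncard_image_le F.finite_toSet).trans_eq (Set.ncard_coe_finset F)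
      exact_mod_cast h1.trans hF
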